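/- Let K ⊆ ℂ^N be a compact polynomially convex set and let λ₁, …, λ_u be pairwise disjoint rectifiable arcs, λ_j = γ_j([0,1]) with γ_j : [0,1] → ℂ^N injective, continuous and of bounded variation, such that for each j the arc λ_j intersects K precisely in its two endpoints γ_j(0), γ_j(1) ∈ K. Suppose that for each j there is a complex affine line L_j ⊆ ℂ^N and parameters 0 ≤ s_j < t_j ≤ 1 with γ_j((s_j,t_j)) ⊆ L_j but λ_j not entirely contained in L_j. Then K ∪ λ₁ ∪ ⋯ ∪ λ_u is polynomially convex. -/

import Mathlib

open Set MvPolynomial Topology MeasureTheory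

noncomputable section

/-- The polynomial hull of a set `X ⊆ ℂ^N`: points where every polynomial in the
coordinates is dominated by its supremum over `X`. -/
def polyHull {N : ℕ} (X : Set (Fin N → ℂ)) : Set (Fin N → ℂ) :=
  {z | ∀ p : MvPolynomial (Fin N) ℂ, ‖eval z p‖ ≤ ⨆ x ∈ X, ‖eval x p‖}

/-- A set is polynomially convex if it equals its polynomial hull. -/
def IsPolynomiallyConvex {N : ℕ} (X : Set (Fin N → ℂ)) : Prop :=
  polyHull X = X

/-- `J` is an arc from `a` to `b`: the image of an injective continuous map on `[0,1]`
(equivalently, in a Hausdorff space, a subset homeomorphic to `[0,1]`). -/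
def IsArcFrom {α : Type*} [TopologicalSpace α] (J : Set α) (a b : α) : Prop :=
  ∃ γ : ℝ → α, ContinuousOn γ (Icc 0 1) ∧ InjOn γ (Icc 0 1) ∧
    γ '' Icc 0 1 = J ∧ γ 0 = a ∧ γ 1 = b

/-- `J` is an arc: a subset homeomorphic to the closed unit interval. -/
def IsArc {α : Type*} [TopologicalSpace α] (J : Set α) : Prop :=
  ∃ a b, IsArcFrom J a b

/-- `J` is a simple closed curve: a subset homeomorphic to the unit circle. -/
def IsSimpleClosedCurve {α : Type*} [TopologicalSpace α] (J : Set α) : Prop :=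
  ∃ γ : Circle → α, Continuous γ ∧ Function.Injective γ ∧ Set.range γ = J

/-- A `C^∞`-smooth open arc: the image of an injective `C^∞` map on an open interval,
with nowhere vanishing derivative, that is a homeomorphism onto its image. -/
def IsSmoothOpenArc {E : Type*} [NormedAddCommGroup E] [NormedSpace ℝ E]
    (A : Set E) : Prop :=
  ∃ (a b : ℝ) (γ : ℝ → E), a < b ∧ ContDiffOn ℝ (⊤ : ℕ∞) γ (Ioo a b) ∧
    (∀ t ∈ Ioo a b, derivWithin γ (Ioo a b) t ≠ 0) ∧
    InjOn γ (Ioo a b) ∧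
    IsEmbedding ((Ioo a b).restrict γ) ∧
    γ '' Ioo a b = A

/-- `P(X) = C(X)`: every continuous function on `X` is a uniform limit of polynomials. -/
def PolyEqContinuous {N : ℕ} (X : Set (Fin N → ℂ)) : Prop :=
  ∀ f : (Fin N → ℂ) → ℂ, ContinuousOn f X → ∀ δ : ℝ, 0 < δ →
    ∃ p : MvPolynomial (Fin N) ℂ, ∀ x ∈ X, ‖f x - eval x p‖ < δ

/-- `L` is a complex affine line in `ℂ^N`. -/
def IsComplexAffineLine {N : ℕ} (L : Set (Fin N → ℂ)) : Prop :=
  ∃ (z₀ v : Fin N → ℂ), v ≠ 0 ∧ L = {z | ∃ t : ℂ, z = z₀ + t • v}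

noncomputable section
open Set Topology Metric Filter

/-- local Hurwitz -/
theorem hurwitz_local {ι : Type*} {l : Filter ι} [l.NeBot] {F : ι → ℂ → ℂ} {f : ℂ → ℂ} {U : Set ℂ}
    (hU : IsOpen U) {b : ℂ} (hb : b ∈ U) (hF : ∀ n, DifferentiableOn ℂ (F n) U)
    (hlim : TendstoLocallyUniformlyOn F f l U) (hne : ∀ n, ∀ z ∈ U, F n z ≠ 0)
    (hfne : ∃ᶠ z in 𝓝 b, f z ≠ 0) : f b ≠ 0 := by
  intro hfb
  have hfd : DifferentiableOn ℂ f U := hlim.differentiableOn (Eventually.of_forall hF) hU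
  have hfa : AnalyticAt ℂ f b := hfd.analyticAt (hU.mem_nhds hb)
  have h1 : ∀ᶠ z in 𝓝[≠] b, f z ≠ 0 := by
    rcases hfa.eventually_eq_zero_or_eventually_ne_zero with h | h
    · exact absurd (h.mono fun z hz hn => hn hz) hfne
    · exact h
  rw [eventually_nhdsWithin_iff] at h1
  obtain ⟨r, hr, hrb⟩ := Metric.eventually_nhds_iff_ball.1 (h1.and (hU.mem_nhds hb))
  have hr2 : 0 < r/2 := by linarith
  have hsub : closedBall b (r/2) ⊆ U := fun z hz => (hrb z (closedBall_subset_ball (by linarith) hz)).2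
  have hsph : sphere b (r/2) ⊆ U := sphere_subset_closedBall.trans hsub
  have hcpt : IsCompact (sphere b (r/2)) := isCompact_sphere _ _
  have hnes : (sphere b (r/2)).Nonempty := by
    rw [NormedSpace.sphere_nonempty]; exact hr2.le
  obtain ⟨z0, hz0, hmin⟩ := hcpt.exists_isMinOn hnes ((hfd.continuousOn.mono hsph).norm)
  set δ := ‖f z0‖ with hδ
  have hδ0 : 0 < δ := by
    have : f z0 ≠ 0 := by
      refine (hrb z0 (sphere_subset_closedBall.trans (closedBall_subset_ball (by linarith)) hz0)).1 ?_
      rintro rfl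
      simp at hz0; linarith
    simpa [hδ] using this
  have hunif : TendstoUniformlyOn F f l (closedBall b (r/2)) :=
    (tendstoLocallyUniformlyOn_iff_tendstoUniformlyOn_of_compact (isCompact_closedBall _ _)).1
      (hlim.mono hsub)
  obtain ⟨n, hn⟩ := ((Metric.tendstoUniformlyOn_iff.1 hunif) (δ/3) (by positivity)).exists
  have hdiff : DiffContOnCl ℂ (fun z => (F n z)⁻¹) (ball b (r/2)) := by
    apply DifferentiableOn.diffContOnCl
    rw [closure_ball b hr2.ne']
    exact ((hF n).mono hsub).inv (fun z hz => hne n z (hsub hz))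
  have hbd : ∀ z ∈ frontier (ball b (r/2)), ‖(F n z)⁻¹‖ ≤ (2*δ/3)⁻¹ := by
    intro z hz
    rw [frontier_ball b hr2.ne'] at hz
    have h2 : δ ≤ ‖f z‖ := hmin hz
    have h3 := hn z (sphere_subset_closedBall hz)
    rw [dist_eq_norm] at h3
    rw [norm_inv]
    apply inv_anti₀ (by positivity)
    have := norm_sub_norm_le (f z) (F n z)
    linarith
  have h4 := Complex.norm_le_of_forall_mem_frontier_norm_le isBounded_ball hdiff hbd
    (subset_closure (mem_ball_self hr2))
  have h5 := hn b (mem_closedBall_self hr2.le)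
  rw [hfb, dist_zero_left] at h5
  rw [norm_inv] at h4
  have h6 : 0 < ‖F n b‖ := norm_pos_iff.2 (hne n b hb)
  have := (inv_le_inv₀ h6 (by positivity)).1 h4
  linarith

/-- ultrafilter Montel -/
theorem montel_ultra {U : Set ℂ} (hU : IsOpen U) (F : ℕ → ℂ → ℂ)
    (hF : ∀ n, DifferentiableOn ℂ (F n) U) (hb : ∀ n, ∀ z ∈ U, ‖F n z‖ ≤ 1) :
    ∃ f : ℂ → ℂ, TendstoLocallyUniformlyOn F f (hyperfilter ℕ : Filter ℕ) U := by
  have hpt : ∀ z ∈ U, ∃ y, Tendsto (fun n => F n z) (hyperfilter ℕ : Filter ℕ) (𝓝 y) := by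
    intro z hz
    have hc : IsCompact (closedBall (0:ℂ) 1) := isCompact_closedBall _ _
    obtain ⟨y, -, hy⟩ := hc.ultrafilter_le_nhds ((hyperfilter ℕ).map (fun n => F n z)) (by
      simp only [le_principal_iff]
      rw [Ultrafilter.mem_coe, Ultrafilter.mem_map]
      apply Filter.univ_mem'
      intro n; simpa using hb n z hz)
    exact ⟨y, hy⟩
  choose! f hf using hpt
  refine ⟨f, ?_⟩
  rw [Metric.tendstoLocallyUniformlyOn_iff]
  intro ε hε x hx
  obtain ⟨ρ, hρ, hρU⟩ := Metric.isOpen_iff.1 hU x hx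
  have hlip : ∀ n, ∀ y ∈ ball x ρ, dist (F n y) (F n x) ≤ 2/ρ * dist y x := by
    intro n y hy
    apply Complex.dist_le_div_mul_dist_of_mapsTo_ball ((hF n).mono hρU) _ hy
    intro w hw
    rw [mem_closedBall, dist_eq_norm]
    calc _ ≤ ‖F n w‖ + ‖F n x‖ := norm_sub_le _ _
      _ ≤ 2 := by linarith [hb n w (hρU hw), hb n x hx]
  have hlip' : ∀ y ∈ ball x ρ, dist (f y) (f x) ≤ 2/ρ * dist y x := by
    intro y hy
    have := (hf y (hρU hy)).dist (hf x hx)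
    exact le_of_tendsto this (Eventually.of_forall fun n => hlip n y hy)
  set η := min ρ (ε * ρ / 8) with hη
  have hη0 : 0 < η := by positivity
  refine ⟨ball x η, mem_nhdsWithin_of_mem_nhds (ball_mem_nhds _ hη0), ?_⟩
  have h1 := (Metric.tendsto_nhds.1 (hf x hx)) (ε/4) (by positivity)
  filter_upwards [h1] with n hn y hy
  have hyρ : y ∈ ball x ρ := ball_subset_ball (min_le_left _ _) hy
  have hyd : dist y x < ε * ρ / 8 := lt_of_lt_of_le hy (min_le_right _ _)
  have hk : 2/ρ * dist y x ≤ ε/4 := by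
    rw [div_mul_eq_mul_div, div_le_iff₀ hρ]; linarith
  have a1 := hlip n y hyρ
  have a2 := hlip' y hyρ
  calc dist (f y) (F n y) ≤ dist (f y) (f x) + dist (f x) (F n x) + dist (F n x) (F n y) :=
        dist_triangle4 _ _ _ _
    _ < ε := by rw [dist_comm (f x), dist_comm (F n x) (F n y)]; linarith

end

noncomputable section
open Set Topology Metric Filter

noncomputable def mob (a z : ℂ) : ℂ := (z - a) / (1 - (starRingEnd ℂ) a * z)

theorem mob_den {a z : ℂ} (ha : ‖a‖ < 1) (hz : ‖z‖ < 1) : 1 - (starRingEnd ℂ) a * z ≠ 0 := by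
  intro h
  have h1 : ‖(starRingEnd ℂ) a * z‖ = 1 := by
    rw [← sub_eq_zero.1 h]; simp
  rw [norm_mul, RCLike.norm_conj] at h1
  nlinarith [norm_nonneg a, norm_nonneg z]

theorem mob_norm {a z : ℂ} (ha : ‖a‖ < 1) (hz : ‖z‖ < 1) : ‖mob a z‖ < 1 := by
  unfold mob
  rw [norm_div, div_lt_one (norm_pos_iff.2 (mob_den ha hz))]
  apply lt_of_pow_lt_pow_left₀ 2 (norm_nonneg _)
  rw [Complex.sq_norm, Complex.sq_norm, Complex.normSq_apply, Complex.normSq_apply]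
  have h1 : a.re^2 + a.im^2 < 1 := by
    have := Complex.sq_norm a; rw [Complex.normSq_apply] at this; nlinarith [norm_nonneg a]
  have h2 : z.re^2 + z.im^2 < 1 := by
    have := Complex.sq_norm z; rw [Complex.normSq_apply] at this; nlinarith [norm_nonneg z]
  simp
  nlinarith [mul_pos (sub_pos.2 h1) (sub_pos.2 h2)]

theorem mob_hasDerivAt {a z : ℂ} (ha : ‖a‖ < 1) (hz : ‖z‖ < 1) :
    HasDerivAt (mob a) ((1 - ‖a‖^2 : ℂ) / (1 - (starRingEnd ℂ) a * z)^2) z := by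
  unfold mob
  have h1 : HasDerivAt (fun z : ℂ => z - a) 1 z := (hasDerivAt_id z).sub_const a
  have h2 : HasDerivAt (fun z : ℂ => 1 - (starRingEnd ℂ) a * z) (-((starRingEnd ℂ) a * 1)) z :=
    ((hasDerivAt_id z).const_mul _).const_sub 1
  refine (h1.div h2 (mob_den ha hz)).congr_deriv ?_
  congr 1
  have := Complex.mul_conj' a
  rw [← this]; ring

theorem mob_inj {a z w : ℂ} (ha : ‖a‖ < 1) (hz : ‖z‖ < 1) (hw : ‖w‖ < 1) (h : mob a z = mob a w) :
    z = w := by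
  unfold mob at h
  rw [div_eq_div_iff (mob_den ha hz) (mob_den ha hw)] at h
  have h1 : (1 - (‖a‖:ℂ)^2) * (z - w) = 0 := by
    rw [← Complex.mul_conj' a]; linear_combination h
  rcases mul_eq_zero.1 h1 with h2 | h2
  · exfalso
    have : ((1 - ‖a‖^2 : ℝ) : ℂ) = 0 := by push_cast; exact h2
    have h3 : (1 - ‖a‖^2 : ℝ) = 0 := by exact_mod_cast this
    nlinarith [norm_nonneg a]
  · exact sub_eq_zero.1 h2

def RFam (G : Set ℂ) : Set (ℂ → ℂ) :=
  {f | (∀ z ∈ G, deriv f z ≠ 0) ∧ (∀ z ∈ G, ‖f z‖ < 1) ∧ InjOn f G ∧ f 0 = 0}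

theorem koebe_step {G : Set ℂ} (hGo : IsOpen G) (hGc : IsSimplyConnected G) (h0 : (0:ℂ) ∈ G)
    {f : ℂ → ℂ} (hf : f ∈ RFam G) {a : ℂ} (ha : ‖a‖ < 1) (hna : ∀ z ∈ G, f z ≠ a) :
    ∃ F ∈ RFam G, ‖deriv f 0‖ < ‖deriv F 0‖ := by
  obtain ⟨hd, hb, hinj, hf0⟩ := hf
  have hdiff : ∀ z ∈ G, DifferentiableAt ℂ f z := fun z hz => differentiableAt_of_deriv_ne_zero (hd z hz)
  have ha0 : a ≠ 0 := fun h => hna 0 h0 (by rw [hf0, h])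
  have hnorma : (1 - (‖a‖:ℂ)^2) ≠ 0 := by
    intro h2
    have : ((1 - ‖a‖^2 : ℝ) : ℂ) = 0 := by push_cast; exact h2
    have h3 : (1 - ‖a‖^2 : ℝ) = 0 := by exact_mod_cast this
    nlinarith [norm_nonneg a]
  set g : ℂ → ℂ := fun z => mob a (f z) with hg
  have hgd : ∀ z ∈ G, HasDerivAt g ((1 - ‖a‖^2 : ℂ) / (1 - (starRingEnd ℂ) a * f z)^2 * deriv f z) z :=
    fun z hz => (mob_hasDerivAt ha (hb z hz)).comp z (hdiff z hz).hasDerivAt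
  have hgne : ∀ z ∈ G, g z ≠ 0 := fun z hz => div_ne_zero (sub_ne_zero.2 (hna z hz)) (mob_den ha (hb z hz))
  have hgc : ContinuousOn g G := fun z hz => (hgd z hz).continuousAt.continuousWithinAt
  obtain ⟨h, hhc, hh⟩ := Complex.exists_continuousOn_pow_eq hGc hGo hgc
    (by rintro ⟨z, hz, hz0⟩; exact hgne z hz hz0) (n := 2) (by norm_num)
  have hhne : ∀ z ∈ G, h z ≠ 0 := fun z hz h1 => hgne z hz (by rw [← hh z, h1]; norm_num)
  have hhd : ∀ z ∈ G, HasDerivAt h ((1 - ‖a‖^2 : ℂ) / (1 - (starRingEnd ℂ) a * f z)^2 * deriv f z / (2 * h z)) z := by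
    intro z hz
    have hsq : HasStrictDerivAt (fun w : ℂ => w^2) (2 * h z) (h z) := by
      simpa using hasStrictDerivAt_pow 2 (h z)
    have h2 : (2 * h z) ≠ 0 := mul_ne_zero two_ne_zero (hhne z hz)
    -- h = local inverse of square composed with g
    have hloc := (hsq.to_localInverse h2)
    have hev : ∀ᶠ w in 𝓝 z, h w = hsq.localInverse _ _ _ h2 (g w) := by
      have h3 : ∀ᶠ w in 𝓝 (h z), hsq.localInverse _ _ _ h2 (w^2) = w :=
        hsq.eventually_left_inverse h2
      have h4 := (hhc.continuousAt (hGo.mem_nhds hz)).eventually h3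
      filter_upwards [h4] with w hw
      rw [← hh w, hw]
    have h5 : HasDerivAt (fun w => hsq.localInverse _ _ _ h2 (g w))
        ((2 * h z)⁻¹ * ((1 - ‖a‖^2 : ℂ) / (1 - (starRingEnd ℂ) a * f z)^2 * deriv f z)) z := by
      have h6 : HasDerivAt (hsq.localInverse _ _ _ h2) (2 * h z)⁻¹ (g z) := by
        have := hloc.hasDerivAt
        simp only [hh] at this
        exact this
      exact h6.comp z (hgd z hz)
    have h7 := h5.congr_of_eventuallyEq hev
    refine h7.congr_deriv ?_
    rw [div_eq_mul_inv _ (2 * h z)]; ring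
  have hhb : ∀ z ∈ G, ‖h z‖ < 1 := by
    intro z hz
    have : ‖h z‖^2 < 1 := by rw [← norm_pow, hh]; exact mob_norm ha (hb z hz)
    nlinarith [norm_nonneg (h z)]
  set b := h 0 with hbdef
  have hb1 : ‖b‖ < 1 := hhb 0 h0
  have hb2 : b^2 = -a := by rw [hbdef, hh]; simp [hg, mob, hf0]
  have hbn : ‖b‖^2 = ‖a‖ := by rw [← norm_pow, hb2, norm_neg]
  have hb0 : 0 < ‖b‖ := norm_pos_iff.2 (hhne 0 h0)
  have hnormb : (1 - (‖b‖:ℂ)^2) ≠ 0 := by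
    intro h2
    have : ((1 - ‖b‖^2 : ℝ) : ℂ) = 0 := by push_cast; exact h2
    have h3 : (1 - ‖b‖^2 : ℝ) = 0 := by exact_mod_cast this
    nlinarith [norm_nonneg b]
  have hFd : ∀ z ∈ G, HasDerivAt (fun z => mob b (h z)) ((1 - ‖b‖^2 : ℂ) / (1 - (starRingEnd ℂ) b * h z)^2 *
      ((1 - ‖a‖^2 : ℂ) / (1 - (starRingEnd ℂ) a * f z)^2 * deriv f z / (2 * h z))) z :=
    fun z hz => (mob_hasDerivAt hb1 (hhb z hz)).comp z (hhd z hz)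
  refine ⟨fun z => mob b (h z), ⟨?_, ?_, ?_, ?_⟩, ?_⟩
  · intro z hz
    rw [(hFd z hz).deriv]
    exact mul_ne_zero (div_ne_zero hnormb (pow_ne_zero 2 (mob_den hb1 (hhb z hz))))
      (div_ne_zero (mul_ne_zero (div_ne_zero hnorma (pow_ne_zero 2 (mob_den ha (hb z hz)))) (hd z hz))
        (mul_ne_zero two_ne_zero (hhne z hz)))
  · exact fun z hz => mob_norm hb1 (hhb z hz)
  · intro z hz w hw hzw
    have h1 := mob_inj hb1 (hhb z hz) (hhb w hw) hzw
    have h2 : g z = g w := by rw [← hh, ← hh, h1]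
    exact hinj hz hw (mob_inj ha (hb z hz) (hb w hw) h2)
  · simp [mob, ← hbdef]
  · rw [(hFd 0 h0).deriv, hf0, ← hbdef]
    have e1 : (starRingEnd ℂ) b * b = (‖b‖:ℂ)^2 := by rw [mul_comm, Complex.mul_conj']
    rw [e1]
    have e2 : ‖(1 - (‖b‖:ℂ)^2) / (1 - (‖b‖:ℂ)^2)^2 * ((1 - (‖a‖:ℂ)^2) / (1 - (starRingEnd ℂ) a * 0)^2 * deriv f 0 / (2 * b))‖
       = (1 + ‖b‖^2) / (2 * ‖b‖) * ‖deriv f 0‖ := by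
      have e3 : (1 - (‖b‖:ℂ)^2) / (1 - (‖b‖:ℂ)^2)^2 * ((1 - (‖a‖:ℂ)^2) / (1 - (starRingEnd ℂ) a * 0)^2 * deriv f 0 / (2 * b))
        = (1 + (‖b‖:ℂ)^2) / (2 * b) * deriv f 0 := by
        rw [← hbn]; push_cast
        have hbb : b ≠ 0 := hhne 0 h0
        field_simp
        ring
      rw [e3, norm_mul, norm_div, norm_mul]
      have : ‖(1 + (‖b‖:ℂ)^2)‖ = 1 + ‖b‖^2 := by
        have : (1 + (‖b‖:ℂ)^2) = ((1 + ‖b‖^2 : ℝ) : ℂ) := by push_cast; rfl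
        rw [this, Complex.norm_real, Real.norm_of_nonneg (by positivity)]
      rw [this]; simp
    rw [e2]
    have hp : 0 < ‖deriv f 0‖ := norm_pos_iff.2 (hd 0 h0)
    have : 1 < (1 + ‖b‖^2) / (2 * ‖b‖) := by
      rw [lt_div_iff₀ (by positivity)]
      nlinarith [sq_nonneg (1 - ‖b‖), mul_pos (sub_pos.2 hb1) (sub_pos.2 hb1)]
    nlinarith

end

noncomputable section
open Set Topology Metric Filter

theorem rmt {G : Set ℂ} (hGo : IsOpen G) (hGs : StarConvex ℝ 0 G) (h0 : (0:ℂ) ∈ G)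
    {R : ℝ} (hGb : ∀ z ∈ G, ‖z‖ < R) :
    ∃ Ψ Φ : ℂ → ℂ, DifferentiableOn ℂ Ψ G ∧ DifferentiableOn ℂ Φ (ball 0 1) ∧
      MapsTo Ψ G (ball 0 1) ∧ MapsTo Φ (ball 0 1) G ∧ (∀ w ∈ G, Φ (Ψ w) = w) ∧
      (∀ z ∈ ball (0:ℂ) 1, Ψ (Φ z) = z) ∧ Φ 0 = 0 ∧ Ψ 0 = 0 := by
  have hGc : IsSimplyConnected G := by
    have := hGs.contractibleSpace ⟨0, h0⟩
    unfold IsSimplyConnected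
    infer_instance
  have hpre : IsPreconnected G := hGc.isPathConnected.isConnected.isPreconnected
  have hR : 0 < R := lt_of_le_of_lt (norm_nonneg _) (hGb 0 h0)
  obtain ⟨ρ, hρ, hρG⟩ := Metric.isOpen_iff.1 hGo 0 h0
  have hdiffF : ∀ f ∈ RFam G, DifferentiableOn ℂ f G :=
    fun f hf z hz => (differentiableAt_of_deriv_ne_zero (hf.1 z hz)).differentiableWithinAt
  -- bounded
  have hbd : BddAbove ((fun f : ℂ → ℂ => ‖deriv f 0‖) '' RFam G) := by
    refine ⟨1/ρ, ?_⟩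
    rintro _ ⟨f, hf, rfl⟩
    apply Complex.norm_deriv_le_div_of_mapsTo_ball ((hdiffF f hf).mono hρG) _ hρ
    intro z hz
    rw [hf.2.2.2, mem_closedBall, dist_zero_right]
    exact (hf.2.1 z (hρG hz)).le
  have hne : ((fun f : ℂ → ℂ => ‖deriv f 0‖) '' RFam G).Nonempty := by
    refine ⟨_, ⟨fun z => z / R, ⟨?_, ?_, ?_, ?_⟩, rfl⟩⟩
    · intro z hz
      have : HasDerivAt (fun z : ℂ => z / R) (1 / R) z := (hasDerivAt_id z).div_const _
      rw [this.deriv]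
      simpa using hR.ne'
    · intro z hz
      rw [norm_div, Complex.norm_real, Real.norm_of_nonneg hR.le, div_lt_one hR]
      exact hGb z hz
    · intro z _ w _ h
      have : (R:ℂ) ≠ 0 := by exact_mod_cast hR.ne'
      field_simp at h
      exact h
    · simp
  set m := sSup ((fun f : ℂ → ℂ => ‖deriv f 0‖) '' RFam G) with hm
  have hmax : ∀ f ∈ RFam G, ‖deriv f 0‖ ≤ m := fun f hf => le_csSup hbd ⟨f, hf, rfl⟩
  have hseq : ∀ n : ℕ, ∃ f ∈ RFam G, m - 1/(n+1) < ‖deriv f 0‖ := by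
    intro n
    obtain ⟨_, ⟨f, hf, rfl⟩, h⟩ := exists_lt_of_lt_csSup hne (show m - 1/((n:ℝ)+1) < m by
      have : 0 < 1/((n:ℝ)+1) := by positivity
      linarith)
    exact ⟨f, hf, h⟩
  choose F hF hFm using hseq
  have hmpos : 0 < m := lt_of_lt_of_le (norm_pos_iff.2 ((hF 0).1 0 h0)) (hmax _ (hF 0))
  obtain ⟨f, hf⟩ := montel_ultra hGo F (fun n => hdiffF _ (hF n)) (fun n z hz => ((hF n).2.1 z hz).le)
  have hfd : DifferentiableOn ℂ f G :=
    hf.differentiableOn (Eventually.of_forall fun n => hdiffF _ (hF n)) hGo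
  have hfder := hf.deriv (Eventually.of_forall fun n => hdiffF _ (hF n)) hGo
  have hlim0 : Tendsto (fun n => ‖deriv (F n) 0‖) (hyperfilter ℕ : Filter ℕ) (𝓝 ‖deriv f 0‖) :=
    (hfder.tendsto_at h0).norm
  have hlim1 : Tendsto (fun n => ‖deriv (F n) 0‖) (hyperfilter ℕ : Filter ℕ) (𝓝 m) := by
    have h1 : Tendsto (fun n => ‖deriv (F n) 0‖) atTop (𝓝 m) := by
      refine tendsto_of_tendsto_of_tendsto_of_le_of_le (g := fun n : ℕ => m - 1/((n:ℝ)+1)) ?_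
        tendsto_const_nhds (fun n => (hFm n).le) (fun n => hmax _ (hF n))
      simpa using (tendsto_const_nhds (x := m)).sub (tendsto_one_div_add_atTop_nhds_zero_nat (𝕜 := ℝ))
    exact h1.mono_left Nat.hyperfilter_le_atTop
  have hfm : ‖deriv f 0‖ = m := tendsto_nhds_unique hlim0 hlim1
  have hfan : AnalyticOnNhd ℂ f G := hfd.analyticOnNhd hGo
  have hf0 : f 0 = 0 := by
    have h1 := hf.tendsto_at h0
    have h2 : (fun n => F n 0) = fun _ => 0 := funext fun n => (hF n).2.2.2
    rw [h2] at h1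
    exact (tendsto_nhds_unique h1 tendsto_const_nhds)
  -- f not locally constant anywhere
  have hnc : ∀ b ∈ G, ∀ c : ℂ, ∃ᶠ z in 𝓝 b, f z ≠ c := by
    intro b hb c hcon
    have h1 : ∀ᶠ z in 𝓝 b, f z = c := hcon.mono fun z hz => not_not.1 hz
    have h2 : EqOn f (fun _ => c) G :=
      hfan.eqOn_of_preconnected_of_eventuallyEq analyticOnNhd_const hpre hb h1
    have h3 : deriv f 0 = 0 := by
      have : f =ᶠ[𝓝 0] fun _ => c := eventually_of_mem (hGo.mem_nhds h0) h2
      rw [this.deriv_eq]; simp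
    rw [h3, norm_zero] at hfm
    exact hmpos.ne hfm
  have hfle : ∀ z ∈ G, ‖f z‖ ≤ 1 := fun z hz =>
    le_of_tendsto (hf.tendsto_at hz).norm (Eventually.of_forall fun n => ((hF n).2.1 z hz).le)
  have hflt : ∀ z ∈ G, ‖f z‖ < 1 := by
    rcases hfan.is_constant_or_isOpen hpre with ⟨c, hc⟩ | hop
    · exfalso
      refine hnc 0 h0 c ?_
      filter_upwards [hGo.mem_nhds h0] with z hz using not_not.2 (hc z hz)
    · have h1 : IsOpen (f '' G) := hop G subset_rfl hGo
      have h2 : f '' G ⊆ closedBall 0 1 := by rintro _ ⟨z, hz, rfl⟩; simpa using hfle z hz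
      have h3 : f '' G ⊆ interior (closedBall 0 1) := interior_maximal h2 h1
      rw [interior_closedBall _ one_ne_zero] at h3
      intro z hz
      simpa using h3 ⟨z, hz, rfl⟩
  have hdne : ∀ z ∈ G, deriv f z ≠ 0 := by
    intro b hb
    refine hurwitz_local hGo hb (fun n => (hdiffF _ (hF n)).deriv hGo) hfder
      (fun n z hz => (hF n).1 z hz) ?_
    intro hcon
    have h1 : ∀ᶠ z in 𝓝 b, deriv f z = 0 := hcon.mono fun z hz => not_not.1 hz
    have h2 : EqOn (deriv f) (fun _ => 0) G :=
      (hfan.deriv).eqOn_of_preconnected_of_eventuallyEq analyticOnNhd_const hpre hb h1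
    have h3 : deriv f 0 = 0 := h2 h0
    rw [h3, norm_zero] at hfm
    exact hmpos.ne hfm
  have hinj : InjOn f G := by
    intro a ha b hb hab
    by_contra hne
    have hop : IsOpen (G \ {a}) := hGo.sdiff isClosed_singleton
    have hbm : b ∈ G \ {a} := ⟨hb, fun h => hne h.symm⟩
    refine hurwitz_local (F := fun n z => F n z - F n a) (f := fun z => f z - f a)
      (l := (hyperfilter ℕ : Filter ℕ)) hop hbm ?_ ?_ ?_ ?_ (by simp [hab])
    · intro n
      exact ((hdiffF _ (hF n)).mono sdiff_subset).sub_const _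
    · rw [Metric.tendstoLocallyUniformlyOn_iff]
      intro ε hε x hx
      have h1 := (Metric.tendstoLocallyUniformlyOn_iff.1 (hf.mono (sdiff_subset (t := {a})))) (ε/2) (by positivity) x hx
      obtain ⟨t, ht, h2⟩ := h1
      refine ⟨t, ht, ?_⟩
      filter_upwards [h2, (Metric.tendsto_nhds.1 (hf.tendsto_at ha)) (ε/2) (by positivity)] with n hn hn' y hy
      have h3 := hn y hy
      rw [dist_eq_norm] at *
      calc ‖f y - f a - (F n y - F n a)‖ = ‖(f y - F n y) + (F n a - f a)‖ := by congr 1; ring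
        _ ≤ _ := norm_add_le _ _
        _ < ε := by linarith
    · intro n z hz h
      exact hz.2 ((hF n).2.2.1 hz.1 ha (sub_eq_zero.1 h))
    · exact (hnc b hb (f a)).mono fun z hz => sub_ne_zero.2 hz
  have hfR : f ∈ RFam G := ⟨hdne, hflt, hinj, hf0⟩
  have hsurj : ∀ a ∈ ball (0:ℂ) 1, ∃ z ∈ G, f z = a := by
    intro a ha
    by_contra hcon
    push Not at hcon
    obtain ⟨F', hF', hlt⟩ := koebe_step hGo hGc h0 hfR (by simpa using ha) hcon
    exact absurd (hmax _ hF') (by rw [← hfm]; exact not_le.2 hlt)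
  choose! Φ hΦG hΦ using hsurj
  have hleft : ∀ w ∈ G, Φ (f w) = w := by
    intro w hw
    have hb : f w ∈ ball (0:ℂ) 1 := by simpa using hflt w hw
    exact hinj (hΦG _ hb) hw (hΦ _ hb)
  refine ⟨f, Φ, hfd, ?_, fun z hz => by simpa using hflt z hz, hΦG, hleft, hΦ, ?_, hf0⟩
  · intro z hz
    have hw := hΦG z hz
    set w := Φ z with hwdef
    have hstrict : HasStrictDerivAt f (deriv f w) w := (hfan w hw).hasStrictDerivAt
    have hmap := hstrict.map_nhds_eq (hdne w hw)
    rw [hΦ z hz] at hmap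
    have hcont : ContinuousAt Φ z := by
      rw [ContinuousAt, ← hmap, tendsto_map'_iff, ← hwdef]
      refine tendsto_id.congr' ?_
      filter_upwards [hGo.mem_nhds hw] with y hy
      simp [hleft y hy]
    refine (HasDerivAt.of_local_left_inverse (f := f) (g := Φ) (f' := deriv f w) hcont
      hstrict.hasDerivAt (hdne w hw) ?_).differentiableAt.differentiableWithinAt
    filter_upwards [isOpen_ball.mem_nhds hz] with y hy using hΦ y hy
  · have := hleft 0 h0
    rwa [hf0] at this

end

noncomputable section
open Set MvPolynomial Topology MeasureTheory

lemma jensen_set {f : ℂ → ℂ} {r M : ℝ} (hr : 0 < r) (hM : 1 ≤ M)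
    (hf : AnalyticOnNhd ℂ f (Metric.closedBall 0 r)) (h0 : f 0 ≠ 0)
    (S : Set ℝ) (hS : MeasurableSet S) (hSI : S ⊆ Ioc 0 (2 * Real.pi))
    (hfM : ∀ θ : ℝ, ‖f (circleMap 0 r θ)‖ ≤ M) (hfS : ∀ θ ∈ S, ‖f (circleMap 0 r θ)‖ ≤ 1) :
    2 * Real.pi * Real.log ‖f 0‖ ≤ (2 * Real.pi - volume.real S) * Real.log M := by
  have hpi := Real.pi_pos
  have hf' : AnalyticOnNhd ℂ f (Metric.closedBall 0 |r|) := by rwa [abs_of_pos hr]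
  have hJ := hf'.circleAverage_log_norm hr.ne' h0
  have hnn : 0 ≤ ∑ᶠ u, MeromorphicOn.divisor f (Metric.closedBall 0 |r|) u *
      Real.log (r * ‖(0:ℂ) - u‖⁻¹) := by
    apply finsum_nonneg
    intro u
    by_cases hu : u ∈ Metric.closedBall (0:ℂ) |r|
    · apply mul_nonneg
      · exact_mod_cast (MeromorphicOn.AnalyticOnNhd.divisor_nonneg hf') u
      · rcases eq_or_ne u 0 with rfl | h
        · simp
        · apply Real.log_nonneg
          have : ‖u‖ ≤ r := by simpa [abs_of_pos hr] using hu
          rw [zero_sub, norm_neg, ← div_eq_mul_inv, one_le_div (norm_pos_iff.2 h)]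
          exact this
    · rw [Function.locallyFinsuppWithin.apply_eq_zero_of_notMem _ hu]; simp
  have hIntg : CircleIntegrable (Real.log ‖f ·‖) 0 r :=
    MeromorphicOn.circleIntegrable_log_norm (fun z hz => (hf' z (Metric.sphere_subset_closedBall hz)).meromorphicAt)
  have h1 : Real.log ‖f 0‖ ≤ Real.circleAverage (Real.log ‖f ·‖) 0 r := by rw [hJ]; linarith
  rw [Real.circleAverage_def, smul_eq_mul] at h1
  have h2 : ∫ θ in 0..2 * Real.pi, Real.log ‖f (circleMap 0 r θ)‖ ≤
      (2 * Real.pi - volume.real S) * Real.log M := by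
    have hI : IntegrableOn (Sᶜ.indicator (fun _ : ℝ => Real.log M)) (Ioc 0 (2 * Real.pi)) := by
      apply Integrable.indicator _ hS.compl
      simp
    have h3 : ∫ θ in Ioc 0 (2 * Real.pi), Sᶜ.indicator (fun _ => Real.log M) θ =
       (2 * Real.pi - volume.real S) * Real.log M := by
      rw [setIntegral_indicator hS.compl, setIntegral_const, smul_eq_mul]
      congr 1
      rw [← sdiff_eq, measureReal_sdiff hSI hS measure_Ioc_lt_top.ne]
      simp [hpi.le]
    rw [← h3, intervalIntegral.integral_of_le (by positivity)]
    apply setIntegral_mono_on _ hI measurableSet_Ioc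
    · intro θ _
      by_cases h : θ ∈ S
      · simp only [mem_compl_iff, h, not_true_eq_false, not_false_eq_true, indicator_of_notMem]
        exact Real.log_nonpos (norm_nonneg _) (hfS θ h)
      · rw [indicator_of_mem (by simpa using h)]
        rcases eq_or_ne (f (circleMap 0 r θ)) 0 with h' | h'
        · rw [h']; simpa using Real.log_nonneg hM
        · exact Real.log_le_log (norm_pos_iff.2 h') (hfM θ)
    · exact (intervalIntegrable_iff_integrableOn_Ioc_of_le (by positivity)).1 hIntg
  calc 2 * Real.pi * Real.log ‖f 0‖ ≤ 2 * Real.pi * ((2 * Real.pi)⁻¹ * ∫ θ in 0..2 * Real.pi, Real.log ‖f (circleMap 0 r θ)‖) := by gcongr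
    _ = ∫ θ in 0..2 * Real.pi, Real.log ‖f (circleMap 0 r θ)‖ := by field_simp
    _ ≤ _ := h2

/-- sector function: L^{1+κ} bound -/
lemma sector_bound {c₁ : ℝ} (hc : 0 < c₁) : ∃ κ : ℝ, 0 < κ ∧ ∃ B : ℝ, 0 < B ∧ ∀ Θ : ℂ → ℂ,
    DifferentiableOn ℂ Θ (Metric.ball 0 1) → Θ 0 = 1 → (∀ z ∈ Metric.ball (0:ℂ) 1, Θ z ≠ 0 ∧ c₁ * ‖Θ z‖ ≤ (Θ z).re) →
    ∀ r, 0 < r → r < 1 → ∫ θ in 0..2 * Real.pi, ‖Θ (circleMap 0 r θ)‖ ^ (1 + κ) ≤ B := by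
  have hpi := Real.pi_pos
  set β := Real.arccos c₁ with hβ
  have hβ0 : 0 ≤ β := Real.arccos_nonneg _
  have hβ1 : β < Real.pi / 2 := Real.arccos_lt_pi_div_two.2 hc
  set β' := (β + Real.pi / 2) / 2 with hβ'
  obtain ⟨κ, hκ, hκβ⟩ : ∃ κ : ℝ, 0 < κ ∧ (1 + κ) * β ≤ β' := by
    refine ⟨(Real.pi/2 - β) / Real.pi, by apply div_pos <;> linarith, ?_⟩
    have : (Real.pi/2 - β) / Real.pi * β ≤ (Real.pi/2 - β) / 2 := by
      rw [div_mul_eq_mul_div, div_le_div_iff₀ hpi two_pos]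
      nlinarith
    rw [add_mul, hβ']; linarith
  have hcos : 0 < Real.cos β' := Real.cos_pos_of_mem_Ioo ⟨by linarith, by linarith⟩
  refine ⟨κ, hκ, 2 * Real.pi / Real.cos β', by positivity, ?_⟩
  intro Θ hΘ h0 hs r hr0 hr1
  have hball : Metric.closedBall (0:ℂ) r ⊆ Metric.ball 0 1 := Metric.closedBall_subset_ball hr1
  -- the power
  let F : ℂ → ℂ := fun z => (Θ z) ^ ((1 + κ : ℝ) : ℂ)
  have hsl : ∀ z ∈ Metric.ball (0:ℂ) 1, Θ z ∈ Complex.slitPlane := by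
    intro z hz
    left
    exact lt_of_lt_of_le (mul_pos hc (norm_pos_iff.2 (hs z hz).1)) (hs z hz).2
  have hF : DifferentiableOn ℂ F (Metric.ball 0 1) := by
    intro z hz
    exact (hΘ z hz).cpow (differentiableWithinAt_const _) (hsl z hz)
  have hF0 : F 0 = 1 := by simp [F, h0]
  have hmv : Real.circleAverage F 0 r = F 0 := by
    apply DiffContOnCl.circleAverage
    rw [abs_of_pos hr0]
    apply DifferentiableOn.diffContOnCl
    rw [closure_ball _ hr0.ne']
    exact hF.mono hball
  have hcm : ∀ θ, circleMap 0 r θ ∈ Metric.ball (0:ℂ) 1 := fun θ => hball (by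
    have := circleMap_mem_closedBall (0:ℂ) hr0.le θ
    exact this)
  have hcont : Continuous (fun θ => F (circleMap 0 r θ)) :=
    hF.continuousOn.comp_continuous (continuous_circleMap _ _) hcm
  have hcontΘ : Continuous (fun θ => Θ (circleMap 0 r θ)) :=
    hΘ.continuousOn.comp_continuous (continuous_circleMap _ _) hcm
  have hre : ∀ z ∈ Metric.ball (0:ℂ) 1, Real.cos β' * ‖Θ z‖ ^ (1 + κ) ≤ (F z).re := by
    intro z hz
    obtain ⟨hz0, hz1⟩ := hs z hz
    have hp : 0 < ‖Θ z‖ := norm_pos_iff.2 hz0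
    have harg : |(Θ z).arg| ≤ β := by
      have h1 : c₁ ≤ Real.cos (Θ z).arg := by
        rw [Complex.cos_arg hz0, le_div_iff₀ hp]; exact hz1
      rw [← Real.cos_abs] at h1
      rw [hβ, ← Real.arccos_cos (abs_nonneg _) (Complex.abs_arg_le_pi _)]
      exact Real.arccos_le_arccos h1
    have : (F z).re = ‖Θ z‖ ^ (1 + κ) * Real.cos ((1 + κ) * (Θ z).arg) := by
      simp only [F]
      rw [Complex.cpow_ofReal, ]
      simp [mul_comm]
      norm_cast
      simp [mul_comm]
    rw [this, mul_comm]
    gcongr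
    rw [← Real.cos_abs ((1 + κ) * _), abs_mul, abs_of_pos (by linarith : 0 < 1 + κ)]
    apply Real.cos_le_cos_of_nonneg_of_le_pi (by positivity)
    · linarith
    · exact le_trans (by gcongr) hκβ
  have h1 : ∫ θ in 0..2 * Real.pi, (F (circleMap 0 r θ)).re = 2 * Real.pi := by
    have h2 : ∫ θ in 0..2 * Real.pi, F (circleMap 0 r θ) = 2 * Real.pi := by
      rw [Real.circleAverage_def, hF0] at hmv
      have : (2 * Real.pi) • ((2 * Real.pi)⁻¹ • ∫ θ in 0..2 * Real.pi, F (circleMap 0 r θ)) = (2 * Real.pi) • (1:ℂ) := by rw [hmv]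
      rw [smul_inv_smul₀ (by positivity)] at this
      rw [this]; simp
    have h3 := intervalIntegral.intervalIntegral_re (μ := volume) (𝕜 := ℂ) (a := 0) (b := 2 * Real.pi) (f := fun θ => F (circleMap 0 r θ)) (hcont.intervalIntegrable _ _)
    simp only [RCLike.re_to_complex] at h3
    rw [h3, h2]; simp
  rw [le_div_iff₀ hcos]
  refine le_trans ?_ h1.le
  rw [mul_comm, ← intervalIntegral.integral_const_mul]
  apply intervalIntegral.integral_mono_on (by positivity)
  · apply Continuous.intervalIntegrable
    apply continuous_const.mul
    exact hcontΘ.norm.rpow_const (fun _ => Or.inr (by linarith))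
  · exact (Complex.continuous_re.comp hcont).intervalIntegrable _ _
  · intro θ _
    exact hre _ (hcm θ)

end

noncomputable section
open Set MvPolynomial Topology MeasureTheory

lemma angle_measure {c₁ a : ℝ} (hc : 0 < c₁) (ha : 0 < a) (A : Set ℝ) (hA : MeasurableSet A)
    (hper : ∀ x, x + 2 * Real.pi ∈ A ↔ x ∈ A) (haA : a ≤ volume.real (A ∩ Ioc 0 (2 * Real.pi))) :
    ∃ c₀ > 0, ∀ Θ : ℂ → ℂ,
    DifferentiableOn ℂ Θ (Metric.ball 0 1) → Θ 0 = 1 → (∀ z ∈ Metric.ball (0:ℂ) 1, Θ z ≠ 0 ∧ c₁ * ‖Θ z‖ ≤ (Θ z).re) →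
    ∀ r, 0 < r → r < 1 → ∀ α₀ : ℝ,
      c₀ ≤ volume.real {θ | θ ∈ Ioc 0 (2 * Real.pi) ∧ α₀ + ∫ s in 0..θ, (Θ (circleMap 0 r s)).re ∈ A} := by
  have hpi := Real.pi_pos
  obtain ⟨κ, hκ, B, hB, hsec⟩ := sector_bound hc
  obtain ⟨l, hl, hlB⟩ : ∃ l : ℝ, 0 < l ∧ l ^ (-κ) * B ≤ a / 2 := by
    refine ⟨(a / (2 * B)) ^ (-(1/κ)), by positivity, ?_⟩
    rw [← Real.rpow_mul (by positivity)]
    have : -(1/κ) * -κ = 1 := by field_simp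
    rw [this, Real.rpow_one]
    apply le_of_eq; field_simp
  refine ⟨a / (2 * l), by positivity, ?_⟩
  intro Θ hΘ h0 hs r hr0 hr1 α₀
  have hcm : ∀ θ, circleMap 0 r θ ∈ Metric.ball (0:ℂ) 1 := fun θ =>
    Metric.closedBall_subset_ball hr1 (circleMap_mem_closedBall (0:ℂ) hr0.le θ)
  have hcontΘ : Continuous (fun θ => Θ (circleMap 0 r θ)) :=
    hΘ.continuousOn.comp_continuous (continuous_circleMap _ _) hcm
  have hcre : Continuous (fun θ => (Θ (circleMap 0 r θ)).re) := Complex.continuous_re.comp hcontΘ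
  set α : ℝ → ℝ := fun θ => α₀ + ∫ s in 0..θ, (Θ (circleMap 0 r s)).re with hα
  have hder : ∀ θ, HasDerivAt α (Θ (circleMap 0 r θ)).re θ := by
    intro θ
    apply HasDerivAt.const_add
    exact intervalIntegral.integral_hasDerivAt_right (hcre.intervalIntegrable _ _)
      hcre.aestronglyMeasurable.stronglyMeasurableAtFilter hcre.continuousAt
  have hαc : Continuous α := continuous_iff_continuousAt.2 fun θ => (hder θ).continuousAt
  have hα0 : α 0 = α₀ := by simp [hα]
  have hα1 : α (2 * Real.pi) = α₀ + 2 * Real.pi := by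
    simp only [hα]
    congr 1
    have hmv : Real.circleAverage Θ 0 r = Θ 0 := by
      apply DiffContOnCl.circleAverage
      rw [abs_of_pos hr0]
      apply DifferentiableOn.diffContOnCl
      rw [closure_ball _ hr0.ne']
      exact hΘ.mono (Metric.closedBall_subset_ball hr1)
    have h2 : ∫ θ in 0..2 * Real.pi, Θ (circleMap 0 r θ) = 2 * Real.pi := by
      rw [Real.circleAverage_def, h0] at hmv
      have : (2 * Real.pi) • ((2 * Real.pi)⁻¹ • ∫ θ in 0..2 * Real.pi, Θ (circleMap 0 r θ)) = (2 * Real.pi) • (1:ℂ) := by rw [hmv]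
      rw [smul_inv_smul₀ (by positivity)] at this
      rw [this]; simp
    have h3 := intervalIntegral.intervalIntegral_re (μ := volume) (𝕜 := ℂ) (a := 0) (b := 2 * Real.pi) (f := fun θ => Θ (circleMap 0 r θ)) (hcontΘ.intervalIntegrable _ _)
    simp only [RCLike.re_to_complex] at h3
    rw [h3, h2]; simp
  set S := {θ | θ ∈ Ioc 0 (2 * Real.pi) ∧ α θ ∈ A} with hS
  have hSm : MeasurableSet S := measurableSet_Ioc.inter (hαc.measurable hA)
  have hSI : S ⊆ Ioc 0 (2 * Real.pi) := fun x hx => hx.1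
  have hSfin : volume S ≠ ⊤ := ne_top_of_le_ne_top measure_Ioc_lt_top.ne (measure_mono hSI)
  have hsub : A ∩ Ioc α₀ (α₀ + 2 * Real.pi) ⊆ α '' S := by
    rintro y ⟨hyA, hy⟩
    have := intermediate_value_Ioc (a := 0) (b := 2 * Real.pi) (by positivity) hαc.continuousOn (f := α)
    rw [hα0, hα1] at this
    obtain ⟨θ, hθ, rfl⟩ := this hy
    exact ⟨θ, ⟨hθ, hyA⟩, rfl⟩
  have hvol : volume.real (A ∩ Ioc α₀ (α₀ + 2 * Real.pi)) = volume.real (A ∩ Ioc 0 (2 * Real.pi)) := by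
    have hp : Function.Periodic (A.indicator (fun _ => (1:ℝ))) (2 * Real.pi) := by
      intro x
      by_cases h : x ∈ A
      · simp [h, (hper x).2 h]
      · simp [h, mt (hper x).1 h]
    have h1 := hp.intervalIntegral_add_eq α₀ 0
    rw [intervalIntegral.integral_of_le (by linarith), intervalIntegral.integral_of_le (by linarith), setIntegral_indicator hA, setIntegral_indicator hA] at h1
    simpa [inter_comm] using h1
  have hle : volume (α '' S) ≤ ∫⁻ x in S, ENNReal.ofReal |(Θ (circleMap 0 r x)).re| := by
    have := addHaar_image_le_lintegral_abs_det_fderiv volume hSm (fun x _ => ((hder x).hasFDerivAt).hasFDerivWithinAt)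
    simpa using this
  have hG : Continuous (fun x => l + l ^ (-κ) * ‖Θ (circleMap 0 r x)‖ ^ (1+κ)) := by
    apply continuous_const.add (continuous_const.mul _)
    exact hcontΘ.norm.rpow_const (fun _ => Or.inr (by linarith))
  have hG2 : Continuous (fun x => l ^ (-κ) * ‖Θ (circleMap 0 r x)‖ ^ (1+κ)) := by
    apply (continuous_const.mul _)
    exact hcontΘ.norm.rpow_const (fun _ => Or.inr (by linarith))
  have hGi : IntegrableOn (fun x => l + l ^ (-κ) * ‖Θ (circleMap 0 r x)‖ ^ (1+κ)) S :=
    (hG.integrableOn_Ioc).mono_set hSI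
  have hpt : ∀ x, |(Θ (circleMap 0 r x)).re| ≤ l + l ^ (-κ) * ‖Θ (circleMap 0 r x)‖ ^ (1+κ) := by
    intro x
    refine (Complex.abs_re_le_norm _).trans ?_
    set y := ‖Θ (circleMap 0 r x)‖
    have hy : 0 ≤ y := norm_nonneg _
    rcases le_or_gt y l with h | h
    · have : 0 ≤ l ^ (-κ) * y ^ (1+κ) := by positivity
      linarith
    · have hy' : 0 < y := hl.trans h
      have : y ≤ l ^ (-κ) * y ^ (1+κ) := by
        rw [Real.rpow_add hy', Real.rpow_one, Real.rpow_neg hl.le]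
        have : 1 ≤ (l^κ)⁻¹ * y^κ := by
          rw [inv_mul_eq_div, one_le_div (by positivity)]
          exact Real.rpow_le_rpow hl.le h.le hκ.le
        nlinarith
      linarith
  have hfinal : a ≤ l * volume.real S + a / 2 := by
    calc a ≤ volume.real (A ∩ Ioc α₀ (α₀ + 2 * Real.pi)) := by rw [hvol]; exact haA
      _ ≤ ∫ x in S, (l + l ^ (-κ) * ‖Θ (circleMap 0 r x)‖ ^ (1+κ)) := by
        rw [Measure.real]
        apply ENNReal.toReal_le_of_le_ofReal
        · exact setIntegral_nonneg hSm (fun x _ => by positivity)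
        rw [ofReal_integral_eq_lintegral_ofReal hGi (Filter.Eventually.of_forall fun x => by positivity)]
        refine (measure_mono hsub).trans (hle.trans ?_)
        exact lintegral_mono fun x => ENNReal.ofReal_le_ofReal (hpt x)
      _ = l * volume.real S + ∫ x in S, l ^ (-κ) * ‖Θ (circleMap 0 r x)‖ ^ (1+κ) := by
        have hci : Integrable (fun _ : ℝ => l) (volume.restrict S) := integrableOn_const hSfin
        rw [integral_add hci ((hG2.integrableOn_Ioc).mono_set hSI)]
        simp [mul_comm]
      _ ≤ l * volume.real S + ∫ x in Ioc 0 (2 * Real.pi), l ^ (-κ) * ‖Θ (circleMap 0 r x)‖ ^ (1+κ) := by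
        gcongr
        · exact Filter.Eventually.of_forall fun x => by positivity
        · exact hG2.integrableOn_Ioc
      _ ≤ l * volume.real S + a / 2 := by
        gcongr
        rw [integral_const_mul]
        refine le_trans ?_ hlB
        gcongr
        have := hsec Θ hΘ h0 hs r hr0 hr1
        rwa [intervalIntegral.integral_of_le (by positivity)] at this
  rw [div_le_iff₀ (by positivity)]
  nlinarith

end

noncomputable section
open Set MvPolynomial Topology MeasureTheory

/-- standard drop with vertex 1 around 0 -/
def dropU (ε : ℝ) : Set ℂ := {u | ∃ ζ : ℂ, |ζ.im| < ε * ζ.re ∧ u = Complex.exp (-ζ)}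

lemma dropU_open (ε : ℝ) : IsOpen (dropU ε) := by
  have : dropU ε = Complex.exp '' {ζ : ℂ | |ζ.im| < ε * (-ζ.re)} := by
    ext u; constructor
    · rintro ⟨ζ, h, rfl⟩; exact ⟨-ζ, by simpa using h, rfl⟩
    · rintro ⟨ζ, h, rfl⟩; exact ⟨-ζ, by simpa using h, by simp⟩
  rw [this]
  apply Complex.isOpenMap_exp
  exact isOpen_lt (Complex.continuous_im.abs) (continuous_const.mul Complex.continuous_re.neg)

lemma dropU_spiral {ε t θ : ℝ} (ht : 0 ≤ t) (hθ : |θ| ≤ ε) {u : ℂ} (hu : u ∈ dropU ε) :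
    Complex.exp (-(t * (1 + θ * Complex.I))) * u ∈ dropU ε := by
  obtain ⟨ζ, h, rfl⟩ := hu
  refine ⟨ζ + t * (1 + θ * Complex.I), ?_, by rw [← Complex.exp_add]; ring_nf⟩
  have h1 : (ζ + t * (1 + θ * Complex.I)).im = ζ.im + t * θ := by simp
  have h2 : (ζ + t * (1 + θ * Complex.I)).re = ζ.re + t := by simp
  rw [h1, h2]
  have : |t * θ| ≤ t * ε := by rw [abs_mul, abs_of_nonneg ht]; gcongr
  have := abs_add_le ζ.im (t * θ)
  linarith

lemma dropU_norm {ε : ℝ} (hε : 0 < ε) {u : ℂ} (hu : u ∈ dropU ε) : ‖u‖ < 1 ∧ u ≠ 0 := by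
  obtain ⟨ζ, h, rfl⟩ := hu
  refine ⟨?_, Complex.exp_ne_zero _⟩
  have : 0 < ζ.re := by
    have := (abs_nonneg _).trans_lt h
    exact (pos_iff_pos_of_mul_pos this).1 hε
  rw [Complex.norm_exp]
  simpa using this

lemma dropU_small {ε : ℝ} (hε : 0 < ε) {u : ℂ} (hu0 : u ≠ 0) (hu : ‖u‖ < Real.exp (-(Real.pi / ε))) :
    u ∈ dropU ε := by
  refine ⟨-Complex.log u, ?_, by simp [Complex.exp_log hu0]⟩
  simp only [Complex.neg_im, abs_neg, Complex.log_im, Complex.neg_re, Complex.log_re]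
  have : Real.log ‖u‖ < -(Real.pi / ε) := by
    rw [← Real.log_exp (-(Real.pi / ε))]
    exact Real.log_lt_log (norm_pos_iff.2 hu0) hu
  have h2 : Real.pi < ε * -Real.log ‖u‖ := by
    rw [← div_lt_iff₀' hε]; linarith
  exact (Complex.abs_arg_le_pi u).trans_lt h2

lemma dropU_real {ε s : ℝ} (hε : 0 < ε) (hs0 : 0 < s) (hs1 : s < 1) : (s : ℂ) ∈ dropU ε := by
  refine ⟨-Real.log s, ?_, ?_⟩
  · simp only [Complex.neg_im, Complex.ofReal_im, neg_zero, abs_zero, Complex.neg_re, Complex.ofReal_re]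
    exact mul_pos hε (by have := Real.log_neg hs0 hs1; linarith)
  · rw [neg_neg, ← Complex.ofReal_exp, Real.exp_log hs0]

/-- the angular lemma: D vanishing linearly at drop vertices which see positive angle measure. -/
lemma LP_compact {ε C : ℝ} (hε : 0 < ε) {E : Set ℂ} (hE : IsCompact E) (h0E : (0:ℂ) ∉ E)
    {G : Set ℂ} (hG : G = {w | w = 0 ∨ ∃ e ∈ E, w / e ∈ dropU ε}) (hEG : ∀ e ∈ E, e ∉ G)
    (hA : 0 < volume ({θ : ℝ | ∃ e ∈ E, e = ‖e‖ * Complex.exp (θ * Complex.I)} ∩ Ioc 0 (2 * Real.pi)))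
    {D : ℂ → ℂ} (hD : DifferentiableOn ℂ D G) (hDC : ∀ e ∈ E, ∀ w, w / e ∈ dropU ε → ‖D w‖ ≤ C * ‖w - e‖) :
    D 0 = 0 := by
  have hpi := Real.pi_pos
  obtain ⟨e₀, he₀⟩ : E.Nonempty := by
    obtain ⟨θ, ⟨e, he, _⟩, _⟩ := nonempty_of_measure_ne_zero hA.ne'
    exact ⟨e, he⟩
  have hne : ∀ e ∈ E, e ≠ 0 := fun e he h => h0E (h ▸ he)
  obtain ⟨R, hR0, hR⟩ : ∃ R > 0, ∀ e ∈ E, ‖e‖ ≤ R := by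
    obtain ⟨R, hR⟩ := hE.isBounded.exists_norm_le
    exact ⟨max R 1, by positivity, fun e he => (hR e he).trans (le_max_left _ _)⟩
  have hspi : ∀ t θ : ℝ, 0 ≤ t → |θ| ≤ ε → ∀ w ∈ G, Complex.exp (-(t * (1 + θ * Complex.I))) * w ∈ G := by
    intro t θ ht hθ w hw
    rw [hG] at hw ⊢
    rcases hw with rfl | ⟨e, he, hw⟩
    · left; simp
    · right; exact ⟨e, he, by rw [mul_div_assoc]; exact dropU_spiral ht hθ hw⟩
  have h0G : (0:ℂ) ∈ G := by rw [hG]; left; rfl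
  have hGo : IsOpen G := by
    have : G = Metric.ball 0 (Real.exp (-(Real.pi / ε)) * ‖e₀‖) ∪ ⋃ e ∈ E, (fun w => w / e) ⁻¹' dropU ε := by
      ext w
      rw [hG]
      simp only [mem_ofPred_eq, mem_union, mem_iUnion, mem_preimage, exists_prop]
      have hp : 0 < ‖e₀‖ := norm_pos_iff.2 (hne _ he₀)
      constructor
      · rintro (rfl | h)
        · left; simp [hp]; positivity
        · right; exact h
      · rintro (h | h)
        · by_cases hw : w = 0
          · left; exact hw
          · right
            refine ⟨e₀, he₀, dropU_small hε (div_ne_zero hw (hne _ he₀)) ?_⟩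
            rw [norm_div, div_lt_iff₀ hp]; simpa using h
        · right; exact h
    rw [this]
    apply Metric.isOpen_ball.union
    apply isOpen_biUnion
    intro e he
    exact (dropU_open ε).preimage (continuous_id.div_const e)
  have hreal : ∀ s : ℝ, 0 < s → s ≤ 1 → ∀ w ∈ G, (s : ℂ) * w ∈ G := by
    intro s hs0 hs1 w hw
    have := hspi (-Real.log s) 0 (by have := Real.log_nonpos hs0.le hs1; linarith) (by simpa using hε.le) w hw
    simpa [← Complex.ofReal_exp, Real.exp_log hs0] using this
  have hGs : StarConvex ℝ 0 G := by
    rw [starConvex_zero_iff]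
    intro w hw s hs0 hs1
    rcases hs0.eq_or_lt with rfl | h
    · simpa using h0G
    · simpa using hreal s h hs1 w hw
  have hGb : ∀ w ∈ G, ‖w‖ < R := by
    intro w hw
    rw [hG] at hw
    rcases hw with rfl | ⟨e, he, hw⟩
    · simpa using hR0
    · have := (dropU_norm hε hw).1
      rw [norm_div, div_lt_one (norm_pos_iff.2 (hne e he))] at this
      exact this.trans_le (hR e he)
  obtain ⟨Ψ, Φ, hΨd, hΦd, hΨm, hΦm, hΦΨ, hΨΦ, hΦ0, hΨ0⟩ := rmt hGo hGs h0G hGb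
  have hBo : IsOpen (Metric.ball (0:ℂ) 1) := Metric.isOpen_ball
  have h0B : (0:ℂ) ∈ Metric.ball (0:ℂ) 1 := by simp
  have hΦat : ∀ z ∈ Metric.ball (0:ℂ) 1, HasDerivAt Φ (deriv Φ z) z := fun z hz =>
    ((hΦd z hz).differentiableAt (hBo.mem_nhds hz)).hasDerivAt
  have hΨat : ∀ w ∈ G, HasDerivAt Ψ (deriv Ψ w) w := fun w hw =>
    ((hΨd w hw).differentiableAt (hGo.mem_nhds hw)).hasDerivAt
  have hchain : ∀ z ∈ Metric.ball (0:ℂ) 1, deriv Ψ (Φ z) * deriv Φ z = 1 := by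
    intro z hz
    have h1 := (hΨat _ (hΦm hz)).comp z (hΦat z hz)
    have h2 : HasDerivAt (Ψ ∘ Φ) 1 z := (hasDerivAt_id z).congr_of_eventuallyEq (by
      filter_upwards [hBo.mem_nhds hz] with x hx
      exact hΨΦ x hx)
    exact h1.unique h2
  have hΦ'ne : ∀ z ∈ Metric.ball (0:ℂ) 1, deriv Φ z ≠ 0 := fun z hz h => by
    have := hchain z hz; rw [h] at this; simp at this
  have hΦne : ∀ z ∈ Metric.ball (0:ℂ) 1, z ≠ 0 → Φ z ≠ 0 := fun z hz hz0 h => by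
    have := hΨΦ z hz; rw [h, hΨ0] at this; exact hz0 this.symm
  -- the logarithmic derivative
  set F : ℂ → ℂ := dslope Φ 0 with hF
  have hFd : DifferentiableOn ℂ F (Metric.ball 0 1) :=
    (Complex.differentiableOn_dslope (hBo.mem_nhds h0B)).2 hΦd
  have hFz : ∀ z, Φ z = z * F z := by
    intro z
    have := sub_smul_dslope Φ 0 z
    simpa [hΦ0] using this.symm
  have hF0 : F 0 = deriv Φ 0 := by simp [hF]
  have hFne : ∀ z ∈ Metric.ball (0:ℂ) 1, F z ≠ 0 := by
    intro z hz h
    by_cases hz0 : z = 0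
    · subst hz0; rw [hF0] at h; exact hΦ'ne 0 hz h
    · exact hΦne z hz hz0 (by rw [hFz, h, mul_zero])
  set Θ : ℂ → ℂ := fun z => deriv Φ z / F z with hΘ
  have hΘd : DifferentiableOn ℂ Θ (Metric.ball 0 1) :=
    (hΦd.deriv hBo).div hFd hFne
  have hΘ0 : Θ 0 = 1 := by simp only [hΘ, hF0]; exact div_self (hΦ'ne 0 h0B)
  have hΘne : ∀ z ∈ Metric.ball (0:ℂ) 1, Θ z ≠ 0 := fun z hz => div_ne_zero (hΦ'ne z hz) (hFne z hz)
  -- sector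
  have hsecN : ∀ z ∈ Metric.ball (0:ℂ) 1, ∀ θ : ℝ, |θ| ≤ ε → 0 ≤ ((1 + θ * Complex.I) * (Θ z)⁻¹).re := by
    intro z hz θ hθ
    by_cases hz0 : z = 0
    · rw [hz0, hΘ0]; simp
    have hle : ∀ t : ℝ, 0 ≤ t → ‖Ψ (Complex.exp (-(t * (1 + θ * Complex.I))) * Φ z)‖ ≤ ‖z‖ := by
      intro t ht
      have := Complex.norm_le_norm_of_mapsTo_ball (f := fun x => Ψ (Complex.exp (-(t * (1 + θ * Complex.I))) * Φ x)) (R := 1) (z := z) ?_ ?_ ?_ ?_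
      · exact this
      · apply hΨd.comp (hΦd.const_mul _)
        intro x hx; exact hspi t θ ht hθ _ (hΦm hx)
      · intro x hx; exact Metric.ball_subset_closedBall (hΨm (hspi t θ ht hθ _ (hΦm hx)))
      · simp [hΦ0, hΨ0]
      · simpa using hz
    set g : ℝ → ℂ := fun t => Ψ (Complex.exp (-(t * (1 + θ * Complex.I))) * Φ z) with hg
    have hg0 : g 0 = z := by simp [hg, hΨΦ z hz]
    have hgd : HasDerivAt g (deriv Ψ (Φ z) * (-(1 + θ * Complex.I) * Φ z)) 0 := by
      have h1 : HasDerivAt (fun t : ℂ => Complex.exp (-(t * (1 + θ * Complex.I))) * Φ z) (-(1 + θ * Complex.I) * Φ z) ((0:ℝ):ℂ) := by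
        have := ((((hasDerivAt_id ((0:ℝ):ℂ)).mul_const (1 + θ * Complex.I)).neg).cexp).mul_const (Φ z)
        refine this.congr_deriv ?_
        simp
      have h2 : HasDerivAt (fun t : ℂ => Ψ (Complex.exp (-(t * (1 + θ * Complex.I))) * Φ z)) (deriv Ψ (Φ z) * (-(1 + θ * Complex.I) * Φ z)) ((0:ℝ):ℂ) := by
        have h3 : HasDerivAt Ψ (deriv Ψ (Φ z)) (Complex.exp (-(((0:ℝ):ℂ) * (1 + θ * Complex.I))) * Φ z) := by
          simpa using hΨat _ (hΦm hz)
        exact HasDerivAt.comp (h₂ := Ψ) (h := fun t : ℂ => Complex.exp (-(t * (1 + θ * Complex.I))) * Φ z) ((0:ℝ):ℂ) h3 h1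
      exact h2.comp_ofReal
    have hns : HasDerivAt (fun t => ‖g t‖ ^ 2) (2 * inner ℝ (g 0) (deriv Ψ (Φ z) * (-(1 + θ * Complex.I) * Φ z))) 0 := hgd.norm_sq
    have hle0 : 2 * inner ℝ (g 0) (deriv Ψ (Φ z) * (-(1 + θ * Complex.I) * Φ z)) ≤ 0 := by
      have hmax : ∀ t ∈ Ici (0:ℝ), ‖g t‖^2 ≤ ‖g 0‖^2 := fun t ht => by
        rw [hg0]; gcongr; exact hle t ht
      by_contra hpos
      push Not at hpos
      have h4 := hasDerivWithinAt_iff_tendsto_slope.1 (hns.hasDerivWithinAt (s := Ioi 0))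
      have h5 : ∀ᶠ t in 𝓝[Ioi 0 \ {0}] (0:ℝ), 0 < slope (fun t => ‖g t‖ ^ 2) 0 t := h4.eventually (lt_mem_nhds hpos)
      have h6 : Ioi (0:ℝ) \ {0} = Ioi 0 := by ext; simp
      rw [h6] at h5
      obtain ⟨t, ht, ht0⟩ := (h5.and self_mem_nhdsWithin).exists
      rw [slope_def_field] at ht
      have ht0' : 0 < t := ht0
      have h7 := hmax t ht0'.le
      have : (‖g t‖^2 - ‖g 0‖^2) / (t - 0) ≤ 0 := div_nonpos_of_nonpos_of_nonneg (by linarith) (by simpa using ht0'.le)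
      linarith
    rw [hg0] at hle0
    have hcalc : inner ℝ z (deriv Ψ (Φ z) * (-(1 + θ * Complex.I) * Φ z)) = -(‖z‖^2 * ((1 + θ * Complex.I) * (Θ z)⁻¹).re) := by
      have hΨ' : deriv Ψ (Φ z) = (deriv Φ z)⁻¹ := eq_inv_of_mul_eq_one_left (hchain z hz)
      have : deriv Ψ (Φ z) * (-(1 + θ * Complex.I) * Φ z) = -(z * ((1 + θ * Complex.I) * (Θ z)⁻¹)) := by
        rw [hΨ', hFz z, hΘ]; simp only [inv_div]; field_simp
      rw [this, Complex.inner]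
      have h8 : -(z * ((1 + θ * Complex.I) * (Θ z)⁻¹)) * (starRingEnd ℂ) z = ((-(‖z‖ ^ 2) : ℝ) : ℂ) * ((1 + θ * Complex.I) * (Θ z)⁻¹) := by
        push_cast
        rw [← Complex.mul_conj' z]; ring
      rw [h8, Complex.re_ofReal_mul]; ring
    rw [hcalc] at hle0
    have hz2 : 0 < ‖z‖^2 := by have := norm_pos_iff.2 hz0; positivity
    by_contra hneg
    push Not at hneg
    nlinarith
  have hsec : ∀ z ∈ Metric.ball (0:ℂ) 1, Θ z ≠ 0 ∧ ε / (1 + ε) * ‖Θ z‖ ≤ (Θ z).re := by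
    intro z hz
    refine ⟨hΘne z hz, ?_⟩
    have h1 := hsecN z hz ε (by rw [abs_of_pos hε])
    have h2 := hsecN z hz (-ε) (by rw [abs_neg, abs_of_pos hε])
    set n := (Θ z)⁻¹ with hn
    have hn0 : n ≠ 0 := inv_ne_zero (hΘne z hz)
    have hΘn : Θ z = n⁻¹ := by simp [hn]
    simp at h1 h2
    have h3 : ε * |n.im| ≤ n.re := by
      rcases abs_cases n.im with h | h <;> rw [h.1] <;> nlinarith
    have h4 : ε / (1 + ε) * ‖n‖ ≤ n.re := by
      have h5 := Complex.norm_le_abs_re_add_abs_im n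
      have h6 : 0 ≤ n.re := le_trans (by positivity) h3
      rw [abs_of_nonneg h6] at h5
      rw [div_mul_eq_mul_div, div_le_iff₀ (by linarith)]
      nlinarith
    rw [hΘn, norm_inv, Complex.inv_re, Complex.normSq_eq_norm_sq]
    have h7 : 0 < ‖n‖ := norm_pos_iff.2 hn0
    rw [le_div_iff₀ (by positivity)]
    calc ε / (1 + ε) * ‖n‖⁻¹ * ‖n‖ ^ 2 = ε / (1 + ε) * ‖n‖ := by field_simp
      _ ≤ _ := h4
  set A : Set ℝ := {θ : ℝ | ∃ e ∈ E, e = ‖e‖ * Complex.exp (θ * Complex.I)} with hAdef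
  have hAc : IsClosed A := by
    have hE1 : IsCompact ((fun e : ℂ => e / ‖e‖) '' E) := by
      apply hE.image_of_continuousOn
      apply continuousOn_id.div (Complex.continuous_ofReal.comp continuous_norm).continuousOn
      intro e he; simpa using hne e he
    have : A = (fun θ : ℝ => Complex.exp (θ * Complex.I)) ⁻¹' ((fun e : ℂ => e / ‖e‖) '' E) := by
      ext θ
      simp only [hAdef, mem_ofPred_eq, mem_preimage, mem_image]
      apply exists_congr; intro e
      apply and_congr_right; intro he
      have : (‖e‖ : ℂ) ≠ 0 := by simpa using hne e he
      rw [div_eq_iff this, mul_comm]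
    rw [this]
    apply hE1.isClosed.preimage
    fun_prop
  have hper : ∀ x, x + 2 * Real.pi ∈ A ↔ x ∈ A := by
    intro x
    have : Complex.exp (((x + 2 * Real.pi : ℝ) : ℂ) * Complex.I) = Complex.exp (x * Complex.I) := by
      push_cast
      rw [add_mul, Complex.exp_add, Complex.exp_two_pi_mul_I, mul_one]
    simp only [hAdef, mem_ofPred_eq, this]
  have hAfin : volume (A ∩ Ioc 0 (2 * Real.pi)) ≠ ⊤ :=
    ne_top_of_le_ne_top measure_Ioc_lt_top.ne (measure_mono inter_subset_right)
  have hApos : 0 < volume.real (A ∩ Ioc 0 (2 * Real.pi)) := ENNReal.toReal_pos hA.ne' hAfin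
  obtain ⟨c₀, hc₀, hang⟩ := angle_measure (c₁ := ε / (1 + ε)) (by positivity) hApos A hAc.measurableSet hper le_rfl
  have hang := hang Θ hΘd hΘ0 hsec
  -- formula for Φ on circles
  have hcirc : ∀ r : ℝ, 0 < r → r < 1 → ∀ θ : ℝ, Φ (circleMap 0 r θ) =
      Φ r * Complex.exp (Complex.I * ∫ s in 0..θ, Θ (circleMap 0 r s)) := by
    intro r hr0 hr1 θ
    have hcm : ∀ θ, circleMap 0 r θ ∈ Metric.ball (0:ℂ) 1 := fun θ =>
      Metric.closedBall_subset_ball hr1 (circleMap_mem_closedBall (0:ℂ) hr0.le θ)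
    have hcontΘ : Continuous (fun θ => Θ (circleMap 0 r θ)) :=
      hΘd.continuousOn.comp_continuous (continuous_circleMap _ _) hcm
    set I : ℝ → ℂ := fun θ => ∫ s in 0..θ, Θ (circleMap 0 r s) with hI
    have hId : ∀ θ, HasDerivAt I (Θ (circleMap 0 r θ)) θ := fun θ =>
      intervalIntegral.integral_hasDerivAt_right (hcontΘ.intervalIntegrable _ _)
        hcontΘ.aestronglyMeasurable.stronglyMeasurableAtFilter hcontΘ.continuousAt
    set g : ℝ → ℂ := fun θ => Φ (circleMap 0 r θ) * Complex.exp (-(Complex.I * I θ)) with hg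
    have hgd : ∀ θ, HasDerivAt g 0 θ := by
      intro θ
      have h1 : HasDerivAt (fun θ => Φ (circleMap 0 r θ)) (deriv Φ (circleMap 0 r θ) * (circleMap 0 r θ * Complex.I)) θ :=
        (hΦat _ (hcm θ)).comp θ (hasDerivAt_circleMap 0 r θ)
      have h2 := (((hId θ).const_mul Complex.I).neg).cexp
      refine (h1.mul h2).congr_deriv ?_
      have h3 : deriv Φ (circleMap 0 r θ) = Θ (circleMap 0 r θ) * F (circleMap 0 r θ) := by
        simp only [hΘ]; field_simp [hFne _ (hcm θ)]
      simp only [Pi.neg_apply, Pi.mul_apply]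
      rw [h3, hFz (circleMap 0 r θ)]; ring
    have hconst := is_const_of_deriv_eq_zero (fun θ => (hgd θ).differentiableAt) (fun θ => (hgd θ).deriv) θ 0
    have h0 : g 0 = Φ r := by simp [hg, hI, circleMap]
    rw [h0] at hconst
    rw [← hconst]
    change _ = Φ (circleMap 0 r θ) * Complex.exp (-(Complex.I * I θ)) * Complex.exp (Complex.I * I θ)
    rw [mul_assoc, ← Complex.exp_add, neg_add_cancel, Complex.exp_zero, mul_one]
  by_contra hD0
  set M := 2 * |C| * R + ‖D 0‖ + 1 with hM
  have hDM : ∀ w ∈ G, ‖D w‖ ≤ M := by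
    intro w hw
    have hw' := hw
    rw [hG] at hw
    rcases hw with rfl | ⟨e, he, hw⟩
    · rw [hM]; have : 0 ≤ 2 * |C| * R := by positivity
      linarith
    · have h1 := hDC e he w hw
      have h2 : ‖w - e‖ ≤ 2 * R := by
        have := norm_sub_le w e; have := hGb w hw'; have := hR e he; linarith
      have h3 : C * ‖w - e‖ ≤ |C| * (2 * R) := mul_le_mul (le_abs_self C) h2 (norm_nonneg _) (abs_nonneg _)
      have := norm_nonneg (D 0)
      linarith
  have hM1 : 1 ≤ M := by rw [hM]; have : 0 ≤ 2 * |C| * R := by positivity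
                         linarith [norm_nonneg (D 0)]
  set T := max 1 ((2 * Real.pi * Real.log M - 2 * Real.pi * Real.log ‖D 0‖ + 1) / c₀) with hT
  have hT1 : 1 ≤ T := le_max_left _ _
  have hT2 : 2 * Real.pi * Real.log M - 2 * Real.pi * Real.log ‖D 0‖ + 1 ≤ c₀ * T := by
    rw [← div_le_iff₀' hc₀]; exact le_max_right _ _
  set η := Real.exp (-T) with hη
  have hη0 : 0 < η := Real.exp_pos _
  have hη1 : η < 1 := by rw [hη, Real.exp_lt_one_iff]; linarith
  set δ := η / (|C| * R + 1) with hδ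
  have hCR : 0 < |C| * R + 1 := by positivity
  have hδ0 : 0 < δ := by positivity
  have hδ1 : δ < 1 := by
    rw [hδ, div_lt_one hCR]
    have : 0 ≤ |C| * R := by positivity
    linarith
  -- compact set K_δ
  have hKc : IsCompact ((fun q : ℝ × ℂ => (q.1 : ℂ) * q.2) '' (Icc 0 (1 - δ) ×ˢ E)) := by
    apply (isCompact_Icc.prod hE).image
    fun_prop
  set Kδ := (fun q : ℝ × ℂ => (q.1 : ℂ) * q.2) '' (Icc 0 (1 - δ) ×ˢ E) with hKδ
  have hKG : Kδ ⊆ G := by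
    rintro _ ⟨⟨s, e⟩, ⟨hs, he⟩, rfl⟩
    simp only at hs he ⊢
    rw [hG]
    rcases hs.1.eq_or_lt with h | h
    · left; rw [← h]; simp
    · right
      refine ⟨e, he, ?_⟩
      rw [mul_div_cancel_right₀ _ (hne e he)]
      exact dropU_real hε h (by linarith [hs.2])
  obtain ⟨r, hr0, hr1, hrK⟩ : ∃ r : ℝ, 0 < r ∧ r < 1 ∧ ∀ w ∈ Kδ, ‖Ψ w‖ < r := by
    have hΨc : ContinuousOn (fun w => ‖Ψ w‖) Kδ := (hΨd.continuousOn.mono hKG).norm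
    have hKne : Kδ.Nonempty := ⟨_, ⟨(0, e₀), ⟨⟨le_rfl, by linarith⟩, he₀⟩, rfl⟩⟩
    obtain ⟨w₀, hw₀, hmax⟩ := hKc.exists_isMaxOn hKne hΨc
    have h1 : ‖Ψ w₀‖ < 1 := by simpa using hΨm (hKG hw₀)
    refine ⟨(‖Ψ w₀‖ + 1) / 2, by linarith [norm_nonneg (Ψ w₀)], by linarith, fun w hw => ?_⟩
    have : ‖Ψ w‖ ≤ ‖Ψ w₀‖ := hmax hw
    linarith
  have hcm : ∀ θ, circleMap 0 r θ ∈ Metric.ball (0:ℂ) 1 := fun θ =>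
      Metric.closedBall_subset_ball hr1 (circleMap_mem_closedBall (0:ℂ) hr0.le θ)
  have hcontΘ : Continuous (fun θ => Θ (circleMap 0 r θ)) :=
      hΘd.continuousOn.comp_continuous (continuous_circleMap _ _) hcm
  set S := {θ | θ ∈ Ioc 0 (2 * Real.pi) ∧ (Φ r).arg + ∫ s in 0..θ, (Θ (circleMap 0 r s)).re ∈ A} with hS
  have hSc := hang r hr0 hr1 (Φ r).arg
  rw [← hS] at hSc
  have hSm : MeasurableSet S := by
    apply measurableSet_Ioc.inter
    have : Continuous fun θ => (Φ r).arg + ∫ s in 0..θ, (Θ (circleMap 0 r s)).re := by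
      apply continuous_const.add
      apply intervalIntegral.continuous_primitive
      intro a b
      exact (Complex.continuous_re.comp hcontΘ).intervalIntegrable _ _
    exact this.measurable hAc.measurableSet
  have hSsmall : ∀ θ ∈ S, ‖D (Φ (circleMap 0 r θ))‖ ≤ η := by
    rintro θ ⟨hθ, e, he, hee⟩
    set w := Φ (circleMap 0 r θ) with hw
    have hwG : w ∈ G := hΦm (hcm θ)
    have hep : 0 < ‖e‖ := norm_pos_iff.2 (hne e he)
    have hrB : (r : ℂ) ∈ Metric.ball (0:ℂ) 1 := by simpa [abs_of_pos hr0] using hr1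
    set I := ∫ s in 0..θ, Θ (circleMap 0 r s) with hI
    have hIre : ∫ s in 0..θ, (Θ (circleMap 0 r s)).re = I.re := by
      have h3 := intervalIntegral.intervalIntegral_re (μ := volume) (𝕜 := ℂ) (a := 0) (b := θ) (f := fun θ => Θ (circleMap 0 r θ)) (hcontΘ.intervalIntegrable _ _)
      simpa using h3
    rw [hIre] at hee
    set s : ℝ := ‖Φ r‖ * Real.exp (-I.im) / ‖e‖ with hs
    have hΦr : Φ r ≠ 0 := hΦne r hrB (by exact_mod_cast hr0.ne')
    have hs0 : 0 < s := by
      have := norm_pos_iff.2 hΦr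
      positivity
    have hwe : w = s * e := by
      rw [hw, hcirc r hr0 hr1 θ]
      have h1 : Φ r = ‖Φ r‖ * Complex.exp ((Φ r).arg * Complex.I) := (Complex.norm_mul_exp_arg_mul_I _).symm
      have h2 : Complex.exp (Complex.I * I) = Real.exp (-I.im) * Complex.exp (I.re * Complex.I) := by
        rw [Complex.ofReal_exp, ← Complex.exp_add]
        congr 1
        apply Complex.ext <;> simp
      have h3 : Complex.exp (((Φ r).arg + I.re : ℝ) * Complex.I) = Complex.exp ((Φ r).arg * Complex.I) * Complex.exp (I.re * Complex.I) := by
        rw [← Complex.exp_add]; push_cast; ring_nf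
      have h4 : (s : ℂ) * (‖e‖ : ℂ) = ‖Φ r‖ * Real.exp (-I.im) := by
        rw [← Complex.ofReal_mul, ← Complex.ofReal_mul, hs, div_mul_cancel₀ _ hep.ne']
      rw [← hI, h2]
      calc Φ r * (Real.exp (-I.im) * Complex.exp (I.re * Complex.I))
          = (‖Φ r‖ * Complex.exp ((Φ r).arg * Complex.I)) * (Real.exp (-I.im) * Complex.exp (I.re * Complex.I)) := by rw [← h1]
        _ = (‖Φ r‖ * Real.exp (-I.im)) * (Complex.exp ((Φ r).arg * Complex.I) * Complex.exp (I.re * Complex.I)) := by ring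
        _ = s * (‖e‖ * Complex.exp (((Φ r).arg + I.re : ℝ) * Complex.I)) := by rw [← h4, h3]; ring
        _ = s * e := by rw [← hee]
    have hs1 : s < 1 := by
      by_contra hge
      push Not at hge
      apply hEG e he
      have := hreal s⁻¹ (by positivity) (inv_le_one_of_one_le₀ hge) w hwG
      rw [hwe] at this
      have hsc : (s : ℂ) ≠ 0 := by exact_mod_cast hs0.ne'
      simpa [hsc] using this
    have hs2 : 1 - δ < s := by
      by_contra hle
      push Not at hle
      have := hrK w ⟨(s, e), ⟨⟨hs0.le, hle⟩, he⟩, hwe.symm⟩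
      rw [hw, hΨΦ _ (hcm θ)] at this
      simp [abs_of_pos hr0] at this
    have h1 := hDC e he w (by rw [hwe, mul_div_cancel_right₀ _ (hne e he)]; exact dropU_real hε hs0 hs1)
    have h2 : ‖w - e‖ ≤ δ * R := by
      have : w - e = ((s - 1 : ℝ) : ℂ) * e := by rw [hwe]; push_cast; ring
      rw [this, norm_mul, Complex.norm_real, Real.norm_eq_abs, abs_of_neg (by linarith)]
      apply mul_le_mul (by linarith) (hR e he) (norm_nonneg _) hδ0.le
    calc ‖D w‖ ≤ C * ‖w - e‖ := h1
      _ ≤ |C| * (δ * R) := mul_le_mul (le_abs_self C) h2 (norm_nonneg _) (abs_nonneg _)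
      _ ≤ η := by
        rw [hδ, ← sub_nonneg]
        have : η - |C| * (η / (|C| * R + 1) * R) = η / (|C| * R + 1) := by field_simp; ring
        rw [this]; positivity
  have hfan : AnalyticOnNhd ℂ (fun z => D (Φ z) / η) (Metric.closedBall 0 r) := by
    have h1 : DifferentiableOn ℂ (fun z => D (Φ z) / η) (Metric.ball 0 1) :=
      (hD.comp hΦd hΦm).div_const _
    exact (h1.analyticOnNhd hBo).mono (Metric.closedBall_subset_ball hr1)
  have hηn : ∀ w : ℂ, ‖w / η‖ = ‖w‖ / η := fun w => by rw [norm_div, Complex.norm_real, Real.norm_eq_abs, abs_of_pos hη0]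
  have hJ := jensen_set (M := M / η) hr0 (by rw [one_le_div hη0]; linarith) hfan (by simpa [hΦ0, hD0] using hη0.ne') S hSm (fun x hx => hx.1)
    (fun θ => by rw [hηn]; gcongr; exact hDM _ (hΦm (hcm θ)))
    (fun θ hθ => by rw [hηn, div_le_one hη0]; exact hSsmall θ hθ)
  rw [hηn, hΦ0, Real.log_div (by simpa using hD0) hη0.ne', Real.log_div (by linarith) hη0.ne', hη, Real.log_exp] at hJ
  have hlM : 0 ≤ Real.log M := Real.log_nonneg hM1
  have : (2 * Real.pi - volume.real S) * (Real.log M - -T) ≤ (2 * Real.pi - c₀) * (Real.log M - -T) := by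
    apply mul_le_mul_of_nonneg_right <;> linarith
  nlinarith

end

noncomputable section
open Set MvPolynomial Topology MeasureTheory

lemma LP_gen {ε C r₀ R : ℝ} (hε : 0 < ε) (hr₀ : 0 < r₀) {E : Set ℂ} {w₁ : ℂ}
    (hEr : ∀ e ∈ E, r₀ ≤ ‖e - w₁‖) (hER : ∀ e ∈ E, ‖e - w₁‖ ≤ R)
    {G : Set ℂ} (hG : G = {w | w = w₁ ∨ ∃ e ∈ E, (w - w₁) / (e - w₁) ∈ dropU ε}) (hEG : ∀ e ∈ E, e ∉ G)
    (hvol : volume (Complex.im '' E) ≠ 0)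
    {D : ℂ → ℂ} (hD : DifferentiableOn ℂ D G)
    (hDC : ∀ e ∈ E, ∀ w, (w - w₁) / (e - w₁) ∈ dropU ε → ‖D w‖ ≤ C * ‖w - e‖) :
    D w₁ = 0 := by
  have hpi := Real.pi_pos
  set S : Set ℂ := (fun e => e - w₁) '' E with hS
  have hSr : ∀ e ∈ S, r₀ ≤ ‖e‖ := by rintro _ ⟨e, he, rfl⟩; exact hEr e he
  have hSR : ∀ e ∈ S, ‖e‖ ≤ R := by rintro _ ⟨e, he, rfl⟩; exact hER e he
  have hcr : ∀ e ∈ closure S, r₀ ≤ ‖e‖ := fun e he =>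
    closure_minimal hSr (isClosed_le continuous_const continuous_norm) he
  have hcne : ∀ e ∈ closure S, e ≠ 0 := fun e he h => by
    have := hcr e he; rw [h, norm_zero] at this; linarith
  have hcomp : IsCompact (closure S) := by
    apply Bornology.IsBounded.isCompact_closure
    exact isBounded_iff_forall_norm_le.2 ⟨R, hSR⟩
  have hVo : ∀ w : ℂ, IsOpen {e : ℂ | e ≠ 0 ∧ w / e ∈ dropU ε} := by
    intro w
    have : ContinuousOn (fun e : ℂ => w / e) {e | e ≠ 0} :=
      continuousOn_const.div continuousOn_id (fun e he => he)
    exact this.isOpen_inter_preimage isOpen_ne (dropU_open ε)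
  have key : ∀ w : ℂ, ∀ e ∈ closure S, w / e ∈ dropU ε →
      e ∈ closure ({e : ℂ | e ≠ 0 ∧ w / e ∈ dropU ε} ∩ S) := by
    intro w e he hw
    exact (hVo w).inter_closure ⟨⟨hcne e he, hw⟩, he⟩
  have key2 : ∀ w : ℂ, ∀ e ∈ closure S, w / e ∈ dropU ε → ∃ e' ∈ S, w / e' ∈ dropU ε := by
    intro w e he hw
    obtain ⟨e', he', he''⟩ := closure_nonempty_iff.1 ⟨e, key w e he hw⟩
    exact ⟨e', he'', he'.2⟩
  have hsep : ∀ e ∈ S, ∀ e' ∈ S, e / e' ∉ dropU ε := by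
    rintro _ ⟨e, he, rfl⟩ _ ⟨e', he', rfl⟩ h
    apply hEG e he
    rw [hG]; right; exact ⟨e', he', h⟩
  have hmain := LP_compact (C := C) (D := fun w => D (w + w₁)) hε hcomp (fun h => hcne 0 h rfl) rfl ?_ ?_ ?_ ?_
  · simpa using hmain
  · rintro e he (h | ⟨e₁, he₁, h⟩)
    · exact hcne e he h
    · obtain ⟨e₂, he₂, h⟩ := key2 e e₁ he₁ h
      have ho : IsOpen ((fun w => w / e₂) ⁻¹' dropU ε) := (dropU_open ε).preimage (continuous_id.div_const e₂)
      obtain ⟨e₃, h3, h4⟩ := mem_closure_iff.1 he _ ho h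
      exact hsep e₃ h4 e₂ he₂ h3
  · -- measure
    set A : Set ℝ := {θ : ℝ | ∃ e ∈ closure S, e = ‖e‖ * Complex.exp (θ * Complex.I)} ∩ Ioc 0 (2 * Real.pi) with hA
    rw [pos_iff_ne_zero]
    intro hA0
    apply hvol
    -- choose
    have hang : ∀ e ∈ S, ∃ θ ∈ A, e = ‖e‖ * Complex.exp (θ * Complex.I) := by
      intro e he
      have hexp : e = ‖e‖ * Complex.exp (e.arg * Complex.I) := (Complex.norm_mul_exp_arg_mul_I e).symm
      have harg := Complex.arg_mem_Ioc e
      by_cases h : 0 < e.arg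
      · exact ⟨e.arg, ⟨⟨e, subset_closure he, hexp⟩, h, by linarith [harg.2]⟩, hexp⟩
      · have : e = ‖e‖ * Complex.exp ((e.arg + 2 * Real.pi : ℝ) * Complex.I) := by
          push_cast
          rw [add_mul, Complex.exp_add, Complex.exp_two_pi_mul_I, mul_one]; exact hexp
        exact ⟨e.arg + 2 * Real.pi, ⟨⟨e, subset_closure he, this⟩, by linarith [harg.1], by linarith⟩, this⟩
    have hR0 : ∀ e ∈ S, r₀ ≤ R := fun e he => (hSr e he).trans (hSR e he)
    obtain ⟨Lc, hLc⟩ : ∃ Lc : NNReal, ∀ e ∈ S, ∀ e' ∈ S, ∀ θ ∈ A, ∀ θ' ∈ A, e = ‖e‖ * Complex.exp (θ * Complex.I) →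
        e' = ‖e'‖ * Complex.exp (θ' * Complex.I) → ‖e - e'‖ ≤ Lc * |θ - θ'| := by
      set B := |Real.log R| + |Real.log r₀| with hB
      set Q := 2 * B + 2 * Real.pi with hQ
      refine ⟨⟨|R| * Real.exp Q * (1 + 1 / ε), by positivity⟩, ?_⟩
      intro e he e' he' θ hθ θ' hθ' h h'
      have hp : 0 < ‖e‖ := hr₀.trans_le (hSr e he)
      have hp' : 0 < ‖e'‖ := hr₀.trans_le (hSr e' he')
      have hlog : ∀ x ∈ S, |Real.log ‖x‖| ≤ B := by
        intro x hx
        have hx0 : 0 < ‖x‖ := hr₀.trans_le (hSr x hx)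
        have h1 := Real.log_le_log hr₀ (hSr x hx)
        have h2 := Real.log_le_log hx0 (hSR x hx)
        rw [abs_le]
        constructor
        · have := neg_abs_le (Real.log r₀); have := abs_nonneg (Real.log R); linarith
        · have := le_abs_self (Real.log R); have := abs_nonneg (Real.log r₀); linarith
      set a := Real.log ‖e‖ - Real.log ‖e'‖ with ha
      set b := θ - θ' with hb
      set ζ : ℂ := a + b * Complex.I with hζ
      have hζre : ζ.re = a := by simp [hζ]
      have hζim : ζ.im = b := by simp [hζ]
      have hee : e' / e = Complex.exp (-ζ) := by
        have e1 : e = Complex.exp (Real.log ‖e‖ + θ * Complex.I) := by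
          rw [Complex.exp_add, ← Complex.ofReal_exp, Real.exp_log hp]; exact h
        have e2 : e' = Complex.exp (Real.log ‖e'‖ + θ' * Complex.I) := by
          rw [Complex.exp_add, ← Complex.ofReal_exp, Real.exp_log hp']; exact h'
        conv_lhs => rw [e1, e2]
        rw [← Complex.exp_sub]
        congr 1
        rw [hζ, ha, hb]; push_cast; ring
      have hee' : e / e' = Complex.exp (-(-ζ)) := by
        rw [neg_neg, ← inv_div, hee, Complex.exp_neg, inv_inv]
      have h1 : ε * a ≤ |b| := by
        by_contra hlt
        push Not at hlt
        exact hsep e' he' e he ⟨ζ, by rw [hζre, hζim]; exact hlt, hee⟩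
      have h2 : ε * (-a) ≤ |b| := by
        by_contra hlt
        push Not at hlt
        exact hsep e he e' he' ⟨-ζ, by rw [Complex.neg_re, Complex.neg_im, hζre, hζim, abs_neg]; exact hlt, hee'⟩
      have h3 : |a| ≤ |b| / ε := by
        rw [le_div_iff₀ hε]
        rcases abs_cases a with h | h <;> rw [h.1] <;> linarith
      have hζn : ‖ζ‖ ≤ (1 + 1/ε) * |b| := by
        have := Complex.norm_le_abs_re_add_abs_im ζ
        rw [hζre, hζim] at this
        have h4 : (1 + 1/ε) * |b| = |b| + |b| / ε := by ring
        linarith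
      have hζQ : ‖ζ‖ ≤ Q := by
        have := Complex.norm_le_abs_re_add_abs_im ζ
        rw [hζre, hζim] at this
        have h5 : |a| ≤ 2 * B := by
          have := abs_sub (Real.log ‖e‖) (Real.log ‖e'‖)
          have := hlog e he; have := hlog e' he'
          linarith
        have h6 : |b| ≤ 2 * Real.pi := by
          rw [abs_le]; constructor <;> linarith [hθ.2.1, hθ.2.2, hθ'.2.1, hθ'.2.2]
        linarith
      have hen : e - e' = e * (1 - Complex.exp (-ζ)) := by
        rw [← hee]; field_simp [norm_pos_iff.1 hp]
      have h7 : ‖1 - Complex.exp (-ζ)‖ ≤ ‖ζ‖ * Real.exp Q := by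
        have := Complex.norm_exp_sub_sum_le_norm_mul_exp (-ζ) 1
        simp at this
        rw [norm_sub_rev]
        refine this.trans ?_
        gcongr
      rw [hen, norm_mul]
      change _ ≤ (|R| * Real.exp Q * (1 + 1 / ε)) * |b|
      calc ‖e‖ * ‖1 - Complex.exp (-ζ)‖ ≤ |R| * (‖ζ‖ * Real.exp Q) := by
            gcongr; exact (hSR e he).trans (le_abs_self R)
        _ ≤ |R| * (((1 + 1/ε) * |b|) * Real.exp Q) := by gcongr
        _ = _ := by ring
    choose! th hthA hth using hang
    have him : ∀ e ∈ E, e - w₁ ∈ S := fun e he => ⟨e, he, rfl⟩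
    set B := (fun e => th (e - w₁)) '' E with hB
    have hBA : B ⊆ A := by rintro _ ⟨e, he, rfl⟩; exact hthA _ (him e he)
    -- choose inverse
    have hinv : ∀ b ∈ B, ∃ e ∈ E, th (e - w₁) = b := fun b hb => hb
    choose! ev hevE hev using hinv
    have hlip : LipschitzOnWith Lc (fun b => (ev b).im) B := by
      rw [lipschitzOnWith_iff_dist_le_mul]
      intro b hb b' hb'
      have := hLc _ (him _ (hevE b hb)) _ (him _ (hevE b' hb')) _ (hthA _ (him _ (hevE b hb))) _ (hthA _ (him _ (hevE b' hb')))
        (hth _ (him _ (hevE b hb))) (hth _ (him _ (hevE b' hb')))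
      rw [hev b hb, hev b' hb'] at this
      rw [Real.dist_eq, Real.dist_eq]
      refine le_trans ?_ this
      have h8 := Complex.abs_im_le_norm (ev b - w₁ - (ev b' - w₁))
      simpa using h8
    have himg : Complex.im '' E ⊆ (fun b => (ev b).im) '' B := by
      rintro _ ⟨e, he, rfl⟩
      refine ⟨th (e - w₁), ⟨e, he, rfl⟩, ?_⟩
      have hb : th (e - w₁) ∈ B := ⟨e, he, rfl⟩
      have := hLc _ (him _ (hevE _ hb)) _ (him e he) _ (hthA _ (him _ (hevE _ hb))) _ (hthA _ (him e he))
        (hth _ (him _ (hevE _ hb))) (hth _ (him e he))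
      rw [hev _ hb, sub_self, abs_zero, mul_zero, norm_le_zero_iff, sub_eq_zero] at this
      have h9 : ev (th (e - w₁)) = e := by simpa using this
      simp only [h9]
    have hB0 : volume B = 0 := measure_mono_null hBA hA0
    rw [← hausdorffMeasure_real] at hB0 ⊢
    apply measure_mono_null himg
    have := hlip.hausdorffMeasure_image_le (d := 1) zero_le_one
    rw [hB0, mul_zero] at this
    exact le_antisymm this zero_le
  · apply hD.comp (differentiableOn_id.add_const _)
    rintro w (rfl | ⟨e, he, hw⟩)
    · rw [hG]; left; simp
    · obtain ⟨_, ⟨e', he', rfl⟩, h⟩ := key2 w e he hw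
      rw [hG]; right
      exact ⟨e', he', by simpa using h⟩
  · intro e he w hw
    have hcl : IsClosed {e' : ℂ | ‖D (w + w₁)‖ ≤ C * ‖w - e'‖} :=
      isClosed_le continuous_const (by fun_prop)
    refine closure_minimal ?_ hcl (key w e he hw)
    rintro _ ⟨⟨_, h⟩, e', he', rfl⟩
    have := hDC e' he' (w + w₁) (by simpa using h)
    have h2 : w + w₁ - e' = w - (e' - w₁) := by ring
    rw [h2] at this
    exact this

end

noncomputable section
open Set MvPolynomial Topology MeasureTheory

lemma lip_sard {h : ℝ → ℝ} {L : NNReal} (hL : LipschitzWith L h) :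
    ∀ᵐ y : ℝ, ∀ t, h t = y → ∃ h', h' ≠ 0 ∧ HasDerivAt h h' t := by
  have h1 : volume (h '' {t | ¬ DifferentiableAt ℝ h t}) = 0 := by
    have h0 : volume {t | ¬ DifferentiableAt ℝ h t} = 0 := hL.ae_differentiableAt
    rw [← hausdorffMeasure_real] at h0 ⊢
    have := (hL.lipschitzOnWith (s := {t | ¬ DifferentiableAt ℝ h t})).hausdorffMeasure_image_le (d := 1) zero_le_one
    rw [h0, mul_zero] at this
    exact le_antisymm this zero_le
  have h2 : volume (h '' {t | DifferentiableAt ℝ h t ∧ deriv h t = 0}) = 0 := by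
    apply addHaar_image_eq_zero_of_det_fderivWithin_eq_zero (f' := fun _ => 0) volume
    · rintro t ⟨ht, h0⟩
      have := ht.hasDerivAt.hasFDerivAt
      rw [h0] at this
      simpa using this.hasFDerivWithinAt
    · intro t _; simp
  rw [ae_iff]
  apply measure_mono_null _ (measure_union_null h1 h2)
  intro y hy
  simp only [mem_ofPred_eq, not_forall] at hy
  obtain ⟨t, ht, hn⟩ := hy
  by_cases hd : DifferentiableAt ℝ h t
  · right
    refine ⟨t, ⟨hd, ?_⟩, ht⟩
    by_contra hne
    exact hn ⟨_, hne, hd.hasDerivAt⟩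
  · left; exact ⟨t, hd, ht⟩

/-- local structure at a transversal crossing value -/
lemma cross_local {c : ℝ → ℂ} {L : NNReal} (hL : LipschitzWith L c) {e : ℂ}
    (hy : ∀ t, (c t).im = e.im → ∃ h', h' ≠ 0 ∧ HasDerivAt (fun t => (c t).im) h' t) :
    ∃ C : ℝ, 1 ≤ C ∧ (∀ t ∈ Icc (0:ℝ) 1, ‖c t - e‖ ≤ C * |(c t - e).im| ∨ 1 ≤ C * ‖c t - e‖) ∧
      ∃ (m : ℕ) (τ : Fin m → ℝ), (∀ l, τ l ∈ Icc (0:ℝ) 1) ∧ ∀ t ∈ Icc (0:ℝ) 1, ∏ l, |t - τ l| ≤ C * ‖c t - e‖ := by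
  set Z := {t | t ∈ Icc (0:ℝ) 1 ∧ c t = e} with hZ
  have hZc : IsCompact Z := by
    have : Z = Icc (0:ℝ) 1 ∩ c ⁻¹' {e} := rfl
    rw [this]
    exact isCompact_Icc.inter_right (isClosed_singleton.preimage hL.continuous)
  have hZf : Z.Finite := by
    by_contra hinf
    obtain ⟨t, ht, hacc⟩ := Set.Infinite.exists_accPt_of_subset_isCompact hinf hZc Subset.rfl
    obtain ⟨h', hne, hd⟩ := hy t (by rw [ht.2])
    have := hd.eventually_ne (c := e.im) hne
    rw [accPt_iff_frequently_nhdsNE] at hacc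
    obtain ⟨s, hs, hs'⟩ := (hacc.and_eventually this).exists
    exact hs' (by rw [hs.2])
  obtain ⟨m, τ, hτinj, hτr⟩ := hZf.fin_param
  have hτZ : ∀ l, τ l ∈ Z := fun l => hτr ▸ mem_range_self l
  have hprod1 : ∀ t ∈ Icc (0:ℝ) 1, ∀ l, |t - τ l| ≤ 1 := by
    intro t ht l
    have := (hτZ l).1
    rw [abs_le]; constructor <;> linarith [ht.1, ht.2, this.1, this.2]
  have hmain : ∃ C : ℝ, 1 ≤ C ∧ ∀ t ∈ Icc (0:ℝ) 1, (‖c t - e‖ ≤ C * |(c t - e).im| ∨ 1 ≤ C * ‖c t - e‖) ∧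
      ∏ l, |t - τ l| ≤ C * ‖c t - e‖ := by
    have key : ∃ C : ℝ, 1 ≤ C ∧ ∀ t ∈ Icc (0:ℝ) 1, t ∈ Icc (0:ℝ) 1 → (‖c t - e‖ ≤ C * |(c t - e).im| ∨ 1 ≤ C * ‖c t - e‖) ∧
      ∏ l, |t - τ l| ≤ C * ‖c t - e‖ := by
      apply isCompact_Icc.induction_on (p := fun s => ∃ C : ℝ, 1 ≤ C ∧ ∀ t ∈ s, t ∈ Icc (0:ℝ) 1 → (‖c t - e‖ ≤ C * |(c t - e).im| ∨ 1 ≤ C * ‖c t - e‖) ∧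
      ∏ l, |t - τ l| ≤ C * ‖c t - e‖)
      · exact ⟨1, le_rfl, by simp⟩
      · rintro s t hst ⟨C, hC, h⟩
        exact ⟨C, hC, fun x hx => h x (hst hx)⟩
      · rintro s t ⟨C, hC, h⟩ ⟨C', hC', h'⟩
        refine ⟨max C C', le_max_of_le_left hC, ?_⟩
        rintro x (hx | hx) hxI
        · obtain ⟨h1, h2⟩ := h x hx hxI
          have hle : C ≤ max C C' := le_max_left _ _
          refine ⟨h1.imp (fun h => h.trans (by gcongr)) (fun h => h.trans (by gcongr)), h2.trans (by gcongr)⟩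
        · obtain ⟨h1, h2⟩ := h' x hx hxI
          have hle : C' ≤ max C C' := le_max_right _ _
          refine ⟨h1.imp (fun h => h.trans (by gcongr)) (fun h => h.trans (by gcongr)), h2.trans (by gcongr)⟩
      · intro t ht
        by_cases hct : c t = e
        · obtain ⟨h', hne, hd⟩ := hy t (by rw [hct])
          have htZ : t ∈ Z := ⟨ht, hct⟩
          obtain ⟨l₀, hl₀⟩ : ∃ l, τ l = t := by rw [← hτr] at htZ; exact htZ
          set a := |h'| / 2 with ha
          have hap : 0 < a := by have := abs_pos.2 hne; positivity
          have hev : ∀ᶠ s in 𝓝 t, a * |s - t| ≤ |(c s - e).im| := by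
            have h1 := (hasDerivAt_iff_isLittleO.1 hd).def hap
            filter_upwards [h1] with s hs
            rw [Real.norm_eq_abs, Real.norm_eq_abs, smul_eq_mul, hct] at hs
            have h2 : (c s - e).im = (c s).im - e.im := by simp
            rw [h2]
            have h3 : |(s - t) * h'| ≤ |(c s).im - e.im| + |(c s).im - e.im - (s - t) * h'| := by
              have := abs_sub ((c s).im - e.im) ((c s).im - e.im - (s - t) * h')
              simpa using this
            rw [abs_mul] at h3
            have : |s - t| * |h'| = 2 * (a * |s - t|) := by rw [ha]; ring
            linarith
          refine ⟨_, mem_nhdsWithin_of_mem_nhds hev, max 1 (max (L / a) (1 / a)), le_max_left _ _, ?_⟩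
          intro s hs hsI
          have hs' : a * |s - t| ≤ |(c s - e).im| := hs
          have hst : |s - t| ≤ |(c s - e).im| / a := by rw [le_div_iff₀' hap]; exact hs'
          have hLs : ‖c s - e‖ ≤ L * |s - t| := by
            have := hL.dist_le_mul s t
            rwa [hct, Complex.dist_eq, Real.dist_eq] at this
          constructor
          · left
            calc ‖c s - e‖ ≤ L * |s - t| := hLs
              _ ≤ L * (|(c s - e).im| / a) := by gcongr
              _ = (L / a) * |(c s - e).im| := by ring
              _ ≤ _ := by gcongr; exact le_max_of_le_right (le_max_left _ _)
          · have : ∏ l, |s - τ l| ≤ |s - t| := by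
              rw [← Finset.mul_prod_erase _ _ (Finset.mem_univ l₀), hl₀]
              apply mul_le_of_le_one_right (abs_nonneg _)
              apply Finset.prod_le_one
              · intro i _; exact abs_nonneg _
              · intro i _; exact hprod1 s hsI i
            calc ∏ l, |s - τ l| ≤ |(c s - e).im| / a := this.trans hst
              _ ≤ ‖c s - e‖ / a := by gcongr; exact Complex.abs_im_le_norm _
              _ = (1/a) * ‖c s - e‖ := by ring
              _ ≤ _ := by gcongr; exact le_max_of_le_right (le_max_right _ _)
        · have hpos : 0 < ‖c t - e‖ := norm_pos_iff.2 (sub_ne_zero.2 hct)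
          have hev : ∀ᶠ s in 𝓝 t, ‖c t - e‖ / 2 < ‖c s - e‖ := by
            have : Continuous fun s => ‖c s - e‖ := (hL.continuous.sub continuous_const).norm
            exact this.continuousAt.eventually (lt_mem_nhds (by linarith))
          refine ⟨_, mem_nhdsWithin_of_mem_nhds hev, max 1 (2 / ‖c t - e‖), le_max_left _ _, ?_⟩
          intro s hs hsI
          have hs' : ‖c t - e‖ / 2 < ‖c s - e‖ := hs
          have h1 : 1 ≤ max 1 (2 / ‖c t - e‖) * ‖c s - e‖ := by
            calc (1:ℝ) = (2 / ‖c t - e‖) * (‖c t - e‖ / 2) := by field_simp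
              _ ≤ _ := by gcongr; exact le_max_right _ _
          refine ⟨Or.inr h1, le_trans ?_ h1⟩
          apply Finset.prod_le_one
          · intro i _; exact abs_nonneg _
          · intro i _; exact hprod1 s hsI i
    obtain ⟨C, hC, h⟩ := key
    exact ⟨C, hC, fun t ht => h t ht ht⟩
  obtain ⟨C, hC, h⟩ := hmain
  exact ⟨C, hC, fun t ht => (h t ht).1, m, τ, fun l => (hτZ l).1, fun t ht => (h t ht).2⟩

end

noncomputable section
open Set MvPolynomial Topology MeasureTheory

lemma drop_geom {ε : ℝ} (hε : 0 < ε) {a u : ℂ} (ha : |a.im| ≤ ε * a.re)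
    (hu : u ∈ dropU ε) : |(a * (1 - u)).im| ≤ 2 * ε * ‖a * (1 - u)‖ ∧ ‖a * (1-u)‖ ≤ 2 * ‖a‖ := by
  have hn := (dropU_norm hε hu).1
  have hare : 0 ≤ a.re := by
    have := (abs_nonneg _).trans ha
    exact nonneg_of_mul_nonneg_right this hε
  have h1u : |(1 - u).im| ≤ ε * (1 - u).re ∧ 0 ≤ (1-u).re := by
    obtain ⟨ζ, h, rfl⟩ := hu
    have hr : 0 < ζ.re := by
      have := (abs_nonneg _).trans_lt h
      exact (pos_iff_pos_of_mul_pos this).1 hε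
    have e1 : (1 - Complex.exp (-ζ)).im = Real.exp (-ζ.re) * Real.sin ζ.im := by
      simp [Complex.exp_im]
    have e2 : (1 - Complex.exp (-ζ)).re = 1 - Real.exp (-ζ.re) * Real.cos ζ.im := by
      simp [Complex.exp_re]
    have hp := Real.exp_pos (-ζ.re)
    have h3 : ζ.re * Real.exp (-ζ.re) ≤ 1 - Real.exp (-ζ.re) := by
      have := Real.add_one_le_exp ζ.re
      have h4 : Real.exp ζ.re * Real.exp (-ζ.re) = 1 := by rw [← Real.exp_add]; simp
      nlinarith
    have h5 : Real.exp (-ζ.re) * Real.cos ζ.im ≤ Real.exp (-ζ.re) := by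
      have := Real.cos_le_one ζ.im; nlinarith
    have h6 : |Real.sin ζ.im| ≤ |ζ.im| := Real.abs_sin_le_abs
    rw [e1, e2, abs_mul, abs_of_pos hp]
    constructor
    · calc Real.exp (-ζ.re) * |Real.sin ζ.im| ≤ Real.exp (-ζ.re) * (ε * ζ.re) := by gcongr; linarith
        _ = ε * (ζ.re * Real.exp (-ζ.re)) := by ring
        _ ≤ ε * (1 - Real.exp (-ζ.re)) := by gcongr
        _ ≤ _ := by gcongr
    · have : 0 ≤ ζ.re * Real.exp (-ζ.re) := by positivity
      linarith
  obtain ⟨h1, h2⟩ := h1u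
  constructor
  · have e1 : (a * (1 - u)).im = a.re * (1-u).im + a.im * (1-u).re := Complex.mul_im _ _
    have : ‖a * (1-u)‖ ≥ a.re * (1-u).re := by
      rw [norm_mul]
      exact mul_le_mul (Complex.re_le_norm _) (Complex.re_le_norm _) h2 (norm_nonneg _)
    rw [e1]
    calc _ ≤ |a.re * (1-u).im| + |a.im * (1-u).re| := abs_add_le _ _
      _ = a.re * |(1-u).im| + |a.im| * (1-u).re := by
        rw [abs_mul, abs_mul, abs_of_nonneg hare, abs_of_nonneg h2]
      _ ≤ a.re * (ε * (1-u).re) + (ε * a.re) * (1-u).re := by gcongr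
      _ = 2 * ε * (a.re * (1-u).re) := by ring
      _ ≤ _ := by gcongr
  · rw [norm_mul, mul_comm]
    gcongr
    calc ‖1 - u‖ ≤ ‖(1:ℂ)‖ + ‖u‖ := norm_sub_le _ _
      _ ≤ 2 := by rw [norm_one]; linarith

lemma cone_est {W : Set ℂ} {e w : ℂ} {C ε : ℝ} (hC : 1 ≤ C) (hε : C * ε ≤ 1/2)
    (h1 : ∀ q ∈ W, ‖q - e‖ ≤ C * |(q - e).im| ∨ 1 ≤ C * ‖q - e‖)
    (hw : |(w - e).im| ≤ ε * ‖w - e‖) (hw2 : ‖w - e‖ ≤ 1 / (4 * C)) (q : ℂ) (hq : q ∈ W) :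
    ‖w - e‖ ≤ 4 * C * ‖q - w‖ ∧ ‖q - e‖ ≤ 5 * C * ‖q - w‖ := by
  have t1 : ‖w - e‖ ≤ ‖q - e‖ + ‖q - w‖ := by
    have := norm_sub_le (q - e) (q - w); simpa using this
  have t2 : ‖q - e‖ ≤ ‖q - w‖ + ‖w - e‖ := by
    have := norm_add_le (q - w) (w - e); simpa using this
  have n1 := norm_nonneg (q - w)
  suffices h : ‖w - e‖ ≤ 4 * C * ‖q - w‖ from ⟨h, by nlinarith⟩
  rcases h1 q hq with h | h
  · have h3 : |(q - e).im| ≤ |(w - e).im| + ‖q - w‖ := by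
      have : (q - e).im = (w - e).im + (q - w).im := by simp
      rw [this]
      exact (abs_add_le _ _).trans (by gcongr; exact Complex.abs_im_le_norm _)
    have : ‖q - e‖ ≤ C * (ε * ‖w - e‖ + ‖q - w‖) := h.trans (by gcongr; linarith)
    have : (C * ε) * ‖w - e‖ ≤ 1/2 * ‖w - e‖ := by gcongr
    nlinarith
  · rw [le_div_iff₀ (by linarith)] at hw2
    have : ‖w - e‖ * 4 ≤ ‖q - e‖ := by
      have h0 : 0 < C := by linarith
      have : C * (‖w - e‖ * 4) ≤ C * ‖q - e‖ := by linarith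
      exact le_of_mul_le_mul_left this h0
    have := norm_nonneg (w - e)
    nlinarith

structure CrossP (c : ℝ → ℂ) (W : Set ℂ) (U : ℕ → Set ℂ) (w₁ : ℂ) (j r k m : ℕ) (e : ℂ) : Prop where
  j1 : 1 ≤ j
  r1 : 1 ≤ r
  eW : e ∈ W
  near : ‖e - w₁‖ < 1 / (2 * j)
  far : 1 / (r:ℝ) ≤ ‖e - w₁‖
  wW : w₁ ∉ W
  wU : ∀ k, w₁ ∉ U k
  drop : ∀ w, (w - w₁) / (e - w₁) ∈ dropU (1 / j) → ∀ q ∈ W, ‖w - e‖ ≤ j * ‖q - w‖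
  right : ∀ s : ℝ, 0 < s → s < 1 / j → e + s ∈ U k ∧ ∀ q ∈ W, ‖q - e‖ ≤ j * ‖q - (e + s)‖
  prod : ∃ τ : Fin m → ℝ, (∀ l, τ l ∈ Icc (0:ℝ) 1) ∧ ∀ t ∈ Icc (0:ℝ) 1, ∏ l, |t - τ l| ≤ j * ‖c t - e‖
  disc : ∀ q ∈ W, ‖q‖ ≤ 1/4 → 1 ≤ j * ‖q - e‖

lemma clopen_const {W U S : Set ℂ} (hU : IsOpen U) (hU' : IsOpen (Wᶜ \ U)) (hS : IsPreconnected S)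
    (hSW : S ⊆ Wᶜ) {a : ℂ} (ha : a ∈ S) (haU : a ∈ U) : S ⊆ U := by
  apply hS.subset_left_of_subset_union hU hU' _ _ ⟨a, ha, haU⟩
  · exact disjoint_sdiff_right
  · intro x hx
    by_cases h : x ∈ U
    · exact Or.inl h
    · exact Or.inr ⟨hSW hx, h⟩

lemma geom_point {c : ℝ → ℂ} {L : NNReal} (hL : LipschitzWith L c) {W : Set ℂ} (hW : IsCompact W)
    (hWc : W ⊆ Metric.closedBall 0 (1/4) ∪ c '' Icc 0 1) {U : ℕ → Set ℂ} (hUo : ∀ k, IsOpen (U k))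
    (hUo' : ∀ k, IsOpen (Wᶜ \ U k)) {M : ℝ} (hM : ∀ w, M < ‖w‖ → w ∈ U 0) {x0 y : ℝ} (hx0 : 1/4 < x0)
    (h0W : (⟨x0, y⟩ : ℂ) ∉ W) (h0U : ∀ k, (⟨x0, y⟩ : ℂ) ∉ U k)
    (hy : ∀ t, (c t).im = y → ∃ h', h' ≠ 0 ∧ HasDerivAt (fun t => (c t).im) h' t) :
    ∃ (n j r k m : ℕ) (e : ℂ), e.im = y ∧ CrossP c W U (TopologicalSpace.denseSeq ℂ n) j r k m e := by
  set S : Set ℝ := {x | x0 ≤ x ∧ (⟨x, y⟩ : ℂ) ∉ W ∧ ∀ k, (⟨x, y⟩ : ℂ) ∉ U k} with hS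
  have hSne : S.Nonempty := ⟨x0, le_rfl, h0W, h0U⟩
  have hSb : BddAbove S := by
    refine ⟨M, fun x hx => ?_⟩
    by_contra! h
    apply hx.2.2 0 (hM _ _)
    have := Complex.re_le_norm (⟨x, y⟩ : ℂ)
    exact h.trans_le this
  set xs := sSup S with hxs
  have hxs0 : x0 ≤ xs := le_csSup hSb ⟨le_rfl, h0W, h0U⟩
  set e : ℂ := ⟨xs, y⟩ with he
  have hinf : ∀ T : Set ℂ, IsPreconnected T → T ⊆ Wᶜ → ∀ a ∈ T, (∀ k, a ∉ U k) → ∀ b ∈ T, ∀ k, b ∉ U k := by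
    intro T hT hTW a ha haU b hb k hbU
    exact haU k (clopen_const (hUo k) (hUo' k) hT hTW hb hbU ha)
  have heW : e ∈ W := by
    by_contra hne
    obtain ⟨δ, hδ, hball⟩ := Metric.isOpen_iff.1 hW.isClosed.isOpen_compl e hne
    obtain ⟨x, hx, hlt⟩ := exists_lt_of_lt_csSup hSne (show xs - δ < sSup S by linarith)
    have hxle : x ≤ xs := le_csSup hSb hx
    have hd : ∀ x' : ℝ, dist (⟨x', y⟩ : ℂ) e = |x' - xs| := by
      intro x'
      rw [Complex.dist_eq, he]
      have : (⟨x', y⟩ : ℂ) - ⟨xs, y⟩ = ((x' - xs : ℝ) : ℂ) := by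
        apply Complex.ext <;> simp
      rw [this, Complex.norm_real, Real.norm_eq_abs]
    have hmem : (⟨x, y⟩ : ℂ) ∈ Metric.ball e δ := by
      rw [Metric.mem_ball, hd, abs_lt]; constructor <;> linarith
    have hmem2 : (⟨xs + δ/2, y⟩ : ℂ) ∈ Metric.ball e δ := by
      rw [Metric.mem_ball, hd, abs_lt]; constructor <;> linarith
    have := hinf _ (convex_ball e δ).isPreconnected hball _ hmem hx.2.2 _ hmem2
    have h3 : xs + δ/2 ∈ S := ⟨by linarith, hball hmem2, this⟩
    have := le_csSup hSb h3
    linarith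
  obtain ⟨C₀, hC₀, hP0, m, τ, hτ, hprod⟩ := cross_local hL (e := e) hy
  have hδ : 0 < xs - 1/4 := by linarith
  set C := max C₀ (1 / (xs - 1/4)) with hCdef
  have hC0C : C₀ ≤ C := le_max_left _ _
  have hC1 : 1 ≤ C := hC₀.trans hC0C
  have hCp : 0 < C := by linarith
  have hdisc : ∀ q : ℂ, ‖q‖ ≤ 1/4 → 1 ≤ C * ‖q - e‖ := by
    intro q hq
    have h1 : xs - 1/4 ≤ ‖q - e‖ := by
      have h2 : ‖e‖ - ‖q‖ ≤ ‖q - e‖ := by rw [norm_sub_rev]; exact norm_sub_norm_le _ _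
      have h3 : xs ≤ ‖e‖ := Complex.re_le_norm e
      linarith
    calc 1 = (1 / (xs - 1/4)) * (xs - 1/4) := by rw [one_div_mul_cancel hδ.ne']
      _ ≤ _ := by gcongr; exact le_max_right _ _
  have hP1 : ∀ q ∈ W, ‖q - e‖ ≤ C * |(q - e).im| ∨ 1 ≤ C * ‖q - e‖ := by
    intro q hq
    rcases hWc hq with h | ⟨t, ht, rfl⟩
    · right; apply hdisc; simpa using h
    · exact (hP0 t ht).imp (fun h => h.trans (by gcongr)) (fun h => h.trans (by gcongr))
  obtain ⟨j, hj⟩ := exists_nat_ge (8 * C)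
  have hjp : (0:ℝ) < j := by linarith
  have hj1 : 1 ≤ j := by exact_mod_cast hjp
  have hjC : 1 / (j:ℝ) ≤ 1 / (8 * C) := one_div_le_one_div_of_le (by positivity) hj
  have hCj : C * (2 * (1 / j)) ≤ 1/2 := by
    calc C * (2 * (1 / j)) ≤ C * (2 * (1 / (8 * C))) := by gcongr
      _ = 1/4 := by field_simp; norm_num
      _ ≤ _ := by norm_num
  have hj4 : 1 / (j:ℝ) ≤ 1 / (4 * C) := hjC.trans (one_div_le_one_div_of_le (by positivity) (by linarith))
  have hjpos : 0 < 1 / (j:ℝ) := by positivity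
  have hright : ∀ s : ℝ, 0 < s → s < 1 / j → ∀ q ∈ W, ‖q - e‖ ≤ j * ‖q - (e + s)‖ := by
    intro s hs hs' q hq
    have h1 : e + s - e = (s:ℂ) := by ring
    have := (cone_est (w := e + s) hC1 hCj hP1 (by rw [h1]; simp; positivity)
      (by rw [h1, Complex.norm_real, Real.norm_eq_abs, abs_of_pos hs]; linarith) q hq).2
    exact this.trans (by gcongr; linarith)
  -- left cone
  set Lc : Set ℂ := {w | |(e - w).im| < 1 / j * (e - w).re ∧ ‖e - w‖ < 1 / (2 * j)} with hLc
  have h2j : 1 / (2 * (j:ℝ)) = 1/2 * (1 / j) := by field_simp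
  have hLcW : Lc ⊆ Wᶜ := by
    intro w hw hwW
    have hre : (e - w).re ≤ ‖e - w‖ := Complex.re_le_norm _
    have hr0 : 0 < (e - w).re := by
      have := (abs_nonneg _).trans_lt hw.1
      exact (pos_iff_pos_of_mul_pos this).1 hjpos
    have h1 : |(w - e).im| ≤ 2 * (1 / j) * ‖w - e‖ := by
      rw [norm_sub_rev w e]
      have : |(w - e).im| = |(e - w).im| := by rw [← abs_neg]; simp
      rw [this]
      have : 1 / j * (e - w).re ≤ 1 / j * ‖e - w‖ := by gcongr
      have := mul_nonneg hjpos.le (norm_nonneg (e-w))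
      linarith [hw.1]
    have h2 := (cone_est hC1 hCj hP1 h1 (by rw [norm_sub_rev]; linarith [hw.2]) w hwW).1
    simp only [sub_self, norm_zero, mul_zero] at h2
    rw [norm_sub_rev] at h2
    linarith
  have hLcconv : Convex ℝ Lc := by
    have e1 : Lc = (fun w => e - w) ⁻¹' ({z : ℂ | |z.im| - 1 / j * z.re < 0} ∩ Metric.ball 0 (1/(2*j))) := by
      ext w; simp [hLc]
    rw [e1]
    have hconv : Convex ℝ ({z : ℂ | |z.im| - 1 / j * z.re < 0} ∩ Metric.ball 0 (1/(2*j))) := by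
      apply Convex.inter _ (convex_ball _ _)
      have hcf : ConvexOn ℝ univ fun z : ℂ => |z.im| - 1 / j * z.re := by
        refine ⟨convex_univ, fun x _ y _ a b ha hb hab => ?_⟩
        simp only [Complex.add_im, Complex.real_smul, Complex.mul_im, Complex.ofReal_re, Complex.ofReal_im, zero_mul, add_zero, Complex.add_re, Complex.mul_re, sub_zero, smul_eq_mul]
        have := abs_add_le (a * x.im) (b * y.im)
        rw [abs_mul, abs_mul, abs_of_nonneg ha, abs_of_nonneg hb] at this
        linarith
      have := hcf.convex_lt 0
      simpa using this
    intro x hx y hy a b ha hb hab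
    have := hconv hx hy ha hb hab
    have e2 : a • (e - x) + b • (e - y) = e - (a • x + b • y) := by
      rw [smul_sub, smul_sub]
      have : e = a • e + b • e := by rw [← add_smul, hab, one_smul]
      nth_rewrite 3 [this]; abel
    simp only [] at this
    rw [e2] at this
    exact this
  have hLcInf : ∀ w ∈ Lc, ∀ k, w ∉ U k := by
    obtain ⟨x, hx, hlt⟩ := exists_lt_of_lt_csSup hSne (show xs - 1/(2*j) < sSup S by
      have : 0 < 1 / (2 * (j:ℝ)) := by positivity
      linarith)
    have hxle : x ≤ xs := le_csSup hSb hx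
    have hxne : x ≠ xs := by rintro h; exact hx.2.1 (h ▸ heW)
    have hxlt : x < xs := lt_of_le_of_ne hxle hxne
    have hd : e - (⟨x, y⟩ : ℂ) = ((xs - x : ℝ) : ℂ) := by apply Complex.ext <;> simp [he]
    have hmem : (⟨x, y⟩ : ℂ) ∈ Lc := by
      constructor
      · rw [hd, Complex.ofReal_im, Complex.ofReal_re, abs_zero]; exact mul_pos hjpos (by linarith)
      · rw [hd, Complex.norm_real, Real.norm_eq_abs, abs_of_pos (by linarith)]; linarith
    exact hinf _ hLcconv.isPreconnected hLcW _ hmem hx.2.2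
  have hLcopen : IsOpen Lc := by
    apply IsOpen.and
    · exact isOpen_lt (by fun_prop) (by fun_prop)
    · exact isOpen_lt (by fun_prop) (by fun_prop)
  have hLcne : Lc.Nonempty := by
    refine ⟨e - ((1/(4*j) : ℝ) : ℂ), ?_, ?_⟩
    · have : e - (e - ((1/(4*j) : ℝ) : ℂ)) = ((1/(4*j) : ℝ) : ℂ) := by ring
      rw [this, Complex.ofReal_im, Complex.ofReal_re, abs_zero]; positivity
    · have : e - (e - ((1/(4*j) : ℝ) : ℂ)) = ((1/(4*j) : ℝ) : ℂ) := by ring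
      rw [this, Complex.norm_real, Real.norm_eq_abs, abs_of_pos (by positivity)]
      apply one_div_lt_one_div_of_lt <;> linarith
  obtain ⟨w₁, hw₁, n, rfl⟩ := (TopologicalSpace.denseRange_denseSeq ℂ).inter_open_nonempty _ hLcopen hLcne
  set w₁ := TopologicalSpace.denseSeq ℂ n
  have hne : e ≠ w₁ := by rintro h; exact hLcW hw₁ (h ▸ heW)
  have hnp : 0 < ‖e - w₁‖ := norm_pos_iff.2 (sub_ne_zero.2 hne)
  obtain ⟨r, hr⟩ := exists_nat_gt (1 / ‖e - w₁‖)
  have hrp : (0:ℝ) < r := lt_trans (by positivity) hr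
  -- right label
  have hk : ∃ k, ∀ s : ℝ, 0 < s → s < 1/j → e + s ∈ U k := by
    have himg : Convex ℝ ((fun s : ℝ => e + (s:ℂ)) '' Ioo 0 (1/(j:ℝ))) := by
      have := ((convex_Ioo (𝕜 := ℝ) 0 (1/(j:ℝ))).linear_image (Complex.ofRealCLM.toLinearMap)).translate e
      rw [image_image] at this
      exact this
    have hsub : ((fun s : ℝ => e + (s:ℂ)) '' Ioo 0 (1/(j:ℝ))) ⊆ Wᶜ := by
      rintro _ ⟨s, hs, rfl⟩ hmem
      have := hright s hs.1 hs.2 _ hmem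
      simp at this
      exact hs.1.ne' this
    have hs1 : 1/(2*(j:ℝ)) ∈ Ioo 0 (1/(j:ℝ)) := ⟨by positivity, by rw [h2j]; linarith⟩
    have : ∃ k, e + ((1/(2*(j:ℝ)) : ℝ) : ℂ) ∈ U k := by
      by_contra! hcon
      have h1 : e + ((1/(2*(j:ℝ)) : ℝ) : ℂ) = ⟨xs + 1/(2*(j:ℝ)), y⟩ := by
        apply Complex.ext <;> simp [he]
      have h2 : xs + 1/(2*(j:ℝ)) ∈ S := by
        refine ⟨by linarith [hs1.1], ?_, ?_⟩
        · rw [← h1]; exact hsub ⟨_, hs1, rfl⟩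
        · rw [← h1]; exact hcon
      have := le_csSup hSb h2
      linarith [hs1.1]
    obtain ⟨k, hk⟩ := this
    have := clopen_const (hUo k) (hUo' k) himg.isPreconnected hsub ⟨_, hs1, rfl⟩ hk
    exact ⟨k, fun s h1 h2 => this ⟨s, ⟨h1, h2⟩, rfl⟩⟩
  obtain ⟨k, hk⟩ := hk
  refine ⟨n, j, r, k, m, e, rfl, hj1, by exact_mod_cast hrp, heW, hw₁.2, ?_, hLcW hw₁, hLcInf _ hw₁, ?_, ?_, ?_, ?_⟩
  · rw [div_le_iff₀ hrp]
    rw [div_lt_iff₀ hnp] at hr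
    linarith
  · intro w hw q hq
    have hdw : w - e = -((e - w₁) * (1 - (w - w₁) / (e - w₁))) := by
      have := sub_ne_zero.2 hne
      field_simp; ring
    obtain ⟨h1, h2⟩ := drop_geom hjpos hw₁.1.le hw
    have h3 : ‖w - e‖ = ‖(e - w₁) * (1 - (w - w₁) / (e - w₁))‖ := by rw [hdw, norm_neg]
    have := (cone_est (w := w) hC1 hCj hP1 (by rw [h3, hdw, Complex.neg_im, abs_neg]; exact h1)
      (by rw [h3]; linarith [hw₁.2]) q hq).1
    exact this.trans (by gcongr; linarith)
  · intro s h1 h2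
    exact ⟨hk s h1 h2, hright s h1 h2⟩
  · exact ⟨τ, hτ, fun t ht => (hprod t ht).trans (by gcongr; linarith)⟩
  · intro q _ hq'
    exact (hdisc q hq').trans (by gcongr; linarith)

lemma geom_main {c : ℝ → ℂ} {L : NNReal} (hL : LipschitzWith L c) {W : Set ℂ} (hW : IsCompact W)
    (hWc : W ⊆ Metric.closedBall 0 (1/4) ∪ c '' Icc 0 1) {U : ℕ → Set ℂ} (hUo : ∀ k, IsOpen (U k))
    (hUo' : ∀ k, IsOpen (Wᶜ \ U k)) {M : ℝ} (hM : ∀ w, M < ‖w‖ → w ∈ U 0) {x0 : ℝ} (hx0 : 1/4 < x0)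
    (h0W : (x0 : ℂ) ∉ W) (h0U : ∀ k, (x0 : ℂ) ∉ U k) :
    ∃ (w₁ : ℂ) (j r k m : ℕ), volume (Complex.im '' {e | CrossP c W U w₁ j r k m e}) ≠ 0 := by
  obtain ⟨δ, hδ, hball⟩ := Metric.isOpen_iff.1 hW.isClosed.isOpen_compl _ h0W
  have hLi : LipschitzWith L (fun t => (c t).im) := by
    apply LipschitzWith.of_dist_le_mul
    intro x y
    have := hL.dist_le_mul x y
    rw [Complex.dist_eq] at this
    rw [Real.dist_eq, ← Complex.sub_im]
    exact (Complex.abs_im_le_norm _).trans this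
  have hsard := lip_sard hLi
  rw [ae_iff] at hsard
  by_contra! hcon
  have hU : volume (⋃ (n : ℕ) (j : ℕ) (r : ℕ) (k : ℕ) (m : ℕ), Complex.im '' {e | CrossP c W U (TopologicalSpace.denseSeq ℂ n) j r k m e}) = 0 := by
    simp only [measure_iUnion_null_iff]
    intro n j r k m
    exact hcon _ _ _ _ _
  have : Ioo (-δ) δ ⊆ {a | ¬∀ (t : ℝ), (c t).im = a → ∃ h', h' ≠ 0 ∧ HasDerivAt (fun t => (c t).im) h' t} ∪ (⋃ (n : ℕ) (j : ℕ) (r : ℕ) (k : ℕ) (m : ℕ), Complex.im '' {e | CrossP c W U (TopologicalSpace.denseSeq ℂ n) j r k m e}) := by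
    intro y hy
    by_cases hg : ∀ (t : ℝ), (c t).im = y → ∃ h', h' ≠ 0 ∧ HasDerivAt (fun t => (c t).im) h' t
    · right
      have hmem : (⟨x0, y⟩ : ℂ) ∈ Metric.ball (x0:ℂ) δ := by
        rw [Metric.mem_ball, Complex.dist_eq]
        have : (⟨x0, y⟩ : ℂ) - x0 = y * Complex.I := by apply Complex.ext <;> simp
        rw [this]; simpa [abs_lt] using hy
      obtain ⟨n, j, r, k, m, e, he, h⟩ := geom_point hL hW hWc hUo hUo' hM hx0 (hball hmem)
        (fun k hk => h0U k (clopen_const (hUo k) (hUo' k) (convex_ball _ _).isPreconnected hball hmem hk (Metric.mem_ball_self hδ))) hg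
      simp only [mem_iUnion]
      exact ⟨n, j, r, k, m, e, h, he⟩
    · left; exact hg
  have h0 := measure_mono_null this (measure_union_null hsard hU)
  rw [Real.volume_Ioo] at h0
  simp at h0
  linarith

end

noncomputable section
open Set MvPolynomial Topology MeasureTheory

open scoped ComplexOrder in
lemma state_pos {X : Type} [TopologicalSpace X] [CompactSpace X] (φ : C(X, ℂ) →L[ℂ] ℂ)
    (hn : ‖φ‖ ≤ 1) (h1 : φ 1 = 1) (f : C(X, ℂ)) (hf : 0 ≤ f) : 0 ≤ φ f := by
  have hfx : ∀ x, 0 ≤ (f x).re ∧ (f x).im = 0 := by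
    intro x
    have := (ContinuousMap.le_def.1 hf) x
    rw [Complex.le_def] at this
    exact ⟨this.1, this.2.symm⟩
  have hle : ∀ g, ‖φ g‖ ≤ ‖g‖ := fun g => (φ.le_opNorm g).trans (by nlinarith [norm_nonneg g])
  have hone : ∀ c : ℂ, φ (f + algebraMap ℂ C(X,ℂ) c) = φ f + c := by
    intro c; rw [map_add, Algebra.algebraMap_eq_smul_one, map_smul, h1]; simp
  have him : (φ f).im = 0 := by
    by_contra hne
    have key : ∀ t : ℝ, ((φ f).im + t)^2 ≤ ‖f‖^2 + t^2 := by
      intro t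
      have h2 : ‖f + algebraMap ℂ C(X,ℂ) (t * Complex.I)‖^2 ≤ ‖f‖^2 + t^2 := by
        have : ‖f + algebraMap ℂ C(X,ℂ) (t * Complex.I)‖ ≤ Real.sqrt (‖f‖^2 + t^2) := by
          rw [ContinuousMap.norm_le _ (Real.sqrt_nonneg _)]
          intro x
          apply Real.le_sqrt_of_sq_le
          have hfn := f.norm_coe_le_norm x
          have h3 : ‖(f + algebraMap ℂ C(X,ℂ) (t * Complex.I)) x‖^2 = (f x).re^2 + t^2 := by
            rw [← Complex.normSq_eq_norm_sq, Complex.normSq_apply]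
            simp [(hfx x).2]; ring
          rw [h3]
          have h4 : (f x).re ≤ ‖f x‖ := Complex.re_le_norm _
          have := (hfx x).1
          gcongr; linarith
        calc _ ≤ (Real.sqrt (‖f‖^2 + t^2))^2 := by gcongr
          _ = _ := Real.sq_sqrt (by positivity)
      have h5 := hle (f + algebraMap ℂ C(X,ℂ) (t * Complex.I))
      rw [hone] at h5
      have h6 : |(φ f).im + t| ≤ ‖φ f + t * Complex.I‖ := by
        have := Complex.abs_im_le_norm (φ f + t * Complex.I)
        simpa using this
      calc ((φ f).im + t)^2 = |(φ f).im + t|^2 := (sq_abs _).symm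
        _ ≤ ‖f + algebraMap ℂ C(X,ℂ) (t * Complex.I)‖^2 := by gcongr; linarith
        _ ≤ _ := h2
    have := key ((‖f‖^2+1) / (φ f).im)
    have h7 : (φ f).im * ((‖f‖^2+1) / (φ f).im) = ‖f‖^2+1 := by field_simp
    nlinarith [sq_nonneg ((φ f).im), sq_nonneg ‖f‖]
  have hre : 0 ≤ (φ f).re := by
    have h2 : ‖f + algebraMap ℂ C(X,ℂ) (-(‖f‖ : ℝ))‖ ≤ ‖f‖ := by
      rw [ContinuousMap.norm_le _ (norm_nonneg _)]
      intro x
      have : (f + algebraMap ℂ C(X,ℂ) (-(‖f‖ : ℝ))) x = (((f x).re - ‖f‖ : ℝ) : ℂ) := by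
        apply Complex.ext <;> simp [(hfx x).2, sub_eq_add_neg]
      rw [this, Complex.norm_real, Real.norm_eq_abs, abs_le]
      have := (Complex.re_le_norm (f x)).trans (f.norm_coe_le_norm x)
      constructor <;> linarith [(hfx x).1, norm_nonneg f]
    have h3 := (hle _).trans h2
    rw [hone] at h3
    have := Complex.abs_re_le_norm (φ f + -((‖f‖ : ℝ):ℂ))
    have h4 : |(φ f).re - ‖f‖| ≤ ‖f‖ := by
      refine le_trans ?_ h3; simpa [sub_eq_add_neg] using this
    rw [abs_le] at h4
    linarith
  rw [Complex.le_def]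
  exact ⟨hre, him.symm⟩

open scoped ComplexOrder InnerProductSpace in
lemma GNS_exists {X : Type} [TopologicalSpace X] [CompactSpace X] (φ : C(X, ℂ) →L[ℂ] ℂ)
    (hn : ‖φ‖ ≤ 1) (h1 : φ 1 = 1) : ∃ (E : Type) (_ : NormedAddCommGroup E) (_ : InnerProductSpace ℂ E)
    (_ : CompleteSpace E) (π : C(X, ℂ) →ₐ[ℂ] (E →L[ℂ] E)) (ξ : E), (∀ a, ‖π a‖ ≤ ‖a‖) ∧ ‖ξ‖ = 1 ∧
    ∀ a, φ a = ⟪ξ, π a ξ⟫_ℂ := by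
  let f : C(X, ℂ) →ₚ[ℂ] ℂ := PositiveLinearMap.mk₀ φ.toLinearMap (fun g hg => state_pos φ hn h1 g hg)
  have hf : ∀ g, f g = φ g := fun g => rfl
  have hfin : ∀ a, φ a = ⟪((f.toPreGNS 1 : f.PreGNS) : f.GNS), f.gnsStarAlgHom a ((f.toPreGNS 1 : f.PreGNS) : f.GNS)⟫_ℂ := by
    intro a
    have e1 : f.gnsStarAlgHom a ((f.toPreGNS 1 : f.PreGNS) : f.GNS) = ((f.leftMulMapPreGNS a (f.toPreGNS 1) : f.PreGNS) : f.GNS) :=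
      PositiveLinearMap.gnsNonUnitalStarAlgHom_apply_coe f
    rw [e1, UniformSpace.Completion.inner_coe, PositiveLinearMap.preGNS_inner_def]
    simp [hf]
  refine ⟨f.GNS, inferInstance, inferInstance, inferInstance, f.gnsStarAlgHom.toAlgHom, ((f.toPreGNS 1 : f.PreGNS) : f.GNS),
    fun a => NonUnitalStarAlgHom.norm_apply_le f.gnsStarAlgHom a, ?_, hfin⟩
  have := hfin 1
  rw [h1, map_one f.gnsStarAlgHom, one_apply_eq_self, inner_self_eq_norm_sq_to_K] at this
  have h2 : ‖((f.toPreGNS 1 : f.PreGNS) : f.GNS)‖^2 = 1 := by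
    apply Complex.ofReal_injective; push_cast; exact this.symm
  have := norm_nonneg ((f.toPreGNS 1 : f.PreGNS) : f.GNS)
  nlinarith

lemma hb_ext {M E : Type*} [AddCommGroup M] [Module ℂ M] [NormedAddCommGroup E] [NormedSpace ℂ E]
    (T : M →ₗ[ℂ] E) (φ₀ : M →ₗ[ℂ] ℂ) (h : ∀ m, ‖φ₀ m‖ ≤ ‖T m‖) :
    ∃ φ : E →L[ℂ] ℂ, ‖φ‖ ≤ 1 ∧ ∀ m, φ (T m) = φ₀ m := by
  let φ₁ : LinearMap.range T →ₗ[ℂ] ℂ := ((LinearMap.ker T).liftQ φ₀ (by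
    intro m hm
    have := h m
    rw [LinearMap.mem_ker.1 hm, norm_zero] at this
    exact LinearMap.mem_ker.2 (norm_le_zero_iff.1 this))) ∘ₗ (LinearMap.quotKerEquivRange T).symm.toLinearMap
  have hφ₁ : ∀ m, φ₁ ⟨T m, LinearMap.mem_range_self T m⟩ = φ₀ m := by
    intro m
    have : (LinearMap.quotKerEquivRange T).symm ⟨T m, LinearMap.mem_range_self T m⟩ = (LinearMap.ker T).mkQ m := by
      rw [LinearEquiv.symm_apply_eq]; rfl
    simp only [φ₁, LinearMap.comp_apply, LinearEquiv.coe_coe]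
    rw [this]; simp
  let φ₂ : LinearMap.range T →L[ℂ] ℂ := φ₁.mkContinuous 1 (by
    rintro ⟨_, m, rfl⟩
    rw [hφ₁, one_mul]
    exact h m)
  obtain ⟨g, hg, hgn⟩ := exists_extension_norm_eq (LinearMap.range T) φ₂
  refine ⟨g, ?_, ?_⟩
  · rw [hgn]; exact LinearMap.mkContinuous_norm_le _ zero_le_one _
  · intro m
    have := hg ⟨T m, LinearMap.mem_range_self T m⟩
    rw [this]
    exact hφ₁ m

end

noncomputable section
open Set MvPolynomial Topology MeasureTheory

section rep
variable {X : Type} [TopologicalSpace X] [CompactSpace X] {E : Type} [NormedAddCommGroup E]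
  [InnerProductSpace ℂ E] [CompleteSpace E]

/-- resolvent function -/
def resC (p : C(X, ℂ)) (w : ℂ) : C(X, ℂ) := Ring.inverse (p - algebraMap ℂ _ w)

lemma resC_unit {p : C(X, ℂ)} {w : ℂ} (hw : w ∉ range p) : IsUnit (p - algebraMap ℂ C(X,ℂ) w) := by
  rw [ContinuousMap.isUnit_iff_forall_ne_zero]
  intro x hx
  apply hw
  refine ⟨x, ?_⟩
  simpa [sub_eq_zero] using hx

lemma resC_mul {p : C(X, ℂ)} {w : ℂ} (hw : w ∉ range p) : (p - algebraMap ℂ C(X,ℂ) w) * resC p w = 1 :=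
  Ring.mul_inverse_cancel _ (resC_unit hw)

lemma resC_apply {p : C(X, ℂ)} {w : ℂ} (hw : w ∉ range p) (x : X) : resC p w x = (p x - w)⁻¹ := by
  have := congrArg (fun g : C(X,ℂ) => g x) (resC_mul hw)
  simp only [ContinuousMap.mul_apply, ContinuousMap.sub_apply, ContinuousMap.one_apply, _root_.algebraMap_apply, smul_eq_mul, ContinuousMap.one_apply, mul_one] at this
  exact eq_inv_of_mul_eq_one_right this

/-- invariance -/
def InvH (π : C(X, ℂ) →ₐ[ℂ] (E →L[ℂ] E)) (H : Submodule ℂ E) (f : C(X, ℂ)) : Prop := ∀ v ∈ H, π f v ∈ H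

lemma InvH.mul {π : C(X, ℂ) →ₐ[ℂ] (E →L[ℂ] E)} {H : Submodule ℂ E} {f g : C(X, ℂ)} (hf : InvH π H f) (hg : InvH π H g) :
    InvH π H (f * g) := by
  intro v hv; rw [map_mul]; exact hf _ (hg _ hv)

lemma InvH.add {π : C(X, ℂ) →ₐ[ℂ] (E →L[ℂ] E)} {H : Submodule ℂ E} {f g : C(X, ℂ)} (hf : InvH π H f) (hg : InvH π H g) :
    InvH π H (f + g) := by
  intro v hv; rw [map_add]; exact H.add_mem (hf _ hv) (hg _ hv)

lemma InvH.alg (π : C(X, ℂ) →ₐ[ℂ] (E →L[ℂ] E)) (H : Submodule ℂ E) (c : ℂ) :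
    InvH π H (algebraMap ℂ _ c) := by
  intro v hv
  rw [AlgHom.commutes, Algebra.algebraMap_eq_smul_one]; exact H.smul_mem _ hv

lemma InvH.sub {π : C(X, ℂ) →ₐ[ℂ] (E →L[ℂ] E)} {H : Submodule ℂ E} {f g : C(X, ℂ)} (hf : InvH π H f) (hg : InvH π H g) :
    InvH π H (f - g) := by
  intro v hv; rw [map_sub]; exact H.sub_mem (hf _ hv) (hg _ hv)

lemma InvH.one (π : C(X, ℂ) →ₐ[ℂ] (E →L[ℂ] E)) (H : Submodule ℂ E) : InvH π H 1 := by
  intro v hv; simpa using hv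

lemma InvH.pow {π : C(X, ℂ) →ₐ[ℂ] (E →L[ℂ] E)} {H : Submodule ℂ E} {f : C(X, ℂ)} (hf : InvH π H f) (n : ℕ) :
    InvH π H (f ^ n) := by
  induction n with
  | zero => rw [pow_zero]; exact InvH.one π H
  | succ n ih => rw [pow_succ]; exact ih.mul hf

lemma InvH.aeval {π : C(X, ℂ) →ₐ[ℂ] (E →L[ℂ] E)} {H : Submodule ℂ E} {f : C(X, ℂ)} (hf : InvH π H f) (g : Polynomial ℂ) :
    InvH π H (Polynomial.aeval f g) := by
  induction g using Polynomial.induction_on' with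
  | add p q hp hq => rw [map_add]; exact hp.add hq
  | monomial n a => rw [Polynomial.aeval_monomial]; exact (InvH.alg π H a).mul (hf.pow n)

def NN (π : C(X, ℂ) →ₐ[ℂ] (E →L[ℂ] E)) (H : Submodule ℂ E) (p : C(X, ℂ)) (w : ℂ) : Submodule ℂ E :=
  H.comap (π (resC p w)).toLinearMap

lemma mem_NN {π : C(X, ℂ) →ₐ[ℂ] (E →L[ℂ] E)} {H : Submodule ℂ E} {p : C(X, ℂ)} {w : ℂ} {v : E} :
    v ∈ NN π H p w ↔ π (resC p w) v ∈ H := Iff.rfl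

lemma NN_closed {π : C(X, ℂ) →ₐ[ℂ] (E →L[ℂ] E)} {H : Submodule ℂ E} (hH : IsClosed (H : Set E)) (p : C(X, ℂ)) (w : ℂ) :
    IsClosed (NN π H p w : Set E) := hH.preimage (π (resC p w)).continuous

lemma pi_mul_apply (π : C(X, ℂ) →ₐ[ℂ] (E →L[ℂ] E)) (f g : C(X,ℂ)) (v : E) : π (f * g) v = π f (π g v) := by
  rw [map_mul]; rfl

lemma NN_of {π : C(X, ℂ) →ₐ[ℂ] (E →L[ℂ] E)} {H : Submodule ℂ E} {p : C(X, ℂ)} {w : ℂ} (hw : w ∉ range p) {u : E} (hu : u ∈ H) :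
    π (p - algebraMap ℂ _ w) u ∈ NN π H p w := by
  rw [mem_NN, ← pi_mul_apply, mul_comm, resC_mul hw]; simpa using hu

lemma NN_eq {π : C(X, ℂ) →ₐ[ℂ] (E →L[ℂ] E)} {H : Submodule ℂ E} {p : C(X, ℂ)} {w : ℂ} (hw : w ∉ range p) (v : E) :
    v = π (p - algebraMap ℂ _ w) (π (resC p w) v) := by
  rw [← pi_mul_apply, resC_mul hw]; simp

lemma NN_le {π : C(X, ℂ) →ₐ[ℂ] (E →L[ℂ] E)} {H : Submodule ℂ E} {p : C(X, ℂ)} {w : ℂ} (hw : w ∉ range p) (hp : InvH π H p) :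
    NN π H p w ≤ H := by
  intro v hv
  rw [NN_eq (H := H) hw v (π := π)]
  exact (hp.sub (InvH.alg π H w)) _ hv

lemma NN_inv {π : C(X, ℂ) →ₐ[ℂ] (E →L[ℂ] E)} {H : Submodule ℂ E} {p f : C(X, ℂ)} {w : ℂ} (hf : InvH π H f) {v : E}
    (hv : v ∈ NN π H p w) : π f v ∈ NN π H p w := by
  rw [mem_NN, ← pi_mul_apply, mul_comm, pi_mul_apply]
  exact hf _ hv

def VV (π : C(X, ℂ) →ₐ[ℂ] (E →L[ℂ] E)) (H : Submodule ℂ E) (p : C(X, ℂ)) (w : ℂ) : Submodule ℂ E :=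
  H ⊓ (NN π H p w)ᗮ

/-- projection to the complement of NN -/
def QQ (π : C(X, ℂ) →ₐ[ℂ] (E →L[ℂ] E)) (H : Submodule ℂ E) (p : C(X, ℂ)) (w : ℂ) : E →L[ℂ] E :=
  (NN π H p w)ᗮ.starProjection

lemma QQ_mem (π : C(X, ℂ) →ₐ[ℂ] (E →L[ℂ] E)) (H : Submodule ℂ E) (p : C(X, ℂ)) (w : ℂ) (v : E) :
    QQ π H p w v ∈ (NN π H p w)ᗮ := Submodule.starProjection_apply_mem _ _

lemma QQ_sub {π : C(X, ℂ) →ₐ[ℂ] (E →L[ℂ] E)} {H : Submodule ℂ E} (hH : IsClosed (H : Set E)) (p : C(X, ℂ)) (w : ℂ) (v : E) :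
    v - QQ π H p w v ∈ NN π H p w := by
  have h0 := Submodule.sub_starProjection_mem_orthogonal (K := (NN π H p w)ᗮ) v
  have hcl : IsClosed (NN π H p w : Set E) := NN_closed hH p w
  have : CompleteSpace (NN π H p w) := hcl.completeSpace_coe
  rwa [Submodule.orthogonal_orthogonal] at h0

lemma QQ_zero {π : C(X, ℂ) →ₐ[ℂ] (E →L[ℂ] E)} {H : Submodule ℂ E} (p : C(X, ℂ)) (w : ℂ) {v : E} (hv : v ∈ NN π H p w) :
    QQ π H p w v = 0 := by
  unfold QQ
  rw [Submodule.starProjection_apply_eq_zero_iff]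
  exact Submodule.le_orthogonal_orthogonal _ hv

lemma QQ_zero_iff {π : C(X, ℂ) →ₐ[ℂ] (E →L[ℂ] E)} {H : Submodule ℂ E} (hH : IsClosed (H : Set E)) (p : C(X, ℂ)) (w : ℂ) {v : E} :
    QQ π H p w v = 0 ↔ v ∈ NN π H p w := by
  refine ⟨fun h => ?_, QQ_zero p w⟩
  have := QQ_sub (π := π) hH p w v
  rwa [h, sub_zero] at this

lemma QQ_VV {π : C(X, ℂ) →ₐ[ℂ] (E →L[ℂ] E)} {H : Submodule ℂ E} (hH : IsClosed (H : Set E)) {p : C(X, ℂ)} {w : ℂ}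
    (hw : w ∉ range p) (hp : InvH π H p) {v : E} (hv : v ∈ H) : QQ π H p w v ∈ VV π H p w := by
  refine ⟨?_, QQ_mem _ _ _ _ _⟩
  have := NN_le hw hp (QQ_sub (π := π) hH p w v)
  have h2 := H.sub_mem hv this
  simpa using h2

lemma QQ_id {π : C(X, ℂ) →ₐ[ℂ] (E →L[ℂ] E)} {H : Submodule ℂ E} {p : C(X, ℂ)} {w : ℂ}
    {v : E} (hv : v ∈ VV π H p w) : QQ π H p w v = v :=
  Submodule.starProjection_eq_self_iff.2 hv.2

lemma resC_norm {p : C(X, ℂ)} {w : ℂ} {δ : ℝ} (hδ : 0 < δ) (h : ∀ x, δ ≤ ‖p x - w‖) : w ∉ range p ∧ ‖resC p w‖ ≤ δ⁻¹ := by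
  have hw : w ∉ range p := by
    rintro ⟨x, hx⟩
    have := h x
    rw [hx] at this; simp at this; linarith
  refine ⟨hw, ?_⟩
  rw [ContinuousMap.norm_le _ (by positivity)]
  intro x
  rw [resC_apply hw, norm_inv]
  exact inv_anti₀ hδ (h x)

open scoped InnerProductSpace in
lemma VV_semicont {π : C(X, ℂ) →ₐ[ℂ] (E →L[ℂ] E)} (hπ : ∀ a, ‖π a‖ ≤ ‖a‖) {H : Submodule ℂ E} (hH : IsClosed (H : Set E)) {p : C(X, ℂ)}
    (hp : InvH π H p) {w w' : ℂ} {δ : ℝ} (h : ∀ x, δ ≤ ‖p x - w‖) (hw' : ‖w' - w‖ < δ) :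
    w' ∉ range p ∧ Module.rank ℂ (VV π H p w') ≤ Module.rank ℂ (VV π H p w) := by
  have hδ : 0 < δ := (norm_nonneg _).trans_lt hw'
  obtain ⟨hw, hn⟩ := resC_norm hδ h
  have hw'r : w' ∉ range p := by
    rintro ⟨x, rfl⟩
    exact absurd (h x) (not_le.2 hw')
  refine ⟨hw'r, ?_⟩
  let T : VV π H p w' →ₗ[ℂ] VV π H p w :=
    { toFun := fun v => ⟨QQ π H p w v, QQ_VV hH hw hp v.2.1⟩
      map_add' := by intro a b; ext; simp
      map_smul' := by intro a b; ext; simp }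
  apply LinearMap.rank_le_of_injective T
  rw [← LinearMap.ker_eq_bot, LinearMap.ker_eq_bot']
  intro v hv
  have h1 : QQ π H p w v = 0 := congrArg Subtype.val hv
  rw [QQ_zero_iff hH] at h1
  set u := π (resC p w) v with hu
  have huH : u ∈ H := h1
  have hvu : (v : E) = π (p - algebraMap ℂ _ w) u := NN_eq (H := H) hw _
  have h2 : ⟪(v : E), π (p - algebraMap ℂ _ w') u⟫_ℂ = 0 := by
    rw [← inner_conj_symm, v.2.2 _ (NN_of hw'r huH)]; simp
  have h3 : π (p - algebraMap ℂ _ w') u = v - (w' - w) • u := by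
    rw [hvu, map_sub, map_sub, AlgHom.commutes, AlgHom.commutes, Algebra.algebraMap_eq_smul_one, Algebra.algebraMap_eq_smul_one]
    simp only [ContinuousLinearMap.sub_apply, ContinuousLinearMap.smul_apply, one_apply_eq_self, sub_smul]
    abel
  rw [h3, inner_sub_right, sub_eq_zero, inner_self_eq_norm_sq_to_K, inner_smul_right] at h2
  have h4 : ‖(v:E)‖^2 ≤ ‖w' - w‖ * (‖(v:E)‖ * ‖u‖) := by
    have h5 := congrArg norm h2
    rw [norm_mul, norm_pow] at h5
    simp only [Complex.coe_algebraMap, Complex.norm_real, norm_norm] at h5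
    have h6 := norm_inner_le_norm (𝕜 := ℂ) (v:E) u
    have h7 : ‖(v:E)‖^2 = ‖w' - w‖ * ‖⟪(v:E), u⟫_ℂ‖ := by simpa using h5
    rw [h7]; gcongr
  have h8 : ‖u‖ ≤ δ⁻¹ * ‖(v:E)‖ := ((π (resC p w)).le_opNorm _).trans (by gcongr; exact (hπ _).trans hn)
  by_contra hne
  have hvp : 0 < ‖(v:E)‖ := by
    rw [norm_pos_iff]; intro h0; exact hne (Subtype.ext h0)
  have h9 : ‖w' - w‖ * (‖(v:E)‖ * ‖u‖) ≤ ‖w' - w‖ * (‖(v:E)‖ * (δ⁻¹ * ‖(v:E)‖)) := by gcongr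
  have h10 : ‖w' - w‖ * (‖(v:E)‖ * (δ⁻¹ * ‖(v:E)‖)) = (‖w' - w‖ / δ) * ‖(v:E)‖^2 := by ring
  have h11 : ‖w' - w‖ / δ < 1 := (div_lt_one hδ).2 hw'
  have h12 : 0 < ‖(v:E)‖^2 := by positivity
  nlinarith

/-- label sets -/
def UU (π : C(X, ℂ) →ₐ[ℂ] (E →L[ℂ] E)) (H : Submodule ℂ E) (p : C(X, ℂ)) (k : ℕ) : Set ℂ :=
  {w | w ∉ range p ∧ Module.rank ℂ (VV π H p w) ≤ k}

lemma dist_range {p : C(X, ℂ)} {w : ℂ} (hw : w ∉ range p) : ∃ δ > 0, ∀ x, δ ≤ ‖p x - w‖ := by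
  have : IsClosed (range p) := (isCompact_range p.continuous).isClosed
  obtain ⟨δ, hδ, hb⟩ := Metric.isOpen_iff.1 this.isOpen_compl w hw
  refine ⟨δ, hδ, fun x => ?_⟩
  by_contra! h
  exact hb (show p x ∈ Metric.ball w δ by rwa [Metric.mem_ball, Complex.dist_eq]) ⟨x, rfl⟩

lemma UU_open {π : C(X, ℂ) →ₐ[ℂ] (E →L[ℂ] E)} (hπ : ∀ a, ‖π a‖ ≤ ‖a‖) {H : Submodule ℂ E} (hH : IsClosed (H : Set E)) {p : C(X, ℂ)}
    (hp : InvH π H p) (k : ℕ) : IsOpen (UU π H p k) := by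
  rw [Metric.isOpen_iff]
  rintro w ⟨hw, hk⟩
  obtain ⟨δ, hδ, h⟩ := dist_range hw
  refine ⟨δ, hδ, fun w' hw' => ?_⟩
  rw [Metric.mem_ball, Complex.dist_eq] at hw'
  obtain ⟨h1, h2⟩ := VV_semicont hπ hH hp h hw'
  exact ⟨h1, h2.trans hk⟩

lemma UU_open' {π : C(X, ℂ) →ₐ[ℂ] (E →L[ℂ] E)} (hπ : ∀ a, ‖π a‖ ≤ ‖a‖) {H : Submodule ℂ E} (hH : IsClosed (H : Set E)) {p : C(X, ℂ)}
    (hp : InvH π H p) (k : ℕ) : IsOpen ((range p)ᶜ \ UU π H p k) := by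
  rw [Metric.isOpen_iff]
  rintro w ⟨hw, hk⟩
  obtain ⟨δ, hδ, h⟩ := dist_range hw
  refine ⟨δ/2, by linarith, fun w' hw' => ?_⟩
  rw [Metric.mem_ball, Complex.dist_eq] at hw'
  have h' : ∀ x, δ/2 ≤ ‖p x - w'‖ := by
    intro x
    have h1 := h x
    have h2 : ‖p x - w‖ ≤ ‖p x - w'‖ + ‖w' - w‖ := by
      have := norm_add_le (p x - w') (w' - w); simpa using this
    linarith
  refine ⟨(resC_norm (by linarith) h').1, fun hmem => hk ⟨hw, ?_⟩⟩
  rw [norm_sub_rev] at hw'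
  exact (VV_semicont hπ hH hp h' hw').2.trans hmem.2

open scoped InnerProductSpace in
lemma UU_zero {π : C(X, ℂ) →ₐ[ℂ] (E →L[ℂ] E)} (hπ : ∀ a, ‖π a‖ ≤ ‖a‖) {H : Submodule ℂ E} {p : C(X, ℂ)}
    {w : ℂ} (hw : ‖p‖ < ‖w‖) : w ∈ UU π H p 0 := by
  have hwr : w ∉ range p := by
    rintro ⟨x, rfl⟩
    exact absurd (p.norm_coe_le_norm x) (not_le.2 hw)
  refine ⟨hwr, ?_⟩
  have : VV π H p w = ⊥ := by
    rw [Submodule.eq_bot_iff]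
    intro v hv
    have h1 := hv.2 _ (NN_of hwr hv.1)
    rw [← inner_conj_symm, map_eq_zero, map_sub, AlgHom.commutes, Algebra.algebraMap_eq_smul_one, ContinuousLinearMap.sub_apply, inner_sub_right,
      ContinuousLinearMap.smul_apply, inner_smul_right, one_apply_eq_self, inner_self_eq_norm_sq_to_K, sub_eq_zero] at h1
    have h2 := congrArg norm h1
    rw [norm_mul, norm_pow] at h2
    have h3 : ‖⟪v, π p v⟫_ℂ‖ = ‖w‖ * ‖v‖^2 := by simpa using h2
    have h4 := norm_inner_le_norm (𝕜 := ℂ) v (π p v)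
    have h5 : ‖π p v‖ ≤ ‖p‖ * ‖v‖ := ((π p).le_opNorm v).trans (by gcongr; exact hπ p)
    by_contra hne
    have h6 : 0 < ‖v‖ := norm_pos_iff.2 hne
    have h7 : ‖v‖ * ‖π p v‖ ≤ ‖v‖ * (‖p‖ * ‖v‖) := by gcongr
    have h8 : 0 < ‖v‖^2 := by positivity
    nlinarith
  rw [this]; simp

lemma charpoly_fin {π : C(X, ℂ) →ₐ[ℂ] (E →L[ℂ] E)} (hπ : ∀ a, ‖π a‖ ≤ ‖a‖) {H : Submodule ℂ E} (hH : IsClosed (H : Set E)) {p f : C(X, ℂ)}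
    (hp : InvH π H p) (hf : InvH π H f) {w : ℂ} {k : ℕ} (hw : w ∈ UU π H p k) :
    ∃ R : Polynomial ℂ, R.Monic ∧ R.natDegree = k ∧ (∀ y : ℂ, ‖y‖ ≤ ‖f‖ → ‖R.eval y‖ ≤ (2 * ‖f‖)^k) ∧
      ∀ v ∈ H, π (Polynomial.aeval f R) v ∈ NN π H p w := by
  obtain ⟨hwr, hk⟩ := hw
  set V := VV π H p w with hV
  haveI : Module.Finite ℂ V := Module.rank_lt_aleph0_iff.1 (hk.trans_lt (Cardinal.natCast_lt_aleph0))
  have hn : Module.finrank ℂ V ≤ k := Module.finrank_le_of_rank_le hk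
  let A : V →ₗ[ℂ] V :=
    { toFun := fun v => ⟨QQ π H p w (π f v), QQ_VV hH hwr hp (hf _ v.2.1)⟩
      map_add' := by intro a b; ext; simp
      map_smul' := by intro a b; ext; simp }
  have hAQ : ∀ y ∈ H, ∀ hy : QQ π H p w y ∈ V, QQ π H p w (π f y) = A ⟨QQ π H p w y, hy⟩ := by
    intro y hy hyV
    change _ = QQ π H p w (π f (QQ π H p w y))
    rw [← sub_eq_zero, ← map_sub, ← map_sub]
    exact QQ_zero p w (NN_inv hf (QQ_sub hH p w y))
  have key : ∀ g : Polynomial ℂ, ∀ v : V, QQ π H p w (π (Polynomial.aeval f g) v) = (Polynomial.aeval A g v : V) := by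
    intro g
    induction g using Polynomial.induction_on with
    | C a =>
      intro v
      rw [Polynomial.aeval_C, Polynomial.aeval_C, AlgHom.commutes, Algebra.algebraMap_eq_smul_one, Algebra.algebraMap_eq_smul_one]
      simp only [ContinuousLinearMap.smul_apply, one_apply_eq_self, map_smul, QQ_id v.2]
      simp
    | add p q hp hq =>
      intro v
      simp only [map_add, ContinuousLinearMap.add_apply, hp v, hq v, LinearMap.add_apply, Submodule.coe_add]
    | monomial n a ih =>
      intro v
      have e1 : Polynomial.C a * Polynomial.X ^ (n+1) = Polynomial.X * (Polynomial.C a * Polynomial.X ^ n : Polynomial ℂ) := by ring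
      rw [e1, map_mul (Polynomial.aeval f), map_mul (Polynomial.aeval A), Polynomial.aeval_X, Polynomial.aeval_X, pi_mul_apply]
      have hyH : π (Polynomial.aeval f (Polynomial.C a * Polynomial.X ^ n)) v ∈ H := (hf.aeval _) _ v.2.1
      rw [hAQ _ hyH (QQ_VV hH hwr hp hyH)]
      congr 1
      change _ = A _
      congr 1
      ext
      exact ih v
  set χ := A.charpoly with hχ
  have hχm : χ.Monic := A.charpoly_monic
  have hχn : χ.natDegree = Module.finrank ℂ V := A.charpoly_natDegree
  have hroot : ∀ μ ∈ χ.roots, ‖μ‖ ≤ ‖f‖ := by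
    intro μ hμ
    have : Module.End.HasEigenvalue A μ := by
      rw [Module.End.hasEigenvalue_iff_isRoot_charpoly]
      exact Polynomial.isRoot_of_mem_roots hμ
    obtain ⟨v, hv⟩ := this.exists_hasEigenvector
    have h1 : QQ π H p w (π f v) = μ • (v:E) := congrArg Subtype.val hv.apply_eq_smul
    have h2 : ‖QQ π H p w (π f v)‖ ≤ ‖f‖ * ‖(v:E)‖ := by
      calc _ ≤ ‖π f v‖ := Submodule.norm_starProjection_apply_le _ _
        _ ≤ _ := ((π f).le_opNorm _).trans (by gcongr; exact hπ f)
    rw [h1, norm_smul] at h2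
    have h3 : 0 < ‖(v:E)‖ := by
      rw [norm_pos_iff]; intro h0; exact hv.2 (Subtype.ext h0)
    exact le_of_mul_le_mul_right h2 h3
  have hsplit : χ = (χ.roots.map (fun a => Polynomial.X - Polynomial.C a)).prod :=
    (IsAlgClosed.splits χ).eq_prod_roots_of_monic hχm
  have hcard : χ.roots.card = Module.finrank ℂ V := by
    rw [← hχn]; exact ((IsAlgClosed.splits χ).natDegree_eq_card_roots).symm
  refine ⟨χ * Polynomial.X ^ (k - Module.finrank ℂ V), hχm.mul (Polynomial.monic_X_pow _), ?_, ?_, ?_⟩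
  · rw [hχm.natDegree_mul (Polynomial.monic_X_pow _), Polynomial.natDegree_X_pow, hχn]; omega
  · intro y hy
    rw [Polynomial.eval_mul, Polynomial.eval_pow, Polynomial.eval_X, norm_mul, norm_pow]
    have h1 : ‖χ.eval y‖ ≤ (2 * ‖f‖) ^ (Module.finrank ℂ V) := by
      rw [hsplit, Polynomial.eval_multiset_prod, Multiset.map_map, ← hcard]
      have : ∀ s : Multiset ℂ, (∀ μ ∈ s, ‖μ‖ ≤ ‖f‖) → ‖(s.map (Polynomial.eval y ∘ fun a => Polynomial.X - Polynomial.C a)).prod‖ ≤ (2 * ‖f‖) ^ s.card := by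
        intro s
        induction s using Multiset.induction_on with
        | empty => simp
        | cons a s ih =>
          intro hs
          rw [Multiset.map_cons, Multiset.prod_cons, Multiset.card_cons, norm_mul, pow_succ']
          have h2 := ih (fun μ hμ => hs μ (Multiset.mem_cons_of_mem hμ))
          have h3 := hs a (Multiset.mem_cons_self a s)
          have h4 : ‖(Polynomial.eval y ∘ fun a => Polynomial.X - Polynomial.C a) a‖ ≤ 2 * ‖f‖ := by
            simp only [Function.comp_apply, Polynomial.eval_sub, Polynomial.eval_X, Polynomial.eval_C]
            exact (norm_sub_le _ _).trans (by linarith)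
          gcongr
      exact this _ hroot
    calc _ ≤ (2 * ‖f‖) ^ (Module.finrank ℂ V) * (2 * ‖f‖)^(k - Module.finrank ℂ V) := by
          gcongr; linarith [norm_nonneg f]
      _ = _ := by rw [← pow_add]; congr 1; omega
  · intro v hv
    rw [map_mul, mul_comm, pi_mul_apply]
    apply NN_inv (hf.aeval _)
    have h1 := QQ_sub (π := π) hH p w v
    have h2 := NN_inv (p := p) (w := w) (hf.aeval χ) h1
    have hQV := QQ_VV hH hwr hp hv
    have h3 : π (Polynomial.aeval f χ) (QQ π H p w v) ∈ NN π H p w := by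
      rw [← QQ_zero_iff hH]
      have := key χ ⟨_, hQV⟩
      rw [this, LinearMap.aeval_self_charpoly]; simp
    have := (NN π H p w).add_mem h2 h3
    rw [← map_add] at this
    simpa using this
end rep

end

noncomputable section
open Set MvPolynomial Topology MeasureTheory

lemma det_cols {n : ℕ} (M : Matrix (Fin n) (Fin n) ℂ) {B δ : ℝ} (hδ : 0 ≤ δ) (i : Fin n → ℕ)
    (h : ∀ a b, δ * ‖M a b‖ ≤ B * δ ^ (i b)) : δ ^ n * ‖M.det‖ ≤ n.factorial * (B ^ n * δ ^ (∑ b, i b)) := by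
  rw [Matrix.det_apply]
  calc _ ≤ δ ^ n * ∑ σ : Equiv.Perm (Fin n), ‖Equiv.Perm.sign σ • ∏ b, M (σ b) b‖ := by
        gcongr; exact norm_sum_le _ _
    _ = ∑ σ : Equiv.Perm (Fin n), ∏ b, (δ * ‖M (σ b) b‖) := by
        rw [Finset.mul_sum]
        apply Finset.sum_congr rfl
        intro σ _
        rw [Finset.prod_mul_distrib, Finset.prod_const, Finset.card_univ, Fintype.card_fin, ← norm_prod]
        congr 1
        rcases Int.units_eq_one_or (Equiv.Perm.sign σ) with h | h <;> rw [h] <;> simp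
    _ ≤ ∑ σ : Equiv.Perm (Fin n), (B ^ n * δ ^ (∑ b, i b)) := by
        apply Finset.sum_le_sum
        intro σ _
        calc _ ≤ ∏ b, B * δ ^ (i b) := by
              apply Finset.prod_le_prod
              · intro b _; positivity
              · intro b _; exact h _ _
          _ = _ := by
              rw [Finset.prod_mul_distrib, Finset.prod_const, Finset.card_univ, Fintype.card_fin, Finset.prod_pow_eq_pow_sum]
    _ = _ := by rw [Finset.sum_const, Finset.card_univ, Fintype.card_perm, Fintype.card_fin, nsmul_eq_mul]

lemma sum_div (d : ℕ) (hd : 1 ≤ d) : ∑ b : Fin (4 * d), (b : ℕ) / d = 6 * d := by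
  rw [Fin.sum_univ_eq_sum_range (fun b => b / d)]
  have key : ∀ k, ∑ b ∈ Finset.range (k * d), b / d = d * ∑ i ∈ Finset.range k, i := by
    intro k
    induction k with
    | zero => simp
    | succ k ih =>
      rw [Nat.succ_mul, Finset.sum_range_add, ih, Finset.sum_range_succ, mul_add]
      congr 1
      rw [Finset.sum_congr rfl (g := fun _ => k)]
      · simp
      · intro x hx
        rw [mul_comm k d, Nat.mul_add_div (by omega), Nat.div_eq_of_lt (Finset.mem_range.1 hx), add_zero]
  rw [key]
  simp [Finset.sum_range_succ]; ring

section rep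
variable {X : Type} [TopologicalSpace X] [CompactSpace X] {E : Type} [NormedAddCommGroup E]
  [InnerProductSpace ℂ E] [CompleteSpace E]

open scoped InnerProductSpace

def DD (π : C(X, ℂ) →ₐ[ℂ] (E →L[ℂ] E)) (p f : C(X, ℂ)) (w₁ : ℂ) (ξ : E) {n : ℕ} (u : Fin n → E) (w : ℂ) : ℂ :=
  (Matrix.of fun a b : Fin n => ⟪u a, π ((p - algebraMap ℂ _ w₁) * resC p w * f ^ (b:ℕ)) ξ⟫_ℂ).det

lemma DD_diff (π : C(X, ℂ) →ₐ[ℂ] (E →L[ℂ] E)) (hπ : ∀ a, ‖π a‖ ≤ ‖a‖) (p f : C(X, ℂ)) (w₁ : ℂ) (ξ : E) {n : ℕ} (u : Fin n → E) {w : ℂ}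
    (hw : w ∉ range p) : DifferentiableAt ℂ (DD π p f w₁ ξ u) w := by
  have hres : DifferentiableAt ℂ (resC p) w := by
    obtain ⟨x, hx⟩ := resC_unit hw
    have h1 : DifferentiableAt ℂ Ring.inverse (p - algebraMap ℂ C(X,ℂ) w) := by
      rw [← hx]; exact (hasFDerivAt_ringInverse x).differentiableAt
    have h2 : DifferentiableAt ℂ (fun w => p - algebraMap ℂ C(X,ℂ) w) w := by
      simp only [Algebra.algebraMap_eq_smul_one]; fun_prop
    exact h1.comp w h2
  let πc : C(X,ℂ) →L[ℂ] (E →L[ℂ] E) := π.toLinearMap.mkContinuous 1 (fun a => by rw [one_mul]; exact hπ a)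
  have hent : ∀ a b : Fin n, DifferentiableAt ℂ (fun w => ⟪u a, π ((p - algebraMap ℂ _ w₁) * resC p w * f ^ (b:ℕ)) ξ⟫_ℂ) w := by
    intro a b
    have h1 : DifferentiableAt ℂ (fun w => (p - algebraMap ℂ _ w₁) * resC p w * f ^ (b:ℕ)) w :=
      (hres.const_mul _).mul_const _
    have h2 : DifferentiableAt ℂ (fun w => πc ((p - algebraMap ℂ _ w₁) * resC p w * f ^ (b:ℕ))) w :=
      πc.differentiableAt.comp w h1
    have h3 : DifferentiableAt ℂ (fun w => πc ((p - algebraMap ℂ _ w₁) * resC p w * f ^ (b:ℕ)) ξ) w :=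
      h2.clm_apply (differentiableAt_const ξ)
    exact (innerSL ℂ (u a)).differentiableAt.comp w h3
  unfold DD
  simp only [Matrix.det_apply, Matrix.of_apply]
  apply DifferentiableAt.fun_sum
  intro σ _
  apply DifferentiableAt.const_smul
  apply DifferentiableAt.fun_finset_prod
  intro b _
  exact hent _ _

lemma cm_pow_le {f : C(X, ℂ)} {B : ℝ} (hf : ‖f‖ ≤ B) (n : ℕ) : ‖f ^ n‖ ≤ B ^ n := by
  have hB : 0 ≤ B := (norm_nonneg f).trans hf
  rw [ContinuousMap.norm_le _ (by positivity)]
  intro x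
  rw [ContinuousMap.pow_apply, norm_pow]
  have := (f.norm_coe_le_norm x).trans hf
  gcongr

lemma cross_det {π : C(X, ℂ) →ₐ[ℂ] (E →L[ℂ] E)} (hπ : ∀ a, ‖π a‖ ≤ ‖a‖) {H : Submodule ℂ E} {p f h : C(X, ℂ)}
    (hp : InvH π H p) (hf : InvH π H f) (hh : InvH π H h) {w₁ w wb : ℂ} (hw₁ : w₁ ∉ range p) (hw : w ∉ range p) {ξ : E} (hξ : ξ ∈ H)
    {d : ℕ} (hd : 1 ≤ d) (u : Fin (4 * d) → E) (hu : ∀ a, u a ∈ (NN π H p w₁)ᗮ) {Q : Polynomial ℂ} (hQ : Q.Monic) (hQd : Q.natDegree = d)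
    (hQh : Polynomial.aeval f Q = (p - algebraMap ℂ _ wb) * h) {B δ : ℝ} (hB : 1 ≤ B) (hδ : 0 < δ) (hδ1 : δ ≤ 1)
    (hhB : ‖h‖ ≤ B) (hfB : ‖f‖ ≤ B) (hξB : ‖ξ‖ ≤ B) (huB : ∀ a, ‖u a‖ ≤ B) (hww : ‖w - wb‖ ≤ 2 * δ)
    (hres : δ * ‖(p - algebraMap ℂ _ w₁) * resC p w‖ ≤ B) :
    ‖DD π p f w₁ ξ u w‖ ≤ (4 * d).factorial * (8 * B ^ (6 + d)) ^ (4 * d) * δ := by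
  set T := (p - algebraMap ℂ _ w₁) * resC p w with hT
  set L : Fin (4 * d) → Polynomial ℂ →ₗ[ℂ] ℂ := fun a =>
    { toFun := fun g => ⟪u a, π (T * Polynomial.aeval f g) ξ⟫_ℂ
      map_add' := by intro g g'; simp [mul_add, inner_add_right]
      map_smul' := by intro c g; simp [inner_smul_right] } with hL
  have hLa : ∀ a g, L a g = ⟪u a, π (T * Polynomial.aeval f g) ξ⟫_ℂ := fun a g => rfl
  set G : Fin (4 * d) → Polynomial ℂ := fun b => Q ^ ((b:ℕ) / d) * Polynomial.X ^ ((b:ℕ) % d) with hG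
  have hGm : ∀ b, (G b).Monic := fun b => (hQ.pow _).mul (Polynomial.monic_X_pow _)
  have hGd : ∀ b, (G b).natDegree = b := by
    intro b
    rw [hG]
    simp only
    rw [(hQ.pow _).natDegree_mul (Polynomial.monic_X_pow _), hQ.natDegree_pow, hQd, Polynomial.natDegree_X_pow, mul_comm]
    exact Nat.div_add_mod _ _
  set M : Matrix (Fin (4*d)) (Fin (4*d)) ℂ := Matrix.of fun a b => L a (Polynomial.X ^ (b:ℕ)) with hM
  set M' : Matrix (Fin (4*d)) (Fin (4*d)) ℂ := Matrix.of fun a b => L a (G b) with hM'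
  have hDM : DD π p f w₁ ξ u w = M.det := by
    unfold DD
    congr 1
    ext a b
    simp only [Matrix.of_apply, hM, hLa, map_pow, Polynomial.aeval_X, hT]
  have hMM : M' = M * Matrix.of fun (c b : Fin (4 * d)) => (G b).coeff (c:ℕ) := by
    ext a b
    rw [Matrix.mul_apply]
    simp only [hM', hM, Matrix.of_apply]
    conv_lhs => rw [(G b).as_sum_range' (4 * d) (by rw [hGd]; exact b.2)]
    rw [map_sum, Finset.sum_range]
    apply Finset.sum_congr rfl
    intro c _
    rw [← Polynomial.C_mul_X_pow_eq_monomial, ← Polynomial.smul_eq_C_mul, map_smul, smul_eq_mul, mul_comm]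
  have hdet : M'.det = M.det := by
    rw [hMM, Matrix.det_mul, Matrix.det_matrixOfPolynomials G hGd hGm, mul_one]
  have hker : ∀ a v, v ∈ H → ⟪u a, π T (π (p - algebraMap ℂ _ w) v)⟫_ℂ = 0 := by
    intro a v hv
    rw [← pi_mul_apply]
    have : T * (p - algebraMap ℂ _ w) = p - algebraMap ℂ _ w₁ := by
      rw [hT, mul_assoc, mul_comm (resC p w), resC_mul hw, mul_one]
    rw [this, ← inner_conj_symm, hu a _ (NN_of hw₁ hv)]; simp
  have hmod : ∀ a v (i : ℕ), v ∈ H → ⟪u a, π T (π ((p - algebraMap ℂ _ wb) ^ i) v)⟫_ℂ = (w - wb) ^ i * ⟪u a, π T v⟫_ℂ := by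
    intro a v i hv
    induction i with
    | zero => simp
    | succ i ih =>
      have e1 : (p - algebraMap ℂ C(X,ℂ) wb) ^ (i+1) = (p - algebraMap ℂ C(X,ℂ) w) * (p - algebraMap ℂ C(X,ℂ) wb) ^ i + (w - wb) • (p - algebraMap ℂ C(X,ℂ) wb) ^ i := by
        rw [pow_succ', Algebra.smul_def, map_sub]; ring
      have hm : π ((p - algebraMap ℂ _ wb) ^ i) v ∈ H := ((hp.sub (InvH.alg π H wb)).pow i) v hv
      rw [e1, map_add, ContinuousLinearMap.add_apply, map_add, inner_add_right, pi_mul_apply π (p - algebraMap ℂ C(X,ℂ) w), hker a _ hm, map_smul, ContinuousLinearMap.smul_apply,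
        map_smul, inner_smul_right, ih, zero_add, pow_succ']
      ring
  have hent : ∀ a b, δ * ‖M' a b‖ ≤ (8 * B ^ (6 + d)) * δ ^ ((b:ℕ) / d) := by
    intro a b
    set i := (b:ℕ) / d with hi
    set s := (b:ℕ) % d with hs
    have hi4 : i ≤ 3 := by
      have : i < 4 := Nat.div_lt_of_lt_mul (lt_of_lt_of_eq b.2 (mul_comm 4 d))
      omega
    have hsd : s ≤ d := (Nat.mod_lt _ (by omega)).le
    have e1 : M' a b = (w - wb) ^ i * ⟪u a, π T (π (h ^ i * f ^ s) ξ)⟫_ℂ := by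
      have hmem : π (h ^ i * f ^ s) ξ ∈ H := ((hh.pow i).mul (hf.pow s)) ξ hξ
      rw [← hmod a _ i hmem, ← pi_mul_apply, ← pi_mul_apply]
      have e0 : Polynomial.aeval f (G b) = (p - algebraMap ℂ C(X,ℂ) wb) ^ i * (h ^ i * f ^ s) := by
        simp only [hG]
        rw [map_mul, map_pow, map_pow, Polynomial.aeval_X, hQh, mul_pow, mul_assoc]
      simp only [hM', Matrix.of_apply, hLa, e0, mul_assoc]
    rw [e1, norm_mul, norm_pow]
    have h1 : ‖⟪u a, π T (π (h ^ i * f ^ s) ξ)⟫_ℂ‖ ≤ B * (‖T‖ * (B ^ i * B ^ s * B)) := by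
      calc _ ≤ ‖u a‖ * ‖π T (π (h ^ i * f ^ s) ξ)‖ := norm_inner_le_norm _ _
        _ ≤ B * (‖T‖ * (B ^ i * B ^ s * B)) := by
          gcongr
          · exact huB a
          · refine ((π T).le_opNorm _).trans ?_
            gcongr
            · exact hπ T
            · refine ((π _).le_opNorm _).trans ?_
              gcongr
              refine (hπ _).trans ((norm_mul_le _ _).trans ?_)
              gcongr
              · exact cm_pow_le hhB i
              · exact cm_pow_le hfB s
    calc δ * (‖w - wb‖ ^ i * ‖⟪u a, π T (π (h ^ i * f ^ s) ξ)⟫_ℂ‖)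
        ≤ δ * ((2 * δ) ^ i * (B * (‖T‖ * (B ^ i * B ^ s * B)))) := by gcongr
      _ = (2 ^ i * (B * (B ^ i * B ^ s * B)) * (δ * ‖T‖)) * δ ^ i := by rw [mul_pow]; ring
      _ ≤ (2 ^ 3 * (B * (B ^ 3 * B ^ d * B)) * B) * δ ^ i := by
          have : (1:ℝ) ≤ 2 := by norm_num
          gcongr
      _ = _ := by ring
  have hfin := det_cols M' hδ.le (fun b => (b:ℕ) / d) hent
  rw [sum_div d hd] at hfin
  rw [hDM, ← hdet]
  have e2 : δ ^ (6 * d) = δ ^ (4 * d) * δ ^ (2 * d) := by rw [← pow_add]; congr 1; omega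
  have e3 : δ ^ (2 * d) ≤ δ := by
    calc δ ^ (2 * d) ≤ δ ^ 1 := pow_le_pow_of_le_one hδ.le hδ1 (by omega)
      _ = δ := pow_one δ
  rw [e2] at hfin
  have hp4 : 0 < δ ^ (4 * d) := by positivity
  have h5 : δ ^ (4 * d) * ‖M'.det‖ ≤ δ ^ (4 * d) * ((4 * d).factorial * (8 * B ^ (6 + d)) ^ (4 * d) * δ ^ (2 * d)) := by
    refine hfin.trans (le_of_eq ?_); ring
  refine (le_of_mul_le_mul_left h5 hp4).trans ?_
  gcongr

lemma gram_zero {π : C(X, ℂ) →ₐ[ℂ] (E →L[ℂ] E)} {H : Submodule ℂ E} (hH : IsClosed (H : Set E)) {p f : C(X, ℂ)}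
    {w₁ : ℂ} (hw₁ : w₁ ∉ range p) {ξ : E} {n : ℕ}
    (hD : DD π p f w₁ ξ (fun a : Fin n => QQ π H p w₁ (π (f ^ (a:ℕ)) ξ)) w₁ = 0) :
    ∃ g : Polynomial ℂ, g ≠ 0 ∧ π (Polynomial.aeval f g) ξ ∈ NN π H p w₁ := by
  unfold DD at hD
  rw [← Matrix.exists_mulVec_eq_zero_iff] at hD
  obtain ⟨c, hc, hcM⟩ := hD
  refine ⟨∑ b : Fin n, Polynomial.monomial (b:ℕ) (c b), ?_, ?_⟩
  · intro h0
    apply hc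
    funext b
    have := congrArg (fun q => Polynomial.coeff q (b:ℕ)) h0
    simp only [Polynomial.finset_sum_coeff, Polynomial.coeff_monomial, Polynomial.coeff_zero] at this
    rw [Finset.sum_eq_single b] at this
    · simpa using this
    · intro b' _ hb'
      rw [if_neg]; intro h; exact hb' (Fin.ext h)
    · simp
  · rw [← QQ_zero_iff hH]
    set y := π (Polynomial.aeval f (∑ b : Fin n, Polynomial.monomial (b:ℕ) (c b))) ξ with hy
    have hy2 : y = ∑ b : Fin n, c b • π (f ^ (b:ℕ)) ξ := by
      rw [hy, map_sum, map_sum, ContinuousLinearMap.sum_apply]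
      apply Finset.sum_congr rfl
      intro b _
      rw [Polynomial.aeval_monomial, ← Algebra.smul_def, map_smul]; rfl
    have h1 : ∀ a : Fin n, ⟪QQ π H p w₁ (π (f ^ (a:ℕ)) ξ), QQ π H p w₁ y⟫_ℂ = 0 := by
      intro a
      have h2 := congrFun hcM a
      simp only [Matrix.mulVec, dotProduct, Matrix.of_apply, Pi.zero_apply, resC_mul hw₁, one_mul] at h2
      have h3 : ⟪QQ π H p w₁ (π (f ^ (a:ℕ)) ξ), y⟫_ℂ = 0 := by
        rw [hy2, inner_sum, ← h2]
        apply Finset.sum_congr rfl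
        intro b _
        rw [inner_smul_right, mul_comm]
      rw [← h3]
      have h4 : ⟪QQ π H p w₁ (π (f ^ (a:ℕ)) ξ), y - QQ π H p w₁ y⟫_ℂ = 0 := by
        rw [← inner_conj_symm, QQ_mem π H p w₁ _ _ (QQ_sub hH p w₁ y)]; simp
      rw [inner_sub_right, sub_eq_zero] at h4
      exact h4.symm
    have h5 : ⟪QQ π H p w₁ y, QQ π H p w₁ y⟫_ℂ = 0 := by
      nth_rewrite 1 [hy2]
      rw [map_sum, sum_inner]
      apply Finset.sum_eq_zero
      intro b _
      rw [map_smul, inner_smul_left, h1, mul_zero]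
    exact inner_self_eq_zero.1 h5
end rep

end

noncomputable section
open Set MvPolynomial Topology MeasureTheory

section rep
variable {X : Type} [TopologicalSpace X] [CompactSpace X] {E : Type} [NormedAddCommGroup E]
  [InnerProductSpace ℂ E] [CompleteSpace E]

lemma aeval_cm_apply (f : C(X, ℂ)) (g : Polynomial ℂ) (x : X) : (Polynomial.aeval f g) x = g.eval (f x) := by
  have := Polynomial.aeval_algHom_apply (ContinuousMap.evalAlgHom ℂ ℂ x) f g
  simp only [ContinuousMap.evalAlgHom_apply] at this
  rw [← this, Polynomial.coe_aeval_eq_eval]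

lemma cross_use {π : C(X, ℂ) →ₐ[ℂ] (E →L[ℂ] E)} (hπ : ∀ a, ‖π a‖ ≤ ‖a‖) {H : Submodule ℂ E} (hH : IsClosed (H : Set E)) {p f : C(X, ℂ)}
    (hp : InvH π H p) (hf : InvH π H f) {ξ : E} (hξ : ξ ∈ H) {σ : ℝ → X} (hσ : ∀ x, ‖p x‖ ≤ 1/4 ∨ ∃ t ∈ Icc (0:ℝ) 1, σ t = x)
    {Lf : NNReal} (hLf : LipschitzWith Lf (fun t => f (σ t))) {w₁ : ℂ} {j r k m : ℕ} :
    ∃ C : ℝ, ∀ e, CrossP (fun t => p (σ t)) (range p) (UU π H p) w₁ j r k m e → ∀ w, (w - w₁) / (e - w₁) ∈ dropU (1 / j) → w ∉ range p ∧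
      ‖DD π p f w₁ ξ (fun a : Fin (4 * (k + m + 1)) => QQ π H p w₁ (π (f ^ (a:ℕ)) ξ)) w‖ ≤ C * ‖w - e‖ := by
  set u : Fin (4 * (k + m + 1)) → E := (fun a : Fin (4 * (k + m + 1)) => QQ π H p w₁ (π (f ^ (a:ℕ)) ξ)) with hu
  set F := ‖f‖ with hF
  have hF0 : 0 ≤ F := norm_nonneg _
  set B0 := (2*F)^k*((2*F)^m+Lf^m)*F*(j:ℝ)^2 with hB0
  have hB00 : 0 ≤ B0 := by positivity
  set B1 := (j:ℝ) * (‖p‖ + ‖w₁‖) with hB1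
  have hB10 : 0 ≤ B1 := by positivity
  set B2 := ∑ a, ‖u a‖ with hB2
  have hB20 : 0 ≤ B2 := Finset.sum_nonneg fun _ _ => norm_nonneg _
  set B := 1 + B0 + F + ‖ξ‖ + B1 + B2 with hB
  have hξ0 := norm_nonneg ξ
  refine ⟨(4 * (k + m + 1)).factorial * (8 * B ^ (6 + (k + m + 1))) ^ (4 * (k + m + 1)), ?_⟩
  intro e he w hwd
  have hj : (1:ℝ) ≤ j := by exact_mod_cast he.j1
  have hj0 : (0:ℝ) < j := by linarith
  have hr : (1:ℝ) ≤ r := by exact_mod_cast he.r1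
  obtain ⟨hu1, hu0⟩ := dropU_norm (by positivity) hwd
  have hew : e - w₁ ≠ 0 := by
    have : 0 < ‖e - w₁‖ := lt_of_lt_of_le (by positivity) he.far
    exact norm_pos_iff.1 this
  have hδ : 0 < ‖w - e‖ := by
    rw [norm_pos_iff, sub_ne_zero]
    rintro rfl
    rw [div_self hew] at hu1
    simp at hu1
  set δ := ‖w - e‖ with hδe
  have hδj : δ < 1 / j := by
    have h1 : w - e = (e - w₁) * ((w - w₁) / (e - w₁) - 1) := by field_simp; ring
    rw [hδe, h1, norm_mul]
    have h2 : ‖(w - w₁) / (e - w₁) - 1‖ ≤ 2 := by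
      refine (norm_sub_le _ _).trans ?_
      rw [norm_one]; linarith
    calc _ ≤ ‖e - w₁‖ * 2 := by gcongr
      _ < 1 / (2 * j) * 2 := by gcongr; exact he.near
      _ = _ := by field_simp
  have hδ1 : δ ≤ 1 := by
    refine hδj.le.trans ?_
    rw [div_le_one hj0]; exact hj
  have hwr : w ∉ range p := by
    intro hw
    have := he.drop w hwd w hw
    simp at this
    rw [hδe] at hδ; simp [this] at hδ
  refine ⟨hwr, ?_⟩
  obtain ⟨hwb, hright⟩ := he.right δ hδ hδj
  obtain ⟨τ, hτ, hprod⟩ := he.prod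
  obtain ⟨R, hRm, hRd, hRb, hRN⟩ := charpoly_fin hπ hH hp hf hwb
  set wb : ℂ := e + (δ:ℂ) with hwbe
  have hwbr : wb ∉ range p := hwb.1
  set S : Polynomial ℂ := (∏ l, (Polynomial.X - Polynomial.C (f (σ (τ l))))) * Polynomial.X with hS
  have hPm : (∏ l, (Polynomial.X - Polynomial.C (f (σ (τ l))))).Monic := Polynomial.monic_prod_of_monic _ _ fun l _ => Polynomial.monic_X_sub_C _
  have hSm : S.Monic := hPm.mul Polynomial.monic_X
  have hSd : S.natDegree = m + 1 := by
    rw [hS, hPm.natDegree_mul Polynomial.monic_X, Polynomial.natDegree_X, Polynomial.natDegree_prod_of_monic _ _ (fun l _ => Polynomial.monic_X_sub_C _)]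
    simp
  set Q := R * S with hQ
  have hQm : Q.Monic := hRm.mul hSm
  have hQd : Q.natDegree = k + m + 1 := by rw [hQ, hRm.natDegree_mul hSm, hRd, hSd, add_assoc]
  set h : C(X,ℂ) := Polynomial.aeval f Q * resC p wb with hh
  have hQh : Polynomial.aeval f Q = (p - algebraMap ℂ _ wb) * h := by
    rw [hh, mul_left_comm, resC_mul hwbr, mul_one]
  have hhInv : InvH π H h := by
    intro v hv
    have h1 : h = resC p wb * (Polynomial.aeval f R * Polynomial.aeval f S) := by
      rw [hh, hQ, map_mul (Polynomial.aeval f), mul_comm]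
    rw [h1, pi_mul_apply, pi_mul_apply]
    exact hRN _ ((hf.aeval S) v hv)
  have hhB : ‖h‖ ≤ B0 := by
    rw [ContinuousMap.norm_le _ hB00]
    intro x
    have hpx : 0 < ‖p x - wb‖ := by
      rw [norm_pos_iff, sub_ne_zero]; intro h; exact hwbr ⟨x, h⟩
    rw [hh, ContinuousMap.mul_apply, resC_apply hwbr, aeval_cm_apply, norm_mul, norm_inv, ← div_eq_mul_inv, div_le_iff₀ hpx]
    have hfx : ‖f x‖ ≤ F := f.norm_coe_le_norm x
    have e1 : ‖Q.eval (f x)‖ = ‖R.eval (f x)‖ * ((∏ l, ‖f x - f (σ (τ l))‖) * ‖f x‖) := by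
      rw [hQ, hS, Polynomial.eval_mul, Polynomial.eval_mul, Polynomial.eval_prod, norm_mul, norm_mul, norm_prod]
      simp
    rw [e1]
    have hR := hRb (f x) hfx
    have hq := hright (p x) ⟨x, rfl⟩
    have key : (∏ l, ‖f x - f (σ (τ l))‖) ≤ ((2*F)^m+Lf^m) * ((j:ℝ)^2 * ‖p x - wb‖) := by
      rcases hσ x with hx | ⟨t, ht, rfl⟩
      · have h1 := he.disc (p x) ⟨x, rfl⟩ hx
        have h2 : 1 ≤ (j:ℝ)^2 * ‖p x - wb‖ := by
          calc (1:ℝ) ≤ j * ‖p x - e‖ := h1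
            _ ≤ j * (j * ‖p x - wb‖) := by gcongr
            _ = _ := by ring
        calc (∏ l, ‖f x - f (σ (τ l))‖) ≤ ∏ l : Fin m, (2 * F) := by
              apply Finset.prod_le_prod
              · intro _ _; positivity
              · intro l _
                refine (norm_sub_le _ _).trans ?_
                have := f.norm_coe_le_norm (σ (τ l))
                linarith
          _ = (2*F)^m := by simp
          _ ≤ ((2*F)^m+Lf^m) * 1 := by rw [mul_one]; have : (0:ℝ) ≤ Lf^m := by positivity
                                       linarith
          _ ≤ _ := by gcongr
      · calc (∏ l, ‖f (σ t) - f (σ (τ l))‖) ≤ ∏ l : Fin m, (Lf * |t - τ l|) := by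
              apply Finset.prod_le_prod
              · intro _ _; positivity
              · intro l _
                have := hLf.dist_le_mul t (τ l)
                rwa [dist_eq_norm, Real.dist_eq] at this
          _ = Lf^m * ∏ l, |t - τ l| := by rw [Finset.prod_mul_distrib]; simp
          _ ≤ Lf^m * (j * (j * ‖p (σ t) - wb‖)) := by
              gcongr
              exact (hprod t ht).trans (by gcongr)
          _ = Lf^m * ((j:ℝ)^2 * ‖p (σ t) - wb‖) := by ring
          _ ≤ _ := by
              gcongr
              have : (0:ℝ) ≤ (2*F)^m := by positivity
              linarith
    calc _ ≤ (2*F)^k * ((((2*F)^m+Lf^m) * ((j:ℝ)^2 * ‖p x - wb‖)) * F) := by gcongr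
      _ = _ := by rw [hB0]; ring
  have hww : ‖w - wb‖ ≤ 2 * δ := by
    have : w - wb = (w - e) - (δ:ℂ) := by rw [hwbe]; ring
    rw [this]
    refine (norm_sub_le _ _).trans ?_
    rw [Complex.norm_real, Real.norm_of_nonneg hδ.le]; linarith
  have hres : δ * ‖(p - algebraMap ℂ _ w₁) * resC p w‖ ≤ B1 := by
    rw [← le_div_iff₀' hδ, ContinuousMap.norm_le _ (by positivity)]
    intro x
    have hpx : 0 < ‖p x - w‖ := by
      rw [norm_pos_iff, sub_ne_zero]; intro h; exact hwr ⟨x, h⟩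
    rw [ContinuousMap.mul_apply, resC_apply hwr, norm_mul, norm_inv, ← div_eq_mul_inv, div_le_div_iff₀ hpx hδ]
    have h1 := he.drop w hwd (p x) ⟨x, rfl⟩
    have h2 : ‖(p - algebraMap ℂ C(X,ℂ) w₁) x‖ ≤ ‖p‖ + ‖w₁‖ := by
      simp only [ContinuousMap.sub_apply, _root_.algebraMap_apply, smul_eq_mul, ContinuousMap.one_apply, mul_one]
      refine (norm_sub_le _ _).trans ?_
      gcongr; exact p.norm_coe_le_norm x
    calc _ ≤ (‖p‖ + ‖w₁‖) * (j * ‖p x - w‖) := by gcongr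
      _ = _ := by rw [hB1]; ring
  have hw1 : w₁ ∉ range p := he.wW
  refine cross_det hπ hp hf hhInv hw1 hwr hξ (by omega) u (fun a => QQ_mem _ _ _ _ _) hQm hQd hQh (by linarith) hδ hδ1
    (hhB.trans (by linarith)) (by linarith) (by linarith) (fun a => ?_) hww (hres.trans (by linarith))
  have : ‖u a‖ ≤ B2 := Finset.single_le_sum (f := fun a => ‖u a‖) (fun _ _ => norm_nonneg _) (Finset.mem_univ a)
  linarith

lemma cross_alg {π : C(X, ℂ) →ₐ[ℂ] (E →L[ℂ] E)} (hπ : ∀ a, ‖π a‖ ≤ ‖a‖) {H : Submodule ℂ E} (hH : IsClosed (H : Set E)) {p f : C(X, ℂ)}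
    (hp : InvH π H p) (hf : InvH π H f) {ξ : E} (hξ : ξ ∈ H) {σ : ℝ → X} (hσ : ∀ x, ‖p x‖ ≤ 1/4 ∨ ∃ t ∈ Icc (0:ℝ) 1, σ t = x)
    {Lf : NNReal} (hLf : LipschitzWith Lf (fun t => f (σ t))) {w₁ : ℂ} {j r k m : ℕ}
    (hvol : volume (Complex.im '' {e | CrossP (fun t => p (σ t)) (range p) (UU π H p) w₁ j r k m e}) ≠ 0) :
    ∃ g : Polynomial ℂ, g ≠ 0 ∧ π (Polynomial.aeval f g) ξ ∈ NN π H p w₁ := by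
  obtain ⟨C, hC⟩ := cross_use hπ hH hp hf hξ hσ hLf (w₁ := w₁) (j := j) (r := r) (k := k) (m := m)
  set Es := {e | CrossP (fun t => p (σ t)) (range p) (UU π H p) w₁ j r k m e} with hEs
  obtain ⟨e₀, he₀⟩ : Es.Nonempty := by
    by_contra h
    rw [not_nonempty_iff_eq_empty] at h
    rw [h] at hvol; simp at hvol
  have he₀ : CrossP (fun t => p (σ t)) (range p) (UU π H p) w₁ j r k m e₀ := he₀
  have hj : (1:ℝ) ≤ j := by exact_mod_cast he₀.j1
  have hr : (1:ℝ) ≤ r := by exact_mod_cast he₀.r1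
  have hw₁ := he₀.wW
  refine gram_zero hH hw₁ (n := 4 * (k + m + 1)) ?_
  refine LP_gen (ε := 1 / j) (C := C) (r₀ := 1 / r) (R := 1 / (2 * j)) (by positivity) (by positivity) (E := Es) (fun e he => he.far) (fun e he => he.near.le)
    rfl ?_ hvol ?_ ?_
  · rintro e he (h | ⟨e', he', h⟩)
    · exact hw₁ (h ▸ he.eW)
    · exact (hC e' he' e h).1 he.eW
  · rintro w (h | ⟨e', he', h⟩)
    · rw [h]; exact (DD_diff π hπ p f w₁ ξ _ hw₁).differentiableWithinAt
    · exact (DD_diff π hπ p f w₁ ξ _ (hC e' he' w h).1).differentiableWithinAt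
  · intro e he w hw
    exact (hC e he w hw).2

lemma finite_quot {N : ℕ} (I : Ideal (MvPolynomial (Fin N) ℂ))
    (h : ∀ i, ∃ g : Polynomial ℂ, g ≠ 0 ∧ Polynomial.aeval (MvPolynomial.X i : MvPolynomial (Fin N) ℂ) g ∈ I) :
    Module.Finite ℂ (MvPolynomial (Fin N) ℂ ⧸ I) := by
  set q := Ideal.Quotient.mkₐ ℂ I with hq
  have h1 : Algebra.adjoin ℂ (range fun i => q (MvPolynomial.X i)) = ⊤ := by
    have : (range fun i => q (MvPolynomial.X i)) = q '' range MvPolynomial.X := by rw [← range_comp]; rfl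
    rw [this, ← AlgHom.map_adjoin, MvPolynomial.adjoin_range_X, Algebra.map_top]
    exact (AlgHom.range_eq_top q).2 (Ideal.Quotient.mkₐ_surjective ℂ I)
  have h2 := fg_adjoin_of_finite (R := ℂ) (s := range fun i => q (MvPolynomial.X i)) (finite_range _) (by
    rintro _ ⟨i, rfl⟩
    obtain ⟨g, hg, hgI⟩ := h i
    refine IsAlgebraic.isIntegral ⟨g, hg, ?_⟩
    rw [Polynomial.aeval_algHom_apply]
    exact Ideal.Quotient.eq_zero_iff_mem.2 hgI)
  rw [h1] at h2
  exact ⟨h2⟩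

/-- M3 for real points -/
lemma M3_real {π : C(X, ℂ) →ₐ[ℂ] (E →L[ℂ] E)} (hπ : ∀ a, ‖π a‖ ≤ ‖a‖) {N : ℕ} (Φ : MvPolynomial (Fin N) ℂ →ₐ[ℂ] C(X,ℂ))
    {ξ : E} {H : Submodule ℂ E} (hHe : (H : Set E) = closure (range fun a => π (Φ a) ξ)) {σ : ℝ → X} {a : MvPolynomial (Fin N) ℂ}
    (hσ : ∀ x, ‖Φ a x‖ ≤ 1/4 ∨ ∃ t ∈ Icc (0:ℝ) 1, σ t = x) (hLip : ∀ b, ∃ L : NNReal, LipschitzWith L (fun t => Φ b (σ t)))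
    {x0 : ℝ} (hx0 : 1/4 < x0) (h0 : (x0 : ℂ) ∉ range (Φ a)) : ∃ k, (x0:ℂ) ∈ UU π H (Φ a) k := by
  have hH : IsClosed (H : Set E) := by rw [hHe]; exact isClosed_closure
  have hinv : ∀ b, InvH π H (Φ b) := by
    intro b v hv
    have hv' : v ∈ closure (range fun a => π (Φ a) ξ) := by rw [← hHe]; exact hv
    change π (Φ b) v ∈ (H : Set E)
    rw [hHe]
    refine map_mem_closure (π (Φ b)).continuous hv' ?_
    rintro _ ⟨a, rfl⟩
    exact ⟨b * a, by simp [map_mul]⟩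
  have hξ : ξ ∈ H := by
    change ξ ∈ (H : Set E)
    rw [hHe]
    exact subset_closure ⟨1, by simp⟩
  by_contra hcon
  push Not at hcon
  set p := Φ a with hp
  obtain ⟨L, hL⟩ := hLip a
  obtain ⟨w₁, j, r, k, m, hvol⟩ := geom_main hL (W := range p) (isCompact_range p.continuous) (by
      rintro _ ⟨x, rfl⟩
      rcases hσ x with h | ⟨t, ht, rfl⟩
      · left; simpa using h
      · right; exact ⟨t, ht, rfl⟩) (U := UU π H p) (UU_open hπ hH (hinv a)) (UU_open' hπ hH (hinv a)) (M := ‖p‖)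
      (fun w hw => UU_zero hπ hw) hx0 h0 hcon
  obtain ⟨e₀, he₀⟩ : {e | CrossP (fun t => p (σ t)) (range p) (UU π H p) w₁ j r k m e}.Nonempty := by
    by_contra h
    rw [not_nonempty_iff_eq_empty] at h
    rw [h] at hvol; simp at hvol
  have he₀ : CrossP (fun t => p (σ t)) (range p) (UU π H p) w₁ j r k m e₀ := he₀
  have hw₁ := he₀.wW
  let I : Ideal (MvPolynomial (Fin N) ℂ) :=
    { carrier := {b | π (Φ b) ξ ∈ NN π H p w₁}
      add_mem' := by
        intro b b' hb hb'
        simp only [mem_ofPred_eq, map_add, ContinuousLinearMap.add_apply] at *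
        exact add_mem hb hb'
      zero_mem' := by simp
      smul_mem' := by
        intro c b hb
        simp only [mem_ofPred_eq, smul_eq_mul, map_mul Φ] at *
        rw [pi_mul_apply]
        exact NN_inv (hinv c) hb }
  have hI : ∀ b, b ∈ I ↔ π (Φ b) ξ ∈ NN π H p w₁ := fun b => Iff.rfl
  have hfin := finite_quot I (by
    intro i
    obtain ⟨Lf, hLf⟩ := hLip (MvPolynomial.X i)
    obtain ⟨g, hg, hgN⟩ := cross_alg hπ hH (hinv a) (hinv (MvPolynomial.X i)) hξ hσ hLf hvol
    refine ⟨g, hg, ?_⟩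
    rw [hI, ← Polynomial.aeval_algHom_apply]
    exact hgN)
  let T : MvPolynomial (Fin N) ℂ →ₗ[ℂ] E :=
    { toFun := fun b => QQ π H p w₁ (π (Φ b) ξ)
      map_add' := by intro b b'; simp
      map_smul' := by intro c b; simp }
  have hT : ∀ b, T b = QQ π H p w₁ (π (Φ b) ξ) := fun b => rfl
  have hTfin : FiniteDimensional ℂ (LinearMap.range T) := by
    let T' : (MvPolynomial (Fin N) ℂ ⧸ I) →ₗ[ℂ] E :=
      (I.restrictScalars ℂ).liftQ T (by
        intro b hb
        rw [LinearMap.mem_ker, hT]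
        exact QQ_zero p w₁ hb)
    have : LinearMap.range T ≤ LinearMap.range T' := by
      rintro _ ⟨b, rfl⟩
      exact ⟨Submodule.Quotient.mk b, rfl⟩
    have h2 : FiniteDimensional ℂ (LinearMap.range T') := inferInstance
    exact Submodule.finiteDimensional_of_le this
  have hle : VV π H p w₁ ≤ LinearMap.range T := by
    intro v hv
    rw [← QQ_id hv]
    have hcl : IsClosed (LinearMap.range T : Set E) := Submodule.closed_of_finiteDimensional _
    have hvH : v ∈ (H : Set E) := hv.1
    rw [hHe] at hvH
    change _ ∈ (LinearMap.range T : Set E)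
    rw [← hcl.closure_eq]
    refine map_mem_closure (QQ π H p w₁).continuous hvH ?_
    rintro _ ⟨b, rfl⟩
    exact ⟨b, rfl⟩
  have : FiniteDimensional ℂ (VV π H p w₁) := Submodule.finiteDimensional_of_le hle
  refine he₀.wU (Module.finrank ℂ (VV π H p w₁)) ⟨hw₁, ?_⟩
  rw [Module.finrank_eq_rank]

end rep

end

noncomputable section
open Set MvPolynomial Topology MeasureTheory

section rep
variable {X : Type} [TopologicalSpace X] [CompactSpace X] {E : Type} [NormedAddCommGroup E]
  [InnerProductSpace ℂ E] [CompleteSpace E]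

lemma M3 {π : C(X, ℂ) →ₐ[ℂ] (E →L[ℂ] E)} (hπ : ∀ a, ‖π a‖ ≤ ‖a‖) {N : ℕ} (Φ : MvPolynomial (Fin N) ℂ →ₐ[ℂ] C(X,ℂ))
    {ξ : E} {H : Submodule ℂ E} (hHe : (H : Set E) = closure (range fun a => π (Φ a) ξ)) {σ : ℝ → X} {a : MvPolynomial (Fin N) ℂ}
    (hσ : ∀ x, ‖Φ a x‖ ≤ 1/4 ∨ ∃ t ∈ Icc (0:ℝ) 1, σ t = x) (hLip : ∀ b, ∃ L : NNReal, LipschitzWith L (fun t => Φ b (σ t)))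
    {w : ℂ} (hw4 : 1/4 < ‖w‖) (hw : w ∉ range (Φ a)) : FiniteDimensional ℂ (VV π H (Φ a) w) := by
  have hw0 : w ≠ 0 := by rintro rfl; simp at hw4; linarith
  have hn0 : (‖w‖:ℂ) ≠ 0 := by simpa using hw0
  set ω : ℂ := ‖w‖ / w with hω
  have hω0 : ω ≠ 0 := div_ne_zero hn0 hw0
  have hω1 : ‖ω‖ = 1 := by rw [hω]; simp [hw0]
  have hωw : ω * w = ‖w‖ := by rw [hω]; field_simp
  have hΦ : Φ (ω • a) = ω • Φ a := map_smul Φ ω a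
  have hr : ((‖w‖:ℝ):ℂ) ∉ range (Φ (ω • a)) := by
    rw [← hωw]
    rintro ⟨x, hx⟩
    rw [hΦ] at hx
    exact hw ⟨x, mul_left_cancel₀ hω0 hx⟩
  obtain ⟨k, hk⟩ := M3_real hπ Φ hHe (a := ω • a) (σ := σ) (by
    intro x
    rw [hΦ]
    simpa [hω1] using hσ x) hLip hw4 hr
  have hres : resC (Φ a) w = ω • resC (Φ (ω • a)) ‖w‖ := by
    ext x
    rw [ContinuousMap.smul_apply, resC_apply hw, resC_apply hr, hΦ, ← hωw, ContinuousMap.smul_apply, smul_eq_mul, smul_eq_mul, ← mul_sub, mul_inv, ← mul_assoc,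
      mul_inv_cancel₀ hω0, one_mul]
  have hNN : NN π H (Φ a) w = NN π H (Φ (ω • a)) ‖w‖ := by
    ext v
    rw [mem_NN, mem_NN, hres, map_smul, ContinuousLinearMap.smul_apply, H.smul_mem_iff hω0]
  have : VV π H (Φ a) w = VV π H (Φ (ω • a)) ‖w‖ := by unfold VV; rw [hNN]
  rw [this]
  have h2 := hk.2
  exact Module.rank_lt_aleph0_iff.1 (h2.trans_lt (Cardinal.natCast_lt_aleph0))

lemma cpt_comp_left {T : E →L[ℂ] E} (hT : IsCompactOperator T) (S : E →L[ℂ] E) : IsCompactOperator (S ∘L T) := by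
  have := hT.clm_comp S
  exact this

/-- Hankel type operator -/
def Hank (π : C(X, ℂ) →ₐ[ℂ] (E →L[ℂ] E)) (P : E →L[ℂ] E) (f : C(X,ℂ)) : E →L[ℂ] E := (1 - P) ∘L (π f ∘L P)

def CCc (π : C(X, ℂ) →ₐ[ℂ] (E →L[ℂ] E)) (P : E →L[ℂ] E) (hP : P ∘L P = P) : Subalgebra ℂ C(X,ℂ) where
  carrier := {f | IsCompactOperator (Hank π P f)}
  add_mem' := by
    intro f g hf hg
    have : Hank π P (f + g) = Hank π P f + Hank π P g := by
      ext v; simp [Hank]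
    simp only [mem_ofPred_eq, this] at *
    exact hf.add hg
  mul_mem' := by
    intro f g hf hg
    have : Hank π P (f * g) = Hank π P f ∘L (π g ∘L P) + ((1 - P) ∘L π f) ∘L Hank π P g := by
      ext v; simp [Hank]
    simp only [mem_ofPred_eq, this] at *
    have h2 : IsCompactOperator (((1 - P) ∘L π f) ∘L Hank π P g) := cpt_comp_left hg ((1 - P) ∘L π f)
    have h1 : IsCompactOperator (Hank π P f ∘L (π g ∘L P)) := hf.comp_clm (π g ∘L P)
    exact h1.add h2
  algebraMap_mem' := by
    intro c
    have : Hank π P (algebraMap ℂ _ c) = 0 := by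
      ext v
      have := congrArg (fun T : E →L[ℂ] E => T v) hP
      simp only [ContinuousLinearMap.comp_apply] at this
      simp [Hank, Algebra.algebraMap_eq_smul_one, this]
    simp only [mem_ofPred_eq, this]
    exact isCompactOperator_zero

lemma mem_CCc {π : C(X, ℂ) →ₐ[ℂ] (E →L[ℂ] E)} {P : E →L[ℂ] E} {hP : P ∘L P = P} {f : C(X,ℂ)} :
    f ∈ CCc π P hP ↔ IsCompactOperator (Hank π P f) := Iff.rfl

lemma CCc_closed {π : C(X, ℂ) →ₐ[ℂ] (E →L[ℂ] E)} (hπ : ∀ a, ‖π a‖ ≤ ‖a‖) {P : E →L[ℂ] E} {hP : P ∘L P = P} :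
    IsClosed (CCc π P hP : Set C(X,ℂ)) := by
  let πc : C(X,ℂ) →L[ℂ] (E →L[ℂ] E) := π.toLinearMap.mkContinuous 1 (fun a => by rw [one_mul]; exact hπ a)
  have hc : Continuous (Hank π P) := by
    have : Hank π P = fun f => (1 - P) ∘L (πc f ∘L P) := rfl
    rw [this]
    exact ((ContinuousLinearMap.compL ℂ E E E (1 - P)).continuous.comp ((ContinuousLinearMap.compL ℂ E E E).flip P).continuous).comp πc.continuous
  exact (isClosed_setOf_isCompactOperator (𝕜₁ := ℂ) (𝕜₂ := ℂ) (σ₁₂ := RingHom.id ℂ) (M₁ := E) (M₂ := E)).preimage hc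

lemma CCc_inv {π : C(X, ℂ) →ₐ[ℂ] (E →L[ℂ] E)} {H : Submodule ℂ E} [H.HasOrthogonalProjection] {hP : H.starProjection ∘L H.starProjection = H.starProjection} {f : C(X,ℂ)}
    (hf : InvH π H f) : f ∈ CCc π H.starProjection hP := by
  rw [mem_CCc]
  have : Hank π H.starProjection f = 0 := by
    ext v
    have h1 : π f (H.starProjection v) ∈ H := hf _ (H.starProjection_apply_mem v)
    have h2 := Submodule.starProjection_eq_self_iff.2 h1
    simp [Hank, h2]
  rw [this]; exact isCompactOperator_zero

lemma CCc_res {π : C(X, ℂ) →ₐ[ℂ] (E →L[ℂ] E)} {H : Submodule ℂ E} [H.HasOrthogonalProjection] (hH : IsClosed (H : Set E)) {hP : H.starProjection ∘L H.starProjection = H.starProjection} {p : C(X,ℂ)}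
    (hp : InvH π H p) {w : ℂ} (hw : w ∉ range p) (hfin : FiniteDimensional ℂ (VV π H p w)) : resC p w ∈ CCc π H.starProjection hP := by
  rw [mem_CCc]
  let A : E →L[ℂ] VV π H p w := (QQ π H p w ∘L H.starProjection).codRestrict _ (fun v => QQ_VV hH hw hp (H.starProjection_apply_mem v))
  have : LocallyCompactSpace (VV π H p w) := by have := FiniteDimensional.proper ℂ (VV π H p w); infer_instance
  have hA : IsCompactOperator A := isCompactOperator_of_locallyCompactSpace_dom A
  have : Hank π H.starProjection (resC p w) = (((1 - H.starProjection) ∘L π (resC p w)) ∘L (VV π H p w).subtypeL) ∘L A := by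
    ext v
    set y := H.starProjection v with hy
    have h1 : π (resC p w) (y - QQ π H p w y) ∈ H := QQ_sub hH p w y
    have h2 := Submodule.starProjection_eq_self_iff.2 h1
    have h3 : (1 - H.starProjection) (π (resC p w) (y - QQ π H p w y)) = 0 := by
      rw [ContinuousLinearMap.sub_apply, h2]; simp
    rw [map_sub, map_sub, sub_eq_zero] at h3
    exact h3
  rw [this]
  exact hA.clm_comp (((1 - H.starProjection) ∘L π (resC p w)) ∘L (VV π H p w).subtypeL)
end rep

end

noncomputable section
open Set MvPolynomial Topology MeasureTheory

lemma J_eq (z : ℂ) {ρ : ℝ} (hρ : 0 < ρ) : ∫ θ in Ioo (-Real.pi) Real.pi, (z - Complex.polarCoord.symm (ρ, θ))⁻¹ =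
    -Complex.I * ∮ w in C(0, ρ), w⁻¹ * (z - w)⁻¹ := by
  have e1 : ∀ θ : ℝ, Complex.polarCoord.symm (ρ, θ) = circleMap 0 ρ θ := by
    intro θ
    rw [Complex.polarCoord_symm_apply, circleMap, zero_add, Complex.exp_mul_I]
    push_cast; rfl
  simp_rw [e1]
  rw [← integral_Ioc_eq_integral_Ioo, ← intervalIntegral.integral_of_le (by linarith [Real.pi_pos])]
  have hper : Function.Periodic (fun θ => (z - circleMap 0 ρ θ)⁻¹) (2 * Real.pi) := by
    intro θ; simp only [periodic_circleMap 0 ρ θ]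
  have h2 := hper.intervalIntegral_add_eq (-Real.pi) 0
  rw [show -Real.pi + 2 * Real.pi = Real.pi by ring, zero_add] at h2
  rw [h2, circleIntegral, ← intervalIntegral.integral_const_mul]
  apply intervalIntegral.integral_congr
  intro θ _
  have : circleMap 0 ρ θ ≠ 0 := circleMap_ne_center hρ.ne'
  simp only [deriv_circleMap, smul_eq_mul]
  field_simp
  rw [Complex.I_sq]; ring

lemma J_lt {z : ℂ} {ρ : ℝ} (hρ : 0 < ρ) (h : ρ < ‖z‖) : ∫ θ in Ioo (-Real.pi) Real.pi, (z - Complex.polarCoord.symm (ρ, θ))⁻¹ = 2 * Real.pi / z := by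
  rw [J_eq z hρ]
  have hd : DifferentiableOn ℂ (fun w => (z - w)⁻¹) (Metric.closedBall 0 ρ) := by
    intro w hw
    have : z - w ≠ 0 := by
      rw [sub_ne_zero]; rintro rfl; simp at hw; linarith
    exact ((differentiableAt_const z).sub differentiableAt_id).inv this |>.differentiableWithinAt
  have h1 := (hd.diffContOnCl_ball (subset_refl _)).circleIntegral_sub_inv_smul (w := 0) (by simpa using hρ)
  simp only [sub_zero, smul_eq_mul] at h1
  rw [h1, div_eq_mul_inv]
  linear_combination (-2 * Real.pi * z⁻¹) * Complex.I_sq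

lemma J_gt {z : ℂ} {ρ : ℝ} (hρ : 0 < ρ) (h : ‖z‖ < ρ) : ∫ θ in Ioo (-Real.pi) Real.pi, (z - Complex.polarCoord.symm (ρ, θ))⁻¹ = 0 := by
  rw [J_eq z hρ, mul_eq_zero]; right
  by_cases hz : z = 0
  · have := circleIntegral.integral_sub_zpow_of_ne (n := -2) (by norm_num) 0 0 ρ
    have h3 : ∮ w in C(0, ρ), w⁻¹ * (z - w)⁻¹ = ∮ w in C(0, ρ), (-1:ℂ) • (w - 0) ^ (-2:ℤ) := by
      apply circleIntegral.integral_congr hρ.le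
      intro w hw
      have : w ≠ 0 := by rintro rfl; simp at hw; linarith
      simp only [hz, zero_sub, sub_zero, smul_eq_mul]
      rw [zpow_neg]
      field_simp
    rw [h3, circleIntegral.integral_smul, this, smul_zero]
  · have h1 := circleIntegral.integral_sub_inv_of_mem_ball (c := 0) (w := z) (R := ρ) (by simpa using h)
    have h2 := circleIntegral.integral_sub_inv_of_mem_ball (c := 0) (w := 0) (R := ρ) (by simpa using hρ)
    have h3 : ∮ w in C(0, ρ), w⁻¹ * (z - w)⁻¹ = ∮ w in C(0, ρ), z⁻¹ • ((w - 0)⁻¹ - (w - z)⁻¹) := by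
      apply circleIntegral.integral_congr hρ.le
      intro w hw
      have h4 : w ≠ 0 := by rintro rfl; simp at hw; linarith
      have hwn : ‖w‖ = ρ := by simpa using hw
      have h5 : w - z ≠ 0 := by rw [sub_ne_zero]; rintro rfl; linarith
      have h6 : z - w ≠ 0 := by rw [← neg_sub]; exact neg_ne_zero.2 h5
      simp only [smul_eq_mul, sub_zero]
      field_simp
      ring
    rw [h3, circleIntegral.integral_smul, circleIntegral.integral_sub, h1, h2, sub_self, smul_zero]
    · apply ContinuousOn.circleIntegrable hρ.le
      intro w hw
      have h4 : w - 0 ≠ 0 := by rw [sub_zero]; rintro rfl; simp at hw; linarith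
      exact ((continuousAt_id.sub continuousAt_const).inv₀ h4).continuousWithinAt
    · apply ContinuousOn.circleIntegrable hρ.le
      intro w hw
      have hwn : ‖w‖ = ρ := by simpa using hw
      have h4 : w - z ≠ 0 := by rw [sub_ne_zero]; rintro rfl; linarith
      exact ((continuousAt_id.sub continuousAt_const).inv₀ h4).continuousWithinAt

lemma inv_int_ball (R : ℝ) : IntegrableOn (fun w : ℂ => w⁻¹) (Metric.ball 0 R) := by
  refine integrableOn_ball_of_norm_le_rpow (C := 1) (α := 1) (by simp) (by simp) ?_ ?_
  · filter_upwards with w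
    rw [one_mul, Real.rpow_neg_one, norm_inv]
  · exact measurable_inv.aestronglyMeasurable

lemma inv_int (z ζ : ℂ) (r : ℝ) : IntegrableOn (fun w : ℂ => (z - w)⁻¹) (Metric.closedBall ζ r) := by
  have h1 := (inv_int_ball (‖z - ζ‖ + r + 1)).integrable_indicator measurableSet_ball |>.comp_sub_left z
  rw [← integrable_indicator_iff measurableSet_closedBall]
  refine h1.mono ?_ ?_
  · refine (Measurable.indicator ?_ measurableSet_closedBall).aestronglyMeasurable
    fun_prop
  · filter_upwards with w
    by_cases hw : w ∈ Metric.closedBall ζ r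
    · rw [indicator_of_mem hw, indicator_of_mem]
      rw [mem_ball_zero_iff]
      rw [Metric.mem_closedBall, dist_eq_norm] at hw
      have : z - w = (z - ζ) - (w - ζ) := by ring
      rw [this]
      refine (norm_sub_le _ _).trans_lt ?_
      linarith
    · rw [indicator_of_notMem hw]; simp

lemma cauchy_disc (z : ℂ) {r : ℝ} (hr : 0 < r) : ∫ w in Metric.closedBall (0:ℂ) r, (z - w)⁻¹ = Real.pi * (min r ‖z‖) ^ 2 / z := by
  set f : ℂ → ℂ := indicator (Metric.closedBall 0 r) (fun w => (z - w)⁻¹) with hf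
  have hfi : Integrable f := (inv_int z 0 r).integrable_indicator measurableSet_closedBall
  have hfm : Measurable f := by
    refine Measurable.indicator ?_ measurableSet_closedBall
    fun_prop
  rw [← integral_indicator measurableSet_closedBall, ← hf, ← Complex.integral_comp_polarCoord_symm]
  have hIntg : IntegrableOn (fun p : ℝ × ℝ => p.1 • f (Complex.polarCoord.symm p)) polarCoord.target := by
    refine ⟨?_, ?_⟩
    · refine Measurable.aestronglyMeasurable ?_
      refine measurable_fst.smul (hfm.comp ?_)
      have : (Complex.polarCoord.symm : ℝ × ℝ → ℂ) = fun p => p.1 * (Real.cos p.2 + Real.sin p.2 * Complex.I) := by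
        funext p; exact Complex.polarCoord_symm_apply p
      rw [this]
      fun_prop
    · have := hfi.2
      rw [hasFiniteIntegral_iff_enorm, ← Complex.lintegral_comp_polarCoord_symm] at this
      rw [hasFiniteIntegral_iff_enorm]
      refine lt_of_le_of_lt (le_of_eq ?_) this
      apply setLIntegral_congr_fun polarCoord.open_target.measurableSet
      rintro ⟨a, b⟩ ⟨h1, h2⟩
      have h1 : 0 < a := h1
      simp only [enorm_smul, smul_eq_mul, Real.enorm_of_nonneg h1.le]
  rw [show polarCoord.target = Ioi (0:ℝ) ×ˢ Ioo (-Real.pi) Real.pi from rfl] at hIntg ⊢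
  rw [Measure.volume_eq_prod] at *
  rw [setIntegral_prod _ hIntg]
  have hae : ∀ᵐ ρ : ℝ, ρ ≠ ‖z‖ := by
    rw [ae_iff]; simp
  have e1 : ∫ x in Ioi (0:ℝ), ∫ y in Ioo (-Real.pi) Real.pi, (x, y).1 • f (Complex.polarCoord.symm (x, y)) =
      ∫ x in Ioi (0:ℝ), indicator (Ioc 0 (min r ‖z‖)) (fun x => (x:ℂ) * (2 * Real.pi / z)) x := by
    apply setIntegral_congr_ae measurableSet_Ioi
    filter_upwards [hae] with x hx hx0
    have hx0 : 0 < x := hx0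
    have hmem : ∀ y, Complex.polarCoord.symm (x, y) ∈ Metric.closedBall (0:ℂ) r ↔ x ≤ r := by
      intro y
      rw [mem_closedBall_zero_iff, Complex.norm_polarCoord_symm, abs_of_pos hx0]
    by_cases hxr : x ≤ r
    · have e2 : ∀ y, f (Complex.polarCoord.symm (x, y)) = (z - Complex.polarCoord.symm (x, y))⁻¹ := by
        intro y; rw [hf, indicator_of_mem ((hmem y).2 hxr)]
      simp only [e2]
      rw [integral_smul]
      rcases lt_or_gt_of_ne hx with h | h
      · rw [J_lt hx0 h, indicator_of_mem (show x ∈ Ioc 0 (min r ‖z‖) from ⟨hx0, le_min hxr h.le⟩)]; simp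
      · rw [J_gt hx0 h, indicator_of_notMem]
        · simp
        · rintro ⟨_, h2⟩; exact absurd (h2.trans (min_le_right _ _)) (not_le.2 h)
    · have e2 : ∀ y, f (Complex.polarCoord.symm (x, y)) = 0 := by
        intro y; rw [hf, indicator_of_notMem (fun h => hxr ((hmem y).1 h))]
      simp only [e2]
      rw [indicator_of_notMem]
      · simp
      · rintro ⟨_, h2⟩; exact hxr (h2.trans (min_le_left _ _))
  rw [e1, setIntegral_indicator measurableSet_Ioc, inter_eq_self_of_subset_right (fun x hx => hx.1)]
  rw [← intervalIntegral.integral_of_le (by positivity), intervalIntegral.integral_mul_const]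
  have : ∫ x in (0:ℝ)..(min r ‖z‖), (x:ℂ) = ((min r ‖z‖)^2 / 2 : ℝ) := by
    rw [intervalIntegral.integral_ofReal, integral_id]; simp
  rw [this]
  push_cast
  ring

lemma cauchy_disc' (z ζ : ℂ) {r : ℝ} (hr : 0 < r) : (z - ζ) * ∫ w in Metric.closedBall ζ r, (z - w)⁻¹ = Real.pi * (min r ‖z - ζ‖) ^ 2 := by
  have h := cauchy_disc (z - ζ) hr
  have : ∫ w in Metric.closedBall ζ r, (z - w)⁻¹ = ∫ w in Metric.closedBall (0:ℂ) r, (z - ζ - w)⁻¹ := by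
    rw [← integral_indicator measurableSet_closedBall, ← integral_indicator measurableSet_closedBall, ← integral_add_right_eq_self _ ζ]
    congr 1
    ext w
    by_cases hw : w ∈ Metric.closedBall (0:ℂ) r
    · rw [indicator_of_mem hw, indicator_of_mem]
      · congr 1; ring
      · simpa [dist_eq_norm] using hw
    · rw [indicator_of_notMem hw, indicator_of_notMem]
      simpa [dist_eq_norm] using hw
  rw [this, h]
  by_cases hz : z - ζ = 0
  · rw [hz]; simp [hr.le]
  · field_simp

end

noncomputable section
open Set MvPolynomial Topology MeasureTheory

lemma small_int (ζ : ℂ) (r M : ℝ) {ε : ℝ} (hε : 0 < ε) : ∃ δ : ENNReal, 0 < δ ∧ ∀ c : ℂ, ‖c‖ ≤ M → ∀ A ⊆ Metric.closedBall ζ r, MeasurableSet A → volume A < δ →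
    ‖∫ w in A, (c - w)⁻¹‖ ≤ ε := by
  set R := M + ‖ζ‖ + r + 1 with hR
  set h0 : ℂ → ℂ := indicator (Metric.ball 0 R) (fun w => w⁻¹) with hh0
  have hi : Integrable h0 := (inv_int_ball R).integrable_indicator measurableSet_ball
  have hfin : ∫⁻ w, ‖h0 w‖ₑ ≠ ⊤ := hi.2.ne
  obtain ⟨δ, hδ, h⟩ := exists_pos_setLIntegral_lt_of_measure_lt hfin (ε := ENNReal.ofReal ε) (by simpa using hε)
  refine ⟨δ, hδ, fun c hc A hA hAm hAδ => ?_⟩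
  have hmp := Measure.measurePreserving_sub_left (volume : Measure ℂ) c
  set A' := (fun w => c - w) ⁻¹' A with hA'
  have hA'v : volume A' = volume A := hmp.measure_preimage hAm.nullMeasurableSet
  have h1 := h A' (by rw [hA'v]; exact hAδ)
  have h2 : ∫⁻ w in A, ‖(c - w)⁻¹‖ₑ = ∫⁻ v in A', ‖h0 v‖ₑ := by
    have h3 := hmp.setLIntegral_comp_preimage_emb (MeasurableEquiv.subLeft c).measurableEmbedding (fun w => ‖(c - w)⁻¹‖ₑ) A
    rw [← h3]
    apply setLIntegral_congr_fun (hmp.measurable hAm)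
    intro v hv
    have hv : c - v ∈ A := hv
    have h4 := hA hv
    rw [Metric.mem_closedBall, dist_eq_norm] at h4
    have h5 : v ∈ Metric.ball (0:ℂ) R := by
      rw [mem_ball_zero_iff]
      have : v = c - ζ - (c - v - ζ) := by ring
      rw [this]
      have := norm_sub_le (c - ζ) (c - v - ζ)
      have := norm_sub_le c ζ
      linarith
    simp only [hh0, indicator_of_mem h5, sub_sub_cancel]
  have h6 : ‖∫ w in A, (c - w)⁻¹‖ₑ ≤ ENNReal.ofReal ε :=
    (enorm_integral_le_lintegral_enorm _).trans (by rw [h2]; exact h1.le)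
  rwa [← ofReal_norm_eq_enorm, ENNReal.ofReal_le_ofReal_iff hε.le] at h6

lemma resC_contAt {Y : Type} [TopologicalSpace Y] [CompactSpace Y] {p : C(Y,ℂ)} {w : ℂ} (hw : w ∉ range p) : ContinuousAt (resC p) w := by
  obtain ⟨x, hx⟩ := resC_unit hw
  have h1 : ContinuousAt Ring.inverse (p - algebraMap ℂ C(Y,ℂ) w) := by
    rw [← hx]; exact NormedRing.inverse_continuousAt x
  have h2 : ContinuousAt (fun w => p - algebraMap ℂ C(Y,ℂ) w) w := by
    simp only [Algebra.algebraMap_eq_smul_one]; fun_prop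
  exact ContinuousAt.comp (g := Ring.inverse) (f := (fun w => p - algebraMap ℂ C(Y,ℂ) w)) h1 h2

lemma bump {Y : Type} [TopologicalSpace Y] [CompactSpace Y] (B : Subalgebra ℂ C(Y,ℂ)) (hB : IsClosed (B : Set C(Y,ℂ))) {p : C(Y,ℂ)} (hp : p ∈ B)
    {ζ : ℂ} {r : ℝ} (hr : 0 < r) (hvol : volume (Metric.closedBall ζ r ∩ range p) = 0)
    (hres : ∀ w ∈ Metric.closedBall ζ r, w ∉ range p → resC p w ∈ B) :
    ∃ b ∈ B, ∀ y, b y = ((r^2 - (min r ‖p y - ζ‖)^2 : ℝ) : ℂ) := by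
  set b : C(Y,ℂ) := ⟨fun y => ((r^2 - (min r ‖p y - ζ‖)^2 : ℝ) : ℂ), by fun_prop⟩ with hb
  refine ⟨b, ?_, fun y => rfl⟩
  change b ∈ (B : Set C(Y,ℂ))
  rw [← hB.closure_eq, Metric.mem_closure_iff]
  intro ε hε
  set M := ‖p‖ + ‖ζ‖ + 1 with hM
  have hM0 : 0 < M := by positivity
  obtain ⟨δ, hδ, hsm⟩ := small_int ζ r ‖p‖ (ε := ε / (2 * M)) (by positivity)
  set S : ℕ → Set ℂ := fun n => Metric.closedBall ζ r ∩ ⋂ y, {w | 1 / ((n:ℝ) + 1) ≤ ‖p y - w‖} with hS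
  have hScl : ∀ n, IsClosed (⋂ y, {w | 1 / ((n:ℝ) + 1) ≤ ‖p y - w‖}) := fun n => isClosed_iInter fun y => isClosed_le continuous_const (by fun_prop)
  have hSc : ∀ n, IsCompact (S n) := fun n => (isCompact_closedBall ζ r).inter_right (hScl n)
  have hSr : ∀ n w, w ∈ S n → w ∉ range p := by
    rintro n w ⟨_, hw⟩ ⟨y, rfl⟩
    have := mem_iInter.1 hw y
    simp only [mem_ofPred_eq, sub_self, norm_zero] at this
    have h2 : 0 < 1 / ((n:ℝ) + 1) := by positivity
    linarith
  set A : ℕ → Set ℂ := fun n => Metric.closedBall ζ r \ S n with hA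
  have hAm : ∀ n, MeasurableSet (A n) := fun n => MeasurableSet.diff measurableSet_closedBall (hSc n).measurableSet
  have hAanti : Antitone A := by
    intro n m hnm w hw
    refine ⟨hw.1, fun h => hw.2 ⟨h.1, ?_⟩⟩
    rw [mem_iInter]; intro y
    have : 1 / ((n:ℝ) + 1) ≤ ‖p y - w‖ := mem_iInter.1 h.2 y
    change _ ≤ ‖p y - w‖
    refine le_trans ?_ this
    gcongr
  have hlim : Filter.Tendsto (fun n => volume (A n)) Filter.atTop (𝓝 0) := by
    have h1 := tendsto_measure_iInter_atTop (μ := volume) (s := A) (fun n => (hAm n).nullMeasurableSet) hAanti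
      ⟨0, ((measure_mono sdiff_subset).trans_lt (measure_closedBall_lt_top (x := ζ) (r := r))).ne⟩
    have h2 : volume (⋂ n, A n) = 0 := by
      refine measure_mono_null ?_ hvol
      intro w hw
      have hw0 := mem_iInter.1 hw
      refine ⟨(hw0 0).1, ?_⟩
      by_contra hwr
      obtain ⟨d, hd, h⟩ := dist_range hwr
      obtain ⟨n, hn⟩ := exists_nat_one_div_lt hd
      refine (hw0 n).2 ⟨(hw0 n).1, mem_iInter.2 fun y => ?_⟩
      exact hn.le.trans (h y)
    rwa [h2] at h1
  obtain ⟨n, hn⟩ := ((tendsto_order.1 hlim).2 δ hδ).exists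
  have : CompleteSpace (Subalgebra.toSubmodule B) := IsClosed.completeSpace_coe (s := (B : Set C(Y,ℂ))) (hs := hB)
  classical
  let f : ℂ → Subalgebra.toSubmodule B := fun w => if h : w ∈ S n then ⟨resC p w, hres w h.1 (hSr n w h)⟩ else 0
  have hfv : ∀ w ∈ S n, (f w : C(Y,ℂ)) = resC p w := by
    intro w hw; simp only [f, dif_pos hw]
  have hfc : ContinuousOn f (S n) := by
    rw [IsEmbedding.subtypeVal.continuousOn_iff]
    refine ContinuousOn.congr (f := resC p) ?_ hfv
    intro w hw
    exact (resC_contAt (hSr n w hw)).continuousWithinAt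
  have hfi : IntegrableOn f (S n) := hfc.integrableOn_compact (hSc n)
  set g := ∫ w in S n, f w with hg
  have hgB : (g : C(Y,ℂ)) ∈ B := g.2
  have hge : ∀ y, (g : C(Y,ℂ)) y = ∫ w in S n, (p y - w)⁻¹ := by
    intro y
    have h1 := ContinuousLinearMap.integral_comp_comm ((ContinuousMap.evalCLM ℂ y) ∘L (Subalgebra.toSubmodule B).subtypeL) hfi
    refine Eq.trans h1.symm ?_
    apply setIntegral_congr_fun (hSc n).measurableSet
    intro w hw
    change (f w : C(Y,ℂ)) y = _
    rw [hfv w hw, resC_apply (hSr n w hw)]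
  refine ⟨algebraMap ℂ _ ((r:ℂ)^2) - ((Real.pi:ℂ)⁻¹) • ((p - algebraMap ℂ _ ζ) * g), ?_, ?_⟩
  · exact B.sub_mem (B.algebraMap_mem _) (B.smul_mem (B.mul_mem (B.sub_mem hp (B.algebraMap_mem _)) hgB) _)
  · rw [dist_eq_norm]
    have hπ := Real.pi_pos
    have hπ3 := Real.pi_gt_three
    refine lt_of_le_of_lt ((ContinuousMap.norm_le _ (C := ε / 2) (by positivity)).2 ?_) (by linarith)
    intro y
    have hpy := p.norm_coe_le_norm y
    have h1 := cauchy_disc' (p y) ζ hr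
    have h2 : ∫ w in Metric.closedBall ζ r, (p y - w)⁻¹ = (∫ w in S n, (p y - w)⁻¹) + ∫ w in A n, (p y - w)⁻¹ := by
      rw [← setIntegral_union disjoint_sdiff_right (hAm n) ((inv_int (p y) ζ r).mono_set inter_subset_left) ((inv_int (p y) ζ r).mono_set sdiff_subset),
        union_sdiff_cancel inter_subset_left]
    rw [h2] at h1
    have h3 := hsm (p y) hpy (A n) sdiff_subset (hAm n) hn
    have e : (b - (algebraMap ℂ _ ((r:ℂ)^2) - ((Real.pi:ℂ)⁻¹) • ((p - algebraMap ℂ _ ζ) * g))) y = -((Real.pi:ℂ)⁻¹ * ((p y - ζ) * ∫ w in A n, (p y - w)⁻¹)) := by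
      simp only [ContinuousMap.sub_apply, ContinuousMap.smul_apply, ContinuousMap.mul_apply, _root_.algebraMap_apply, smul_eq_mul, ContinuousMap.one_apply, mul_one, hge, hb,
        ContinuousMap.coe_mk]
      have hπc : (Real.pi:ℂ) ≠ 0 := by exact_mod_cast hπ.ne'
      have h4 : (((min r ‖p y - ζ‖)^2 : ℝ) : ℂ) = (Real.pi:ℂ)⁻¹ * ((p y - ζ) * ((∫ w in S n, (p y - w)⁻¹) + ∫ w in A n, (p y - w)⁻¹)) := by
        rw [h1]; push_cast; field_simp
      rw [Complex.ofReal_sub, h4]; push_cast; ring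
    rw [e, norm_neg, norm_mul, norm_mul, norm_inv, Complex.norm_real, Real.norm_of_nonneg hπ.le]
    have h5 : ‖p y - ζ‖ ≤ M := by
      refine (norm_sub_le _ _).trans ?_; linarith
    calc Real.pi⁻¹ * (‖p y - ζ‖ * ‖∫ w in A n, (p y - w)⁻¹‖) ≤ 1 * (M * (ε / (2 * M))) := by
          gcongr
          exact inv_le_one_of_one_le₀ (by linarith)
      _ = ε / 2 := by field_simp

end

noncomputable section
open Set MvPolynomial Topology MeasureTheory

lemma mem_polyHull_iff {N : ℕ} {X : Set (Fin N → ℂ)} (hX : IsCompact X) {z : Fin N → ℂ} :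
    z ∈ polyHull X ↔ ∀ (p : MvPolynomial (Fin N) ℂ) (C : ℝ), (∀ x ∈ X, ‖eval x p‖ ≤ C) → ‖eval z p‖ ≤ C := by
  have hbdd : ∀ p : MvPolynomial (Fin N) ℂ, ∃ M : ℝ, 0 ≤ M ∧ ∀ x ∈ X, ‖eval x p‖ ≤ M := by
    intro p
    obtain ⟨M, hM⟩ := hX.exists_bound_of_continuousOn (f := fun x => eval x p) (by
      exact (MvPolynomial.continuous_eval p).continuousOn)
    exact ⟨max M 0, le_max_right _ _, fun x hx => (hM x hx).trans (le_max_left _ _)⟩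
  constructor
  · intro h p C hC
    rcases X.eq_empty_or_nonempty with rfl | ⟨x, hx⟩
    · have := h 1
      simp at this
      norm_num at this
    · have hC0 : 0 ≤ C := (norm_nonneg _).trans (hC x hx)
      refine (h p).trans ?_
      refine Real.iSup_le (fun x => Real.iSup_le (fun hx => hC x hx) hC0) hC0
  · intro h p
    apply h
    intro x hx
    obtain ⟨M, hM0, hM⟩ := hbdd p
    refine le_ciSup_of_le ⟨M, ?_⟩ x ?_
    · rintro _ ⟨y, rfl⟩
      exact Real.iSup_le (fun hy => hM y hy) hM0
    · rw [ciSup_pos hx]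

lemma pc_of {N : ℕ} {X : Set (Fin N → ℂ)} (hX : IsCompact X) (h : ∀ z, z ∈ polyHull X → z ∈ X) : IsPolynomiallyConvex X := by
  apply Subset.antisymm h
  intro z hz
  rw [mem_polyHull_iff hX]
  intro p C hC
  exact hC z hz

lemma sep_poly {N : ℕ} {X : Set (Fin N → ℂ)} (hX : IsCompact X) {z : Fin N → ℂ} (hz : z ∉ polyHull X) {ε : ℝ} (hε : 0 < ε) :
    ∃ p : MvPolynomial (Fin N) ℂ, eval z p = 1 ∧ ∀ x ∈ X, ‖eval x p‖ ≤ ε := by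
  rw [mem_polyHull_iff hX] at hz
  push Not at hz
  obtain ⟨p, C, hC, hlt⟩ := hz
  rcases X.eq_empty_or_nonempty with rfl | ⟨x0, hx0⟩
  · exact ⟨1, by simp, by simp⟩
  have hC0 : 0 ≤ C := (norm_nonneg _).trans (hC x0 hx0)
  have hp0 : 0 < ‖eval z p‖ := hC0.trans_lt hlt
  have hp1 : eval z p ≠ 0 := norm_pos_iff.1 hp0
  obtain ⟨n, hn⟩ := exists_pow_lt_of_lt_one hε ((div_lt_one hp0).2 hlt)
  refine ⟨(MvPolynomial.C (eval z p)⁻¹ * p) ^ n, by simp [hp1], fun x hx => ?_⟩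
  refine le_trans ?_ hn.le
  rw [map_pow, map_mul, eval_C, norm_pow, norm_mul, norm_inv, inv_mul_eq_div]
  have := hC x hx
  gcongr

lemma pc_sep {N : ℕ} {X : Set (Fin N → ℂ)} (hX : IsCompact X) (hpc : IsPolynomiallyConvex X) {z : Fin N → ℂ} (hz : z ∉ X) {ε : ℝ} (hε : 0 < ε) :
    ∃ p : MvPolynomial (Fin N) ℂ, eval z p = 1 ∧ ∀ x ∈ X, ‖eval x p‖ ≤ ε :=
  sep_poly hX (by rw [show polyHull X = X from hpc]; exact hz) hε

lemma vol_lip_image {h : ℝ → ℂ} {S : Set ℝ} {L : NNReal} (hL : LipschitzOnWith L h S) : volume (h '' S) = 0 := by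
  have h1 : Measure.hausdorffMeasure 2 (h '' S) = 0 := by
    have h2 := hL.hausdorffMeasure_image_le (d := 2) (by norm_num)
    have h3 : (Measure.hausdorffMeasure 2 : Measure ℝ) S = 0 := by
      have : dimH S < ((2:NNReal):ENNReal) := by
        refine (dimH_mono (subset_univ S)).trans_lt ?_
        rw [Real.dimH_univ]; norm_num
      exact hausdorffMeasure_of_dimH_lt (d := 2) this
    rw [h3, mul_zero] at h2
    exact le_antisymm h2 (zero_le)
  have h4 : (volume : Measure ℂ) ≪ Measure.hausdorffMeasure 2 := by
    have : (Measure.hausdorffMeasure 2 : Measure ℂ).IsAddHaarMeasure := by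
      have := isAddHaarMeasure_hausdorffMeasure (E := ℂ)
      simpa using this
    exact Measure.absolutelyContinuous_isAddHaarMeasure _ _
  exact h4 h1

/-- bounded Lipschitz functions -/
def BL (f : ℝ → ℂ) : Prop := ∃ M : ℝ, 0 ≤ M ∧ (∀ t, ‖f t‖ ≤ M) ∧ ∀ s t, ‖f s - f t‖ ≤ M * |s - t|

lemma BL.const (c : ℂ) : BL fun _ => c := ⟨‖c‖, norm_nonneg _, fun _ => le_rfl, fun s t => by simp; positivity⟩

lemma BL.add {f g : ℝ → ℂ} (hf : BL f) (hg : BL g) : BL fun t => f t + g t := by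
  obtain ⟨M, hM, h1, h2⟩ := hf
  obtain ⟨M', hM', h1', h2'⟩ := hg
  refine ⟨M + M', by positivity, fun t => (norm_add_le _ _).trans (add_le_add (h1 t) (h1' t)), fun s t => ?_⟩
  rw [show f s + g s - (f t + g t) = (f s - f t) + (g s - g t) by ring, add_mul]
  exact (norm_add_le _ _).trans (add_le_add (h2 s t) (h2' s t))

lemma BL.mul {f g : ℝ → ℂ} (hf : BL f) (hg : BL g) : BL fun t => f t * g t := by
  obtain ⟨M, hM, h1, h2⟩ := hf
  obtain ⟨M', hM', h1', h2'⟩ := hg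
  refine ⟨2 * (M * M') , by positivity, fun t => ?_, fun s t => ?_⟩
  · rw [norm_mul]
    have := h1 t
    have := h1' t
    have : ‖f t‖ * ‖g t‖ ≤ M * M' := by gcongr
    have : 0 ≤ M * M' := by positivity
    linarith
  · rw [show f s * g s - f t * g t = (f s - f t) * g s + f t * (g s - g t) by ring]
    refine (norm_add_le _ _).trans ?_
    rw [norm_mul, norm_mul]
    calc _ ≤ (M * |s - t|) * M' + M * (M' * |s - t|) := by
          gcongr
          · exact h2 s t
          · exact h1' s
          · exact h1 t
          · exact h2' s t
      _ = _ := by ring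

lemma BL.lip {f : ℝ → ℂ} (hf : BL f) : ∃ L : NNReal, LipschitzWith L f := by
  obtain ⟨M, hM, h1, h2⟩ := hf
  refine ⟨⟨M, hM⟩, LipschitzWith.of_dist_le_mul fun s t => ?_⟩
  rw [dist_eq_norm, Real.dist_eq]; exact h2 s t

lemma BL.poly {N : ℕ} {γ : ℝ → Fin N → ℂ} (h : ∀ i, BL fun t => γ t i) (p : MvPolynomial (Fin N) ℂ) : BL fun t => eval (γ t) p := by
  induction p using MvPolynomial.induction_on with
  | C a => simpa using BL.const a
  | add p q hp hq => simpa using hp.add hq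
  | mul_X p i hp => simpa using hp.mul (h i)

lemma avoid_vol {f g : ℝ → ℂ} (hf : BL f) (hg : BL g) : volume {a : ℂ | ∃ t, g t ≠ 0 ∧ f t + a * g t = 0} = 0 := by
  have hsub : {a : ℂ | ∃ t, g t ≠ 0 ∧ f t + a * g t = 0} ⊆ ⋃ n : ℕ, (fun t => - f t / g t) '' {t | 1 / ((n:ℝ) + 1) ≤ ‖g t‖} := by
    rintro a ⟨t, ht, h⟩
    obtain ⟨n, hn⟩ := exists_nat_one_div_lt (norm_pos_iff.2 ht)
    refine mem_iUnion.2 ⟨n, t, hn.le, ?_⟩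
    simp only
    rw [div_eq_iff ht]; linear_combination -h
  refine measure_mono_null hsub (measure_iUnion_null fun n => ?_)
  obtain ⟨M, hM, h1, h2⟩ := hf
  obtain ⟨M', hM', h1', h2'⟩ := hg
  have hK : 0 ≤ (M * M' + M * M') * ((n:ℝ) + 1)^2 := by positivity
  refine vol_lip_image (L := Real.toNNReal ((M * M' + M * M') * ((n:ℝ) + 1)^2)) (LipschitzOnWith.of_dist_le_mul fun s hs t ht => ?_)
  rw [dist_eq_norm, Real.dist_eq]
  have hs : 1 / ((n:ℝ) + 1) ≤ ‖g s‖ := hs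
  have ht : 1 / ((n:ℝ) + 1) ≤ ‖g t‖ := ht
  have hn : (0:ℝ) < (n:ℝ) + 1 := by positivity
  have hs0 : 0 < ‖g s‖ := lt_of_lt_of_le (by positivity) hs
  have ht0 : 0 < ‖g t‖ := lt_of_lt_of_le (by positivity) ht
  have e : - f s / g s - - f t / g t = ((f t - f s) * g s + f s * (g s - g t)) / (g s * g t) := by
    have h3 := norm_pos_iff.1 hs0
    have h4 := norm_pos_iff.1 ht0
    field_simp; ring
  rw [e, norm_div, norm_mul, div_le_iff₀ (by positivity)]
  have e2 : 1 ≤ ((n:ℝ)+1)^2 * (‖g s‖ * ‖g t‖) := by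
    calc (1:ℝ) = ((n:ℝ)+1)^2 * (1 / ((n:ℝ) + 1) * (1 / ((n:ℝ) + 1))) := by field_simp
      _ ≤ _ := by gcongr
  have e3 : ‖(f t - f s) * g s + f s * (g s - g t)‖ ≤ (M * M' + M * M') * |s - t| := by
    refine (norm_add_le _ _).trans ?_
    rw [norm_mul, norm_mul]
    calc _ ≤ (M * |t - s|) * M' + M * (M' * |s - t|) := by
          gcongr
          · exact h2 t s
          · exact h1' s
          · exact h1 s
          · exact h2' s t
      _ = _ := by rw [abs_sub_comm t s]; ring
  calc _ ≤ ((M * M' + M * M') * |s - t|) * 1 := by rw [mul_one]; exact e3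
    _ ≤ ((M * M' + M * M') * |s - t|) * (((n:ℝ)+1)^2 * (‖g s‖ * ‖g t‖)) := by gcongr
    _ = _ := by rw [Real.coe_toNNReal _ hK]; ring

lemma avoid {f g : ℝ → ℂ} (hf : BL f) (hg : BL g) {ε : ℝ} (hε : 0 < ε) : ∃ a : ℂ, ‖a‖ < ε ∧ ∀ t, g t ≠ 0 → f t + a * g t ≠ 0 := by
  by_contra! h
  have hsub : Metric.ball (0:ℂ) ε ⊆ {a : ℂ | ∃ t, g t ≠ 0 ∧ f t + a * g t = 0} := by
    intro a ha
    exact h a (by simpa using ha)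
  have := measure_mono_null hsub (avoid_vol hf hg)
  exact (Metric.measure_ball_pos volume (0:ℂ) hε).ne' this

lemma choose_q {N : ℕ} {K : Set (Fin N → ℂ)} (hK : IsCompact K) {γ : ℝ → Fin N → ℂ} (hγ : ∀ i, BL fun t => γ t i) {x : Fin N → ℂ} (hx : ∀ t, γ t ≠ x)
    {p0 : MvPolynomial (Fin N) ℂ} (hp0 : eval x p0 = 0) {ε : ℝ} (hε : 0 < ε) :
    ∃ q : MvPolynomial (Fin N) ℂ, eval x q = 0 ∧ (∀ y ∈ K, ‖eval y q - eval y p0‖ ≤ ε) ∧ ∀ t, eval (γ t) q ≠ 0 := by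
  obtain ⟨M, hM⟩ : ∃ M : ℝ, ∀ y ∈ K, ∀ i, ‖y i - x i‖ ≤ M := by
    obtain ⟨M, hM⟩ := hK.exists_bound_of_continuousOn (f := fun y => y - x) (by fun_prop)
    exact ⟨M, fun y hy i => (norm_le_pi_norm (y - x) i).trans (hM y hy)⟩
  have key : ∀ k : ℕ, k ≤ N → ∃ q : MvPolynomial (Fin N) ℂ, eval x q = 0 ∧ (∀ y ∈ K, ‖eval y q - eval y p0‖ ≤ ε * k / (N + 1)) ∧
      ∀ t, (∃ i : Fin N, (i:ℕ) < k ∧ γ t i ≠ x i) → eval (γ t) q ≠ 0 := by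
    intro k
    induction k with
    | zero => intro _; exact ⟨p0, hp0, by simp, by simp⟩
    | succ k ih =>
      intro hk
      obtain ⟨q, hq1, hq2, hq3⟩ := ih (by omega)
      set i : Fin N := ⟨k, by omega⟩ with hi
      have hδ : 0 < ε / ((N + 1) * (|M| + 1)) := by positivity
      have hg : BL fun t => γ t i - x i := by
        simpa [sub_eq_add_neg] using (hγ i).add (BL.const (- x i))
      obtain ⟨a, ha, h⟩ := avoid (BL.poly hγ q) hg hδ
      refine ⟨q + MvPolynomial.C a * (MvPolynomial.X i - MvPolynomial.C (x i)), by simp [hq1], fun y hy => ?_, ?_⟩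
      · have e : eval y (q + MvPolynomial.C a * (MvPolynomial.X i - MvPolynomial.C (x i))) - eval y p0 = (eval y q - eval y p0) + a * (y i - x i) := by
          simp; ring
        rw [e]
        refine (norm_add_le _ _).trans ?_
        have h1 := hq2 y hy
        have h2 : ‖a * (y i - x i)‖ ≤ ε / (N + 1) := by
          rw [norm_mul]
          have h3 : ‖y i - x i‖ ≤ |M| + 1 := (hM y hy i).trans (by linarith [le_abs_self M])
          calc _ ≤ ε / ((N + 1) * (|M| + 1)) * (|M| + 1) := by gcongr
            _ = _ := by field_simp
        push_cast
        calc _ ≤ ε * k / (N + 1) + ε / (N + 1) := add_le_add h1 h2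
          _ = _ := by ring
      · rintro t ⟨j, hj, hjx⟩
        have e : eval (γ t) (q + MvPolynomial.C a * (MvPolynomial.X i - MvPolynomial.C (x i))) = eval (γ t) q + a * (γ t i - x i) := by simp
        rw [e]
        by_cases hti : γ t i - x i = 0
        · rw [hti, mul_zero, add_zero]
          refine hq3 t ⟨j, ?_, hjx⟩
          rcases Nat.lt_succ_iff_lt_or_eq.1 hj with h | h
          · exact h
          · exfalso
            have : j = i := Fin.ext h
            rw [this] at hjx
            exact hjx (sub_eq_zero.1 hti)
        · exact h t hti
  obtain ⟨q, h1, h2, h3⟩ := key N le_rfl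
  refine ⟨q, h1, fun y hy => (h2 y hy).trans ?_, fun t => h3 t ?_⟩
  · rw [div_le_iff₀ (by positivity)]
    nlinarith
  · by_contra! h
    exact hx t (funext fun i => h i i.2)

end

noncomputable section
open Set MvPolynomial Topology MeasureTheory

section SW
variable {X : Type} [TopologicalSpace X] [CompactSpace X]

def ofRealCM : C(ℝ, ℂ) := ⟨Complex.ofReal, Complex.continuous_ofReal⟩

def pullR {I : Type} [TopologicalSpace I] (T : C(X, I)) (u : C(I, ℝ)) : C(X, ℂ) := ofRealCM.comp (u.comp T)

def swAlg {I : Type} [TopologicalSpace I] (T : C(X, I)) (B : Subalgebra ℂ C(X,ℂ)) : Subalgebra ℝ C(I, ℝ) where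
  carrier := {u | pullR T u ∈ B}
  add_mem' := by
    intro u v hu hv
    have : pullR T (u + v) = pullR T u + pullR T v := by ext x; simp [pullR, ofRealCM]
    simp only [mem_ofPred_eq, this] at *
    exact add_mem hu hv
  mul_mem' := by
    intro u v hu hv
    have : pullR T (u * v) = pullR T u * pullR T v := by ext x; simp [pullR, ofRealCM]
    simp only [mem_ofPred_eq, this] at *
    exact mul_mem hu hv
  algebraMap_mem' := by
    intro c
    have : pullR T (algebraMap ℝ _ c) = algebraMap ℂ _ (c:ℂ) := by ext x; simp [pullR, ofRealCM]
    simp only [mem_ofPred_eq, this] at *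
    exact Subalgebra.algebraMap_mem _ _

lemma SW_pull {I : Type} [TopologicalSpace I] [CompactSpace I] (T : C(X, I)) (B : Subalgebra ℂ C(X,ℂ)) (hB : IsClosed (B : Set C(X,ℂ)))
    (hsep : ∀ s t : I, s ≠ t → ∃ u : C(I, ℝ), u s ≠ u t ∧ pullR T u ∈ B) (f : C(I, ℂ)) : f.comp T ∈ B := by
  have hcl : IsClosed (swAlg T B : Set C(I,ℝ)) := by
    have : Continuous (pullR T) := by
      unfold pullR
      exact (ContinuousMap.continuous_postcomp _).comp (ContinuousMap.continuous_precomp _)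
    exact hB.preimage this
  have htop : swAlg T B = ⊤ := by
    have h := ContinuousMap.subalgebra_topologicalClosure_eq_top_of_separatesPoints (swAlg T B) (by
      intro s t hst
      obtain ⟨u, hu, hu2⟩ := hsep s t hst
      exact ⟨u, ⟨u, hu2, rfl⟩, hu⟩)
    rw [← h]
    apply le_antisymm (Subalgebra.le_topologicalClosure _)
    exact Subalgebra.topologicalClosure_minimal le_rfl hcl
  have hall : ∀ u : C(I,ℝ), pullR T u ∈ B := fun u => by
    have : u ∈ swAlg T B := by rw [htop]; trivial
    exact this
  have : f.comp T = pullR T ⟨fun s => (f s).re, by fun_prop⟩ + algebraMap ℂ _ Complex.I * pullR T ⟨fun s => (f s).im, by fun_prop⟩ := by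
    ext x
    simp only [pullR, ofRealCM, ContinuousMap.comp_apply, ContinuousMap.add_apply, ContinuousMap.mul_apply, _root_.algebraMap_apply, ContinuousMap.coe_mk, ContinuousMap.one_apply, smul_eq_mul, mul_one]
    rw [mul_comm, Complex.re_add_im]
  rw [this]
  exact add_mem (hall _) (mul_mem (Subalgebra.algebraMap_mem _ _) (hall _))
end SW

/-- evaluation of polynomials as continuous functions -/
def evC {N : ℕ} (X : Set (Fin N → ℂ)) : MvPolynomial (Fin N) ℂ →ₐ[ℂ] C(X, ℂ) :=
  MvPolynomial.aeval fun i => ⟨fun x => x.1 i, (continuous_apply i).comp continuous_subtype_val⟩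

lemma evC_apply {N : ℕ} (X : Set (Fin N → ℂ)) (p : MvPolynomial (Fin N) ℂ) (x : X) : evC X p x = eval x.1 p := by
  induction p using MvPolynomial.induction_on with
  | C a => simp [evC]
  | add p q hp hq => rw [map_add, ContinuousMap.add_apply, hp, hq, map_add]
  | mul_X p i hp => rw [map_mul, ContinuousMap.mul_apply, hp, map_mul]; simp [evC]

lemma tau_exists {N : ℕ} {K : Set (Fin N → ℂ)} (hK : IsCompact K) {γ : ℝ → Fin N → ℂ} (hγ : ContinuousOn γ (Icc 0 1)) (hinj : InjOn γ (Icc 0 1)) (h0 : γ 0 ∈ K)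
    (hout : ∀ t ∈ Ioc (0:ℝ) 1, γ t ∉ K) : ∃ τ : C((K ∪ γ '' Icc 0 1 : Set (Fin N → ℂ)), Icc (0:ℝ) 1),
      ∀ x, (x.1 ∈ K ∧ τ x = 0) ∨ (x.1 ∉ K ∧ x.1 = γ (τ x)) := by
  classical
  have hex : ∀ x : (K ∪ γ '' Icc 0 1 : Set (Fin N → ℂ)), ∃ t : Icc (0:ℝ) 1, (x.1 ∈ K ∧ t = 0) ∨ (x.1 ∉ K ∧ x.1 = γ t) := by
    rintro ⟨x, hx⟩
    by_cases hxK : x ∈ K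
    · exact ⟨0, Or.inl ⟨hxK, rfl⟩⟩
    · rcases hx with h | ⟨t, ht, rfl⟩
      · exact absurd h hxK
      · exact ⟨⟨t, ht⟩, Or.inr ⟨hxK, rfl⟩⟩
  choose τ hτ using hex
  refine ⟨⟨τ, ?_⟩, hτ⟩
  rw [continuous_iff_isClosed]
  intro C hC
  have hC2 : IsCompact (γ '' (Subtype.val '' C)) := by
    apply IsCompact.image_of_continuousOn
    · exact hC.isCompact.image continuous_subtype_val
    · apply hγ.mono
      rintro _ ⟨t, _, rfl⟩
      exact t.2
  have h00 : ((0 : Icc (0:ℝ) 1) : ℝ) = 0 := rfl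
  by_cases hz : (0 : Icc (0:ℝ) 1) ∈ C
  · have : τ ⁻¹' C = Subtype.val ⁻¹' (K ∪ γ '' (Subtype.val '' C)) := by
      ext x
      simp only [mem_preimage, mem_union]
      constructor
      · intro h
        rcases hτ x with ⟨h1, h2⟩ | ⟨h1, h2⟩
        · exact Or.inl h1
        · right; rw [h2]; exact ⟨_, ⟨_, h, rfl⟩, rfl⟩
      · rintro (h | ⟨_, ⟨t, ht, rfl⟩, h⟩)
        · rcases hτ x with ⟨h1, h2⟩ | ⟨h1, h2⟩
          · rw [h2]; exact hz
          · exact absurd h h1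
        · rcases hτ x with ⟨h1, h2⟩ | ⟨h1, h2⟩
          · rw [h2]; exact hz
          · rw [h2] at h
            have := hinj t.2 (τ x).2 h
            rw [← Subtype.ext this]; exact ht
    rw [this]
    exact (hK.union hC2).isClosed.preimage continuous_subtype_val
  · have : τ ⁻¹' C = Subtype.val ⁻¹' (γ '' (Subtype.val '' C)) := by
      ext x
      simp only [mem_preimage]
      constructor
      · intro h
        rcases hτ x with ⟨h1, h2⟩ | ⟨h1, h2⟩
        · rw [h2] at h; exact absurd h hz
        · rw [h2]; exact ⟨_, ⟨_, h, rfl⟩, rfl⟩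
      · rintro ⟨_, ⟨t, ht, rfl⟩, h⟩
        rcases hτ x with ⟨h1, h2⟩ | ⟨h1, h2⟩
        · exfalso
          rw [← h] at h1
          have ht0 : t ≠ 0 := by rintro rfl; exact hz ht
          refine hout t ⟨lt_of_le_of_ne t.2.1 ?_, t.2.2⟩ h1
          intro h; exact ht0 (Subtype.ext h.symm)
        · rw [h2] at h
          have := hinj t.2 (τ x).2 h
          rw [← Subtype.ext this]; exact ht
    rw [this]
    exact hC2.isClosed.preimage continuous_subtype_val

end

noncomputable section
open Set MvPolynomial Topology MeasureTheory

lemma compactSpace_attach {N : ℕ} {K : Set (Fin N → ℂ)} (hK : IsCompact K) {γ : ℝ → Fin N → ℂ} (hγ : ContinuousOn γ (Icc 0 1)) :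
    IsCompact (K ∪ γ '' Icc 0 1 : Set (Fin N → ℂ)) := hK.union (isCompact_Icc.image_of_continuousOn hγ)

lemma coordSep {N : ℕ} {x y : Fin N → ℂ} (h : x ≠ y) : ∃ l : MvPolynomial (Fin N) ℂ, eval x l = 0 ∧ eval y l = 1 := by
  obtain ⟨i, hi⟩ := Function.ne_iff.1 h
  have : y i - x i ≠ 0 := sub_ne_zero.2 (Ne.symm hi)
  refine ⟨MvPolynomial.C (y i - x i)⁻¹ * (MvPolynomial.X i - MvPolynomial.C (x i)), by simp, by simp [this]⟩

lemma poly_bdd {N : ℕ} {K : Set (Fin N → ℂ)} (hK : IsCompact K) (p : MvPolynomial (Fin N) ℂ) : ∃ M : ℝ, 0 < M ∧ ∀ x ∈ K, ‖eval x p‖ ≤ M := by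
  obtain ⟨M, hM⟩ := hK.exists_bound_of_continuousOn (f := fun x => eval x p) (by
    exact (MvPolynomial.continuous_eval p).continuousOn)
  exact ⟨max M 1, by positivity, fun x hx => (hM x hx).trans (le_max_left _ _)⟩

lemma sep_prod {N : ℕ} {K : Set (Fin N → ℂ)} (hK : IsCompact K) (hpc : IsPolynomiallyConvex K) {x y : Fin N → ℂ} (h : x ≠ y) (hy : y ∉ K) :
    ∃ p : MvPolynomial (Fin N) ℂ, eval x p = 0 ∧ eval y p = 1 ∧ ∀ z ∈ K, ‖eval z p‖ ≤ 1/4 := by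
  obtain ⟨l, hl0, hl1⟩ := coordSep h
  obtain ⟨M, hM, hM2⟩ := poly_bdd hK l
  obtain ⟨p, hp1, hp2⟩ := pc_sep hK hpc hy (ε := 1/(4*M)) (by positivity)
  refine ⟨p * l, by simp [hl0], by simp [hl1, hp1], fun z hz => ?_⟩
  rw [map_mul, norm_mul]
  have h1 := hM2 z hz
  have h2 := hp2 z hz
  calc _ ≤ 1/(4*M) * M := by gcongr
    _ = _ := by field_simp

section M2
variable {N : ℕ} {K : Set (Fin N → ℂ)} {γ : ℝ → Fin N → ℂ} {E : Type} [NormedAddCommGroup E]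
  [InnerProductSpace ℂ E] [CompleteSpace E]

lemma invH_of {X : Type} [TopologicalSpace X] [CompactSpace X] {π : C(X, ℂ) →ₐ[ℂ] (E →L[ℂ] E)} (Φ : MvPolynomial (Fin N) ℂ →ₐ[ℂ] C(X,ℂ))
    {ξ : E} {H : Submodule ℂ E} (hHe : (H : Set E) = closure (range fun a => π (Φ a) ξ)) (b : MvPolynomial (Fin N) ℂ) : InvH π H (Φ b) := by
  intro v hv
  have hv' : v ∈ closure (range fun a => π (Φ a) ξ) := by rw [← hHe]; exact hv
  change π (Φ b) v ∈ (H : Set E)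
  rw [hHe]
  refine map_mem_closure (π (Φ b)).continuous hv' ?_
  rintro _ ⟨a, rfl⟩
  exact ⟨b * a, by simp [map_mul]⟩

lemma M2 (hK : IsCompact K) (hpc : IsPolynomiallyConvex K) (hγ : ∀ i, BL fun t => γ t i) (hcl : ∀ t, γ t ∈ γ '' Icc 0 1)
    (hinj : InjOn γ (Icc 0 1)) (h0 : γ 0 ∈ K) (hout : ∀ t ∈ Ioc (0:ℝ) 1, γ t ∉ K)
    [CompactSpace (K ∪ γ '' Icc 0 1 : Set (Fin N → ℂ))]
    {π : C((K ∪ γ '' Icc 0 1 : Set (Fin N → ℂ)), ℂ) →ₐ[ℂ] (E →L[ℂ] E)} (hπ : ∀ a, ‖π a‖ ≤ ‖a‖)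
    {ξ : E} {H : Submodule ℂ E} [H.HasOrthogonalProjection] (hHe : (H : Set E) = closure (range fun a => π (evC _ a) ξ))
    (hP : H.starProjection ∘L H.starProjection = H.starProjection)
    (τ : C((K ∪ γ '' Icc 0 1 : Set (Fin N → ℂ)), Icc (0:ℝ) 1)) (hτ : ∀ x, (x.1 ∈ K ∧ τ x = 0) ∨ (x.1 ∉ K ∧ x.1 = γ (τ x)))
    (f : C(Icc (0:ℝ) 1, ℂ)) : f.comp τ ∈ CCc π H.starProjection hP := by
  have hH : IsClosed (H : Set E) := by rw [hHe]; exact isClosed_closure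
  have hinv := invH_of (evC _) hHe
  apply SW_pull τ _ (CCc_closed hπ)
  have key : ∀ s t : Icc (0:ℝ) 1, s < t → ∃ u : C(Icc (0:ℝ) 1, ℝ), u s ≠ u t ∧ pullR τ u ∈ CCc π H.starProjection hP := by
    intro s t hst
    have hst' : (s:ℝ) < t := hst
    have htK : γ t ∉ K := hout t ⟨lt_of_le_of_lt s.2.1 hst', t.2.2⟩
    have hne : γ s ≠ γ t := fun h => hst'.ne (hinj s.2 t.2 h)
    obtain ⟨p, hp0, hp1, hpK⟩ := sep_prod hK hpc hne htK
    have hpl : BL fun t => eval (γ t) p := BL.poly hγ p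
    obtain ⟨L, hL⟩ := hpl.lip
    have hvol : volume (Metric.closedBall 1 (1/2) ∩ range (evC (K ∪ γ '' Icc 0 1) p)) = 0 := by
      refine measure_mono_null ?_ (vol_lip_image (hL.lipschitzOnWith (s := univ)))
      rintro w ⟨hw1, ⟨x, hx⟩⟩
      rw [evC_apply] at hx
      rcases x.2 with h | ⟨r, hr, h⟩
      · exfalso
        have h1 := hpK _ h
        rw [hx] at h1
        rw [mem_closedBall_iff_norm] at hw1
        have h2 : ‖(1:ℂ)‖ ≤ ‖w‖ + ‖w - 1‖ := by
          calc ‖(1:ℂ)‖ = ‖w - (w - 1)‖ := by congr 1; ring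
            _ ≤ _ := norm_sub_le _ _
        rw [norm_one] at h2
        linarith
      · refine ⟨r, trivial, ?_⟩
        simp only
        rw [h, hx]
    obtain ⟨b, hbB, hb⟩ := bump (CCc π H.starProjection hP) (CCc_closed hπ) (CCc_inv (hinv p)) (ζ := 1) (r := 1/2) (by norm_num) hvol (by
      intro w hw1 hw2
      apply CCc_res hH (hinv p) hw2
      have hw4 : 1/4 < ‖w‖ := by
        rw [mem_closedBall_iff_norm] at hw1
        have h2 : ‖(1:ℂ)‖ ≤ ‖w‖ + ‖w - 1‖ := by
          calc ‖(1:ℂ)‖ = ‖w - (w - 1)‖ := by congr 1; ring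
            _ ≤ _ := norm_sub_le _ _
        rw [norm_one] at h2
        linarith
      refine M3 hπ (evC _) hHe (σ := fun t => ⟨γ t, Or.inr (hcl t)⟩) ?_ ?_ hw4 hw2
      · intro x
        rw [evC_apply]
        rcases x.2 with h | ⟨r, hr, h⟩
        · exact Or.inl (hpK _ h)
        · exact Or.inr ⟨r, hr, Subtype.ext h⟩
      · intro b
        simp only [evC_apply]
        exact (BL.poly hγ b).lip)
    have hKb : ∀ z ∈ K, min (1/2:ℝ) ‖eval z p - 1‖ = 1/2 := by
      intro z hz
      apply min_eq_left
      have h1 := hpK z hz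
      have h2 : ‖(1:ℂ)‖ ≤ ‖eval z p‖ + ‖eval z p - 1‖ := by
          calc ‖(1:ℂ)‖ = ‖eval z p - (eval z p - 1)‖ := by congr 1; ring
            _ ≤ _ := norm_sub_le _ _
      rw [norm_one] at h2
      linarith
    have hcont : Continuous fun r : Icc (0:ℝ) 1 => eval (γ r) p := hL.continuous.comp continuous_subtype_val
    refine ⟨⟨fun r => (1/2)^2 - (min (1/2) ‖eval (γ r) p - 1‖)^2, by fun_prop⟩, ?_, ?_⟩
    · simp only [ContinuousMap.coe_mk, hp0, hp1, zero_sub, norm_neg, norm_one, sub_self, norm_zero]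
      norm_num
    · convert hbB using 1
      ext x
      rw [hb, evC_apply]
      simp only [pullR, ofRealCM, ContinuousMap.comp_apply, ContinuousMap.coe_mk]
      rcases hτ x with ⟨h1, h2⟩ | ⟨h1, h2⟩
      · rw [h2, hKb _ h1, show ((0 : Icc (0:ℝ) 1) : ℝ) = 0 from rfl, hKb _ h0]
      · rw [← h2]
  intro s t hst
  rcases lt_or_gt_of_ne hst with h | h
  · exact key s t h
  · obtain ⟨u, h1, h2⟩ := key t s h
    exact ⟨u, h1.symm, h2⟩
end M2

end

noncomputable section
open Set MvPolynomial Topology MeasureTheory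

section Fr
variable {X : Type} [TopologicalSpace X] [CompactSpace X] {E : Type} [NormedAddCommGroup E]
  [InnerProductSpace ℂ E] [CompleteSpace E]

/-- Toeplitz-type operator -/
def Toep (π : C(X, ℂ) →ₐ[ℂ] (E →L[ℂ] E)) (P : E →L[ℂ] E) (f : C(X,ℂ)) : E →L[ℂ] E := P * π f * P + (1 - P)

/-- unit plus compact -/
def Fr (π : C(X, ℂ) →ₐ[ℂ] (E →L[ℂ] E)) (P : E →L[ℂ] E) (f : C(X,ℂ)) : Prop :=
  ∃ U : (E →L[ℂ] E)ˣ, IsCompactOperator (Toep π P f - (U : E →L[ℂ] E) : E →L[ℂ] E)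

lemma Toep_unit {π : C(X, ℂ) →ₐ[ℂ] (E →L[ℂ] E)} (hπ : ∀ a, ‖π a‖ ≤ ‖a‖) {P : E →L[ℂ] E} (hP : P * P = P) (hP1 : ‖P‖ ≤ 1) {f : C(X,ℂ)} (hf : ‖f - 1‖ < 1) :
    ∃ U : (E →L[ℂ] E)ˣ, (U : E →L[ℂ] E) = Toep π P f := by
  have h1 : ‖P * π (1 - f) * P‖ < 1 := by
    have h2 : ‖π (1 - f)‖ < 1 := (hπ _).trans_lt (by rwa [norm_sub_rev])
    calc _ ≤ ‖P * π (1 - f)‖ * ‖P‖ := norm_mul_le _ _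
      _ ≤ ‖P * π (1 - f)‖ * 1 := by gcongr
      _ ≤ ‖P‖ * ‖π (1 - f)‖ := by rw [mul_one]; exact norm_mul_le _ _
      _ ≤ 1 * ‖π (1 - f)‖ := by gcongr
      _ < 1 := by rwa [one_mul]
  refine ⟨Units.oneSub _ h1, ?_⟩
  rw [Units.val_oneSub, Toep, map_sub, map_one, mul_sub, sub_mul, mul_one, hP]
  abel

lemma Fr_near {π : C(X, ℂ) →ₐ[ℂ] (E →L[ℂ] E)} (hπ : ∀ a, ‖π a‖ ≤ ‖a‖) {P : E →L[ℂ] E} (hP : P * P = P) (hP1 : ‖P‖ ≤ 1) {f : C(X,ℂ)} (hf : ‖f - 1‖ < 1) :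
    Fr π P f := by
  obtain ⟨U, hU⟩ := Toep_unit hπ hP hP1 hf
  refine ⟨U, ?_⟩
  rw [hU, sub_self]; exact isCompactOperator_zero

lemma Fr_mul {π : C(X, ℂ) →ₐ[ℂ] (E →L[ℂ] E)} (hπ : ∀ a, ‖π a‖ ≤ ‖a‖) {P : E →L[ℂ] E} (hP : P * P = P) (hP1 : ‖P‖ ≤ 1) {f g : C(X,ℂ)} (hf : Fr π P f)
    (hg : ‖g - 1‖ < 1) (hgc : IsCompactOperator (Hank π P g)) :
    Fr π P (f * g) := by
  obtain ⟨V, hV⟩ := Toep_unit hπ hP hP1 hg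
  obtain ⟨U, hU⟩ := hf
  refine ⟨U * V, ?_⟩
  have e : Toep π P (f * g) - ((U * V : (E →L[ℂ] E)ˣ) : E →L[ℂ] E) = (P * π f) * Hank π P g + (Toep π P f - (U : E →L[ℂ] E)) * V := by
    have hH : Hank π P g = (1 - P) * (π g * P) := rfl
    have e1 : Toep π P f * Toep π P g = P * π f * P * π g * P + (1 - P) := by
      unfold Toep
      have h1 : P * (1 - P) = 0 := by rw [mul_sub, hP, mul_one, sub_self]
      have h2 : (1 - P) * P = 0 := by rw [sub_mul, hP, one_mul, sub_self]
      have h3 : (1 - P) * (1 - P) = 1 - P := by rw [mul_sub, h2, mul_one, sub_zero]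
      calc _ = P * π f * (P * P) * π g * P + P * π f * (P * (1 - P)) + ((1 - P) * P) * π g * P + (1 - P) * (1 - P) := by noncomm_ring
        _ = _ := by rw [hP, h1, h2, h3]; noncomm_ring
    rw [sub_mul, Units.val_mul, hV, e1, hH, Toep, map_mul]
    noncomm_ring
  rw [e]
  have c1 : IsCompactOperator (((P * π f) * Hank π P g : E →L[ℂ] E)) := cpt_comp_left hgc (P * π f)
  have c2 : IsCompactOperator ((Toep π P f - (U : E →L[ℂ] E)) * (V : E →L[ℂ] E) : E →L[ℂ] E) := hU.comp_clm (V : E →L[ℂ] E)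
  exact c1.add c2

lemma Fr_surj {π : C(X, ℂ) →ₐ[ℂ] (E →L[ℂ] E)} {H : Submodule ℂ E} [H.HasOrthogonalProjection] {q : C(X,ℂ)} (hq : InvH π H q) (hu : IsUnit q)
    (hF : Fr π H.starProjection q) {h : E} (hh : h ∈ H) : ∃ v ∈ H, π q v = h := by
  obtain ⟨U, hU⟩ := hF
  set P := H.starProjection with hPdef
  have hPm : ∀ v, P v ∈ H := H.starProjection_apply_mem
  have hPi : ∀ {v}, v ∈ H → P v = v := fun hv => Submodule.starProjection_eq_self_iff.2 hv
  have hS : ∀ v, Toep π P q v = π q (P v) + (v - P v) := by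
    intro v
    change P (π q (P v)) + (v - P v) = _
    rw [hPi (hq _ (hPm v))]
  have hPS : ∀ v, P (Toep π P q v) = π q (P v) := by
    intro v
    rw [hS, map_add, map_sub, hPi (hPm v), sub_self, add_zero, hPi (hq _ (hPm v))]
  set T : E →L[ℂ] E := ((U⁻¹ : (E →L[ℂ] E)ˣ) : E →L[ℂ] E) * (Toep π P q - (U : E →L[ℂ] E)) with hT
  have hTc : IsCompactOperator T := cpt_comp_left hU _
  have hTS : T = ((U⁻¹ : (E →L[ℂ] E)ˣ) : E →L[ℂ] E) * Toep π P q - 1 := by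
    rw [hT, mul_sub, Units.inv_mul]
  have hUT : Toep π P q = U * (T + 1) := by
    rw [hTS, sub_add_cancel, Units.mul_inv_cancel_left]
  rcases hTc.hasEigenvalue_or_mem_resolventSet (μ := (-1:ℂ)) (by norm_num) with he | hr
  · exfalso
    obtain ⟨v, hv⟩ := he.exists_hasEigenvector
    have h1 : T v = (-1:ℂ) • v := hv.apply_eq_smul
    have h2 : Toep π P q v = 0 := by
      rw [hUT]
      change (U : E →L[ℂ] E) (T v + v) = 0
      rw [h1]; simp
    have h3 : π q (P v) = 0 := by rw [← hPS, h2, map_zero]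
    have h4 : v = P v := by
      have := hS v
      rw [h2, h3, zero_add] at this
      exact sub_eq_zero.1 this.symm
    obtain ⟨u, rfl⟩ := hu
    have h5 : P v = 0 := by
      have : π ((u⁻¹ : C(X,ℂ)ˣ) * (u : C(X,ℂ))) (P v) = 0 := by rw [pi_mul_apply, h3, map_zero]
      simpa using this
    exact hv.2 (h4.trans h5)
  · rw [spectrum.mem_resolventSet_iff] at hr
    obtain ⟨W, hW⟩ := hr
    refine ⟨P (-((W⁻¹ : (E →L[ℂ] E)ˣ) : E →L[ℂ] E) (((U⁻¹ : (E →L[ℂ] E)ˣ) : E →L[ℂ] E) h)), hPm _, ?_⟩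
    rw [← hPS]
    have e : T + 1 = - (W : E →L[ℂ] E) := by rw [hW]; simp
    rw [hUT, e]
    have : ∀ (A : (E →L[ℂ] E)ˣ) (x : E), (A : E →L[ℂ] E) (((A⁻¹ : (E →L[ℂ] E)ˣ) : E →L[ℂ] E) x) = x := by
      intro A x
      have := congrArg (fun B : E →L[ℂ] E => B x) (Units.mul_inv A)
      exact this
    change P ((U : E →L[ℂ] E) (-(W : E →L[ℂ] E) (-((W⁻¹ : (E →L[ℂ] E)ˣ) : E →L[ℂ] E) (((U⁻¹ : (E →L[ℂ] E)ˣ) : E →L[ℂ] E) h)))) = h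
    simp only [map_neg, neg_neg, this, hPi hh]
end Fr

end

noncomputable section
open Set MvPolynomial Topology MeasureTheory

theorem thmA {N : ℕ} {K : Set (Fin N → ℂ)} {γ : ℝ → Fin N → ℂ} (hK : IsCompact K) (hpc : IsPolynomiallyConvex K) (hγ : ∀ i, BL fun t => γ t i) (hcl : ∀ t, γ t ∈ γ '' Icc 0 1)
    (hinj : InjOn γ (Icc 0 1)) (h0 : γ 0 ∈ K) (hout : ∀ t ∈ Ioc (0:ℝ) 1, γ t ∉ K) : IsPolynomiallyConvex (K ∪ γ '' Icc 0 1) := by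
  have hγc : Continuous γ := by
    rw [continuous_pi_iff]
    intro i
    obtain ⟨L, hL⟩ := (hγ i).lip
    exact hL.continuous
  have hXc := compactSpace_attach hK hγc.continuousOn
  apply pc_of hXc
  intro x hx
  by_contra hxX
  have hxK : x ∉ K := fun h => hxX (Or.inl h)
  have hγx : ∀ t, γ t ≠ x := by
    rintro t rfl; exact hxX (Or.inr (hcl t))
  have : CompactSpace (K ∪ γ '' Icc 0 1 : Set (Fin N → ℂ)) := isCompact_iff_compactSpace.1 hXc
  set X : Set (Fin N → ℂ) := K ∪ γ '' Icc 0 1 with hX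
  obtain ⟨τ, hτ⟩ : ∃ τ : C(X, Icc (0:ℝ) 1), ∀ x, (x.1 ∈ K ∧ τ x = 0) ∨ (x.1 ∉ K ∧ x.1 = γ (τ x)) := tau_exists hK hγc.continuousOn hinj h0 hout
  rw [mem_polyHull_iff hXc] at hx
  obtain ⟨φ, hφ1, hφ⟩ := hb_ext (evC X).toLinearMap (MvPolynomial.aeval x : MvPolynomial (Fin N) ℂ →ₐ[ℂ] ℂ).toLinearMap (by
    intro m
    rw [AlgHom.toLinearMap_apply, AlgHom.toLinearMap_apply, MvPolynomial.aeval_eq_eval]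
    apply hx
    intro y hy
    have := (evC X m).norm_coe_le_norm ⟨y, hy⟩
    rwa [evC_apply] at this)
  have hφe : ∀ m, φ (evC X m) = eval x m := by
    intro m
    have := hφ m
    rwa [AlgHom.toLinearMap_apply, AlgHom.toLinearMap_apply, MvPolynomial.aeval_eq_eval] at this
  have hφone : φ 1 = 1 := by have := hφe 1; simpa using this
  obtain ⟨E, _, _, _, π, ξ, hπ, hξ, hφπ⟩ := GNS_exists φ hφ1 hφone
  let H0 : Submodule ℂ E := LinearMap.range ((ContinuousLinearMap.apply ℂ E ξ).toLinearMap ∘ₗ π.toLinearMap ∘ₗ (evC X).toLinearMap)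
  let H : Submodule ℂ E := H0.topologicalClosure
  have hHe : (H : Set E) = closure (range fun a => π (evC X a) ξ) := by
    rw [Submodule.topologicalClosure_coe]
    rfl
  have hHcl : IsClosed (H : Set E) := by rw [hHe]; exact isClosed_closure
  have : CompleteSpace H := hHcl.completeSpace_coe
  have hP' : H.starProjection * H.starProjection = H.starProjection := H.isIdempotentElem_starProjection
  have hP : H.starProjection ∘L H.starProjection = H.starProjection := hP'
  have hP1 : ‖H.starProjection‖ ≤ 1 := H.starProjection_norm_le
  have hM2 := M2 hK hpc hγ hcl hinj h0 hout hπ hHe hP τ hτ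
  have hinv := invH_of (evC X) hHe
  have hξH : ξ ∈ H := by
    change ξ ∈ (H : Set E)
    rw [hHe]
    exact subset_closure ⟨1, by simp⟩
  -- the polynomial q
  obtain ⟨p0, hp0x, hp0K⟩ := pc_sep hK hpc hxK (ε := 1/16) (by norm_num)
  obtain ⟨q, hqx, hqK', hqγ⟩ := choose_q hK hγ hγx (p0 := 1 - p0) (by simp [hp0x]) (ε := 1/16) (by norm_num)
  have hqK : ∀ y ∈ K, ‖eval y q - 1‖ ≤ 1/8 := by
    intro y hy
    have h1 := hqK' y hy
    have h2 := hp0K y hy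
    have e : eval y q - 1 = (eval y q - eval y (1 - p0)) - eval y p0 := by simp; ring
    rw [e]
    refine (norm_sub_le _ _).trans (by linarith)
  have hBL := BL.poly hγ q
  obtain ⟨L, hL⟩ := hBL.lip
  have hQc : Continuous fun t => eval (γ t) q := hL.continuous
  set Q : ℝ → ℂ := fun t => eval (γ t) q with hQ
  have hQ0 : ∀ t, Q t ≠ 0 := hqγ
  have hq0 : ∀ y : X, eval y.1 q ≠ 0 := by
    rintro ⟨y, hy | ⟨t, ht, rfl⟩⟩ h
    · have := hqK y hy
      simp only at h
      rw [h] at this; norm_num at this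
    · exact hqγ t h
  let R : ℝ → C(Icc (0:ℝ) 1, ℂ) := fun s => ⟨fun t => Q (min t s) / Q t, by
    exact Continuous.div (hQc.comp (by fun_prop)) (hQc.comp (by fun_prop)) (fun t => hQ0 _)⟩
  let r : ℝ → ℝ → C(Icc (0:ℝ) 1, ℂ) := fun s s' => ⟨fun t => Q (min t s') / Q (min t s), by
    exact Continuous.div (hQc.comp (by fun_prop)) (hQc.comp (by fun_prop)) (fun t => hQ0 _)⟩
  let A : ℝ → C(X, ℂ) := fun s => evC X q * (R s).comp τ
  have hA1 : A 1 = evC X q := by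
    ext y
    simp only [A, R, ContinuousMap.mul_apply, ContinuousMap.comp_apply, ContinuousMap.coe_mk]
    rw [min_eq_left (τ y).2.2, div_self (hQ0 _), mul_one]
  have hstep : ∀ s s', A s' = A s * (r s s').comp τ := by
    intro s s'
    ext y
    simp only [A, R, r, ContinuousMap.mul_apply, ContinuousMap.comp_apply, ContinuousMap.coe_mk]
    have h1 := hQ0 (τ y)
    have h2 := hQ0 (min (τ y) s)
    field_simp
  have hA0 : ‖A 0 - 1‖ < 1 := by
    have : ‖A 0 - 1‖ ≤ 1/8 := by
      rw [ContinuousMap.norm_le _ (by norm_num)]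
      intro y
      simp only [A, R, ContinuousMap.mul_apply, ContinuousMap.comp_apply, ContinuousMap.coe_mk, ContinuousMap.sub_apply, ContinuousMap.one_apply]
      rw [evC_apply]
      rcases hτ y with ⟨h1, h2⟩ | ⟨h1, h2⟩
      · rw [h2, show ((0 : Icc (0:ℝ) 1) : ℝ) = 0 from rfl, min_self, div_self (hQ0 _), mul_one]
        exact hqK _ h1
      · rw [min_eq_right (τ y).2.1]
        have : eval y.1 q = Q (τ y) := by rw [hQ]; simp only; rw [← h2]
        rw [this, mul_div_cancel₀ _ (hQ0 _)]
        exact hqK _ h0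
    linarith
  -- minimum of |Q|
  obtain ⟨m, hm, hmQ⟩ : ∃ m : ℝ, 0 < m ∧ ∀ t ∈ Icc (0:ℝ) 1, m ≤ ‖Q t‖ := by
    obtain ⟨t, ht, hmin⟩ := isCompact_Icc.exists_isMinOn (nonempty_Icc.2 zero_le_one) (hQc.norm.continuousOn (s := Icc (0:ℝ) 1))
    exact ⟨‖Q t‖, norm_pos_iff.2 (hQ0 t), fun s hs => hmin hs⟩
  obtain ⟨n, hn⟩ := exists_nat_gt (2 * (L:ℝ) / m)
  have hn0 : (0:ℝ) < n := lt_of_le_of_lt (by positivity) hn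
  have hr : ∀ s s' : ℝ, 0 ≤ s → |s' - s| ≤ 1/(n:ℝ) → ‖(r s s').comp τ - 1‖ < 1 := by
    intro s s' hs hss
    have : ‖(r s s').comp τ - 1‖ ≤ 1/2 := by
      rw [ContinuousMap.norm_le _ (by norm_num)]
      intro y
      simp only [r, ContinuousMap.comp_apply, ContinuousMap.coe_mk, ContinuousMap.sub_apply, ContinuousMap.one_apply]
      set t : ℝ := (τ y : ℝ)
      have ht : t ∈ Icc (0:ℝ) 1 := (τ y).2
      have hmem : min t s ∈ Icc (0:ℝ) 1 := ⟨le_min ht.1 hs, (min_le_left _ _).trans ht.2⟩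
      have hmQ' := hmQ _ hmem
      rw [div_sub_one (hQ0 _), norm_div, div_le_iff₀ (norm_pos_iff.2 (hQ0 _))]
      have h1 : ‖Q (min t s') - Q (min t s)‖ ≤ L * |min t s' - min t s| := by
        have := hL.dist_le_mul (min t s') (min t s)
        rwa [dist_eq_norm, Real.dist_eq] at this
      have h2 : |min t s' - min t s| ≤ |s' - s| := by
        have := abs_min_sub_min_le_max t s' t s
        simpa using this
      have h3 : (L:ℝ) * (1/n) ≤ m / 2 := by
        rw [div_lt_iff₀ hm] at hn
        rw [mul_one_div, div_le_iff₀ hn0]; linarith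
      calc _ ≤ (L:ℝ) * (1/n) := h1.trans (by gcongr; exact h2.trans hss)
        _ ≤ _ := by linarith
    linarith
  have hFr : ∀ k : ℕ, Fr π H.starProjection (A (k / n)) := by
    intro k
    induction k with
    | zero => simpa using Fr_near hπ hP' hP1 hA0
    | succ k ih =>
      rw [hstep (k/n)]
      apply Fr_mul hπ hP' hP1 ih
      · apply hr _ _ (by positivity)
        push_cast
        rw [← sub_div, add_sub_cancel_left, abs_of_nonneg (by positivity)]
      · exact mem_CCc.1 (hM2 _)
  have hFrq : Fr π H.starProjection (evC X q) := by
    have := hFr n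
    rwa [div_self hn0.ne', hA1] at this
  have hunit : IsUnit (evC X q) := by
    rw [ContinuousMap.isUnit_iff_forall_ne_zero]
    intro y; rw [evC_apply]; exact hq0 y
  obtain ⟨v, hvH, hv⟩ := Fr_surj (hinv q) hunit hFrq hξH
  have hvcl : v ∈ closure (range fun a => π (evC X a) ξ) := by rw [← hHe]; exact hvH
  rw [Metric.mem_closure_iff] at hvcl
  obtain ⟨_, ⟨a, rfl⟩, ha⟩ := hvcl (1 / (‖π (evC X q)‖ + 1)) (by positivity)
  have h1 : ‖ξ - π (evC X (q * a)) ξ‖ < 1 := by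
    rw [map_mul, pi_mul_apply]
    nth_rewrite 1 [← hv]
    rw [← map_sub]
    rw [dist_eq_norm] at ha
    calc _ ≤ ‖π (evC X q)‖ * ‖v - π (evC X a) ξ‖ := ContinuousLinearMap.le_opNorm _ _
      _ ≤ (‖π (evC X q)‖ + 1) * ‖v - π (evC X a) ξ‖ := by gcongr; linarith
      _ < (‖π (evC X q)‖ + 1) * (1 / (‖π (evC X q)‖ + 1)) := by gcongr
      _ = 1 := by field_simp
  have h2 : φ (evC X (1 - q * a)) = 1 := by rw [hφe]; simp [hqx]
  rw [hφπ, map_sub, map_sub, map_one, map_one] at h2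
  have h3 : ‖inner ℂ ξ (ξ - π (evC X (q * a)) ξ)‖ ≤ ‖ξ‖ * ‖ξ - π (evC X (q * a)) ξ‖ := norm_inner_le_norm _ _
  change inner ℂ ξ (ξ - π (evC X (q * a)) ξ) = 1 at h2
  rw [h2, hξ, norm_one, one_mul] at h3
  linarith

end

noncomputable section
open Set MvPolynomial Topology MeasureTheory

lemma reparam {N : ℕ} {γ : ℝ → Fin N → ℂ} {a b : ℝ} (hab : a < b) (hc : ContinuousOn γ (Icc a b)) (hinj : InjOn γ (Icc a b)) (hBV : BoundedVariationOn γ (Icc a b)) :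
    ∃ g : ℝ → Fin N → ℂ, (∀ i, BL fun t => g t i) ∧ (∀ t, g t ∈ g '' Icc 0 1) ∧ InjOn g (Icc 0 1) ∧ g 0 = γ a ∧ g '' Icc 0 1 = γ '' Icc a b := by
  have hl := hBV.locallyBoundedVariationOn
  have has : a ∈ Icc a b := left_mem_Icc.2 hab.le
  have hbs : b ∈ Icc a b := right_mem_Icc.2 hab.le
  set v := variationOnFromTo γ (Icc a b) a with hv
  have hva : v a = 0 := variationOnFromTo.self _ _ _
  have hmono : MonotoneOn v (Icc a b) := variationOnFromTo.monotoneOn hl has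
  have hd0 : ∀ x ∈ Icc a b, ∀ y ∈ Icc a b, x ≤ y → dist (γ x) (γ y) ≤ v y - v x := by
    intro x hx y hy hxy
    have e : v y - v x = variationOnFromTo γ (Icc a b) x y := variationOnFromTo.sub_right hl has hy hx
    rw [e, variationOnFromTo.eq_of_le _ _ hxy]
    exact (hBV.mono inter_subset_left).dist_le ⟨hx, ⟨le_rfl, hxy⟩⟩ ⟨hy, ⟨hxy, le_rfl⟩⟩
  have hd : ∀ x ∈ Icc a b, ∀ y ∈ Icc a b, dist (γ x) (γ y) ≤ |v x - v y| := by
    intro x hx y hy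
    rcases le_total x y with h | h
    · rw [abs_sub_comm]; exact (hd0 x hx y hy h).trans (le_abs_self _)
    · rw [dist_comm]; exact (hd0 y hy x hx h).trans (le_abs_self _)
  have hvc : ContinuousOn v (Icc a b) := by
    intro x hx
    have h1 := variationOnFromTo.tendsto_left has hx hl ((hc x hx).tendsto.mono_left (nhdsWithin_mono _ inter_subset_left))
    have h2 := variationOnFromTo.tendsto_right has hx hl ((hc x hx).tendsto.mono_left (nhdsWithin_mono _ inter_subset_left))
    rw [dist_self, sub_zero] at h1
    rw [dist_self, add_zero] at h2
    have hU : Icc a b ⊆ (Icc a b ∩ Iio x) ∪ ({x} ∪ (Icc a b ∩ Ioi x)) := by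
      intro y hy
      rcases lt_trichotomy y x with h | h | h
      · exact Or.inl ⟨hy, h⟩
      · exact Or.inr (Or.inl h)
      · exact Or.inr (Or.inr ⟨hy, h⟩)
    refine ContinuousWithinAt.mono ?_ hU
    have c1 : ContinuousWithinAt v (Icc a b ∩ Iio x) x := h1
    have c2 : ContinuousWithinAt v (Icc a b ∩ Ioi x) x := h2
    exact c1.union (continuousWithinAt_singleton.union c2)
  set l := v b with hlb
  have hl0 : 0 < l := by
    have := hd0 a has b hbs hab.le
    rw [hva, sub_zero] at this
    refine lt_of_lt_of_le (dist_pos.2 ?_) this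
    intro h; exact hab.ne (hinj has hbs h)
  have hex : ∀ r ∈ Icc 0 l, ∃ x ∈ Icc a b, v x = r := by
    have := intermediate_value_Icc hab.le hvc
    rw [hva] at this
    exact this
  choose! w hw1 hw2 using hex
  have hcm : ∀ t : ℝ, l * (projIcc (0:ℝ) 1 zero_le_one t : ℝ) ∈ Icc 0 l := by
    intro t
    have := (projIcc (0:ℝ) 1 zero_le_one t).2
    exact ⟨mul_nonneg hl0.le this.1, mul_le_of_le_one_right hl0.le this.2⟩
  set g : ℝ → Fin N → ℂ := fun t => γ (w (l * (projIcc (0:ℝ) 1 zero_le_one t : ℝ))) with hg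
  have hgim : ∀ t, g t ∈ γ '' Icc a b := fun t => ⟨_, hw1 _ (hcm t), rfl⟩
  have hgp : ∀ t ∈ Icc (0:ℝ) 1, g t = γ (w (l * t)) := by
    intro t ht
    simp only [hg, projIcc_of_mem zero_le_one ht]
  have hlip : ∀ s t, dist (g s) (g t) ≤ l * |s - t| := by
    intro s t
    refine (hd _ (hw1 _ (hcm s)) _ (hw1 _ (hcm t))).trans ?_
    rw [hw2 _ (hcm s), hw2 _ (hcm t), ← mul_sub, abs_mul, abs_of_pos hl0]
    exact mul_le_mul_of_nonneg_left (abs_projIcc_sub_projIcc (zero_le_one (α := ℝ))) hl0.le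
  obtain ⟨M, hM⟩ : ∃ M : ℝ, ∀ x ∈ Icc a b, ‖γ x‖ ≤ M := isCompact_Icc.exists_bound_of_continuousOn hc
  refine ⟨g, ?_, ?_, ?_, ?_, ?_⟩
  · intro i
    refine ⟨max l M, le_max_of_le_left hl0.le, fun t => ?_, fun s t => ?_⟩
    · exact (norm_le_pi_norm _ i).trans ((hM _ (hw1 _ (hcm t))).trans (le_max_right _ _))
    · have h1 := hlip s t
      rw [dist_eq_norm] at h1
      have h2 := norm_le_pi_norm (g s - g t) i
      rw [Pi.sub_apply] at h2
      calc _ ≤ l * |s - t| := h2.trans h1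
        _ ≤ _ := by gcongr; exact le_max_left _ _
  · intro t
    refine ⟨projIcc (0:ℝ) 1 zero_le_one t, (projIcc (0:ℝ) 1 zero_le_one t).2, ?_⟩
    simp only [hg, projIcc_val]
  · intro s hs t ht hst
    have h1 := hcm s
    have h2 := hcm t
    rw [projIcc_of_mem zero_le_one hs] at h1
    rw [projIcc_of_mem zero_le_one ht] at h2
    rw [hgp s hs, hgp t ht] at hst
    have h3 := hinj (hw1 _ h1) (hw1 _ h2) hst
    have h4 := congrArg v h3
    rw [hw2 _ h1, hw2 _ h2] at h4
    exact mul_left_cancel₀ hl0.ne' h4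
  · rw [hgp 0 (by simp), mul_zero]
    have h0 : (0:ℝ) ∈ Icc 0 l := ⟨le_rfl, hl0.le⟩
    have := hd _ (hw1 0 h0) _ has
    rw [hw2 0 h0, hva, sub_zero, abs_zero] at this
    exact dist_le_zero.1 this
  · apply Subset.antisymm
    · rintro _ ⟨t, _, rfl⟩; exact hgim t
    · rintro _ ⟨x, hx, rfl⟩
      have hvx0 : 0 ≤ v x := by rw [← hva]; exact hmono has hx hx.1
      have hvxl : v x ≤ l := hmono hx hbs hx.2
      have ht : v x / l ∈ Icc (0:ℝ) 1 := ⟨div_nonneg hvx0 hl0.le, (div_le_one hl0).2 hvxl⟩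
      refine ⟨v x / l, ht, ?_⟩
      rw [hgp _ ht, mul_div_cancel₀ _ hl0.ne']
      have := hd _ (hw1 _ ⟨hvx0, hvxl⟩) _ hx
      rw [hw2 _ ⟨hvx0, hvxl⟩, sub_self, abs_zero] at this
      exact dist_le_zero.1 this

theorem thmA_right {N : ℕ} {K : Set (Fin N → ℂ)} {γ : ℝ → Fin N → ℂ} (hK : IsCompact K) (hpc : IsPolynomiallyConvex K)
    {a b : ℝ} (hab : a < b) (hc : ContinuousOn γ (Icc a b)) (hinj : InjOn γ (Icc a b)) (hBV : BoundedVariationOn γ (Icc a b))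
    (h0 : γ a ∈ K) (hout : ∀ t ∈ Ioc a b, γ t ∉ K) : IsPolynomiallyConvex (K ∪ γ '' Icc a b) := by
  obtain ⟨g, hg1, hg2, hg3, hg4, hg5⟩ := reparam hab hc hinj hBV
  rw [← hg5]
  apply thmA hK hpc hg1 hg2 hg3 (by rwa [hg4])
  intro t ht
  have : g t ∈ γ '' Icc a b := by rw [← hg5]; exact mem_image_of_mem _ ⟨ht.1.le, ht.2⟩
  obtain ⟨x, hx, hxt⟩ := this
  rw [← hxt]
  apply hout
  refine ⟨lt_of_le_of_ne hx.1 ?_, hx.2⟩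
  rintro rfl
  rw [← hg4] at hxt
  have := hg3 (by simp) ⟨ht.1.le, ht.2⟩ hxt
  exact ht.1.ne this

theorem thmA_left {N : ℕ} {K : Set (Fin N → ℂ)} {γ : ℝ → Fin N → ℂ} (hK : IsCompact K) (hpc : IsPolynomiallyConvex K)
    {a b : ℝ} (hab : a < b) (hc : ContinuousOn γ (Icc a b)) (hinj : InjOn γ (Icc a b)) (hBV : BoundedVariationOn γ (Icc a b))
    (h0 : γ b ∈ K) (hout : ∀ t ∈ Ico a b, γ t ∉ K) : IsPolynomiallyConvex (K ∪ γ '' Icc a b) := by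
  have hmap : MapsTo (fun t : ℝ => -t) (Icc (-b) (-a)) (Icc a b) := fun t ht => ⟨by linarith [ht.2], by linarith [ht.1]⟩
  have him : γ '' Icc a b = (γ ∘ fun t => -t) '' Icc (-b) (-a) := by
    rw [image_comp]; simp
  rw [him]
  apply thmA_right hK hpc (neg_lt_neg hab)
  · exact hc.comp (by fun_prop) hmap
  · exact hinj.comp neg_injective.injOn hmap
  · exact (lt_of_le_of_lt (eVariationOn.comp_le_of_antitoneOn γ (fun t : ℝ => -t) (fun x _ y _ h => neg_le_neg h) hmap) (lt_top_iff_ne_top.2 hBV)).ne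
  · simpa using h0
  · intro t ht
    exact hout _ ⟨by linarith [ht.2], by linarith [ht.1]⟩

/-- two-sided version with a gap -/
theorem thmA_gap {N : ℕ} {K : Set (Fin N → ℂ)} {γ : ℝ → Fin N → ℂ} (hK : IsCompact K) (hpc : IsPolynomiallyConvex K)
    (hc : ContinuousOn γ (Icc 0 1)) (hinj : InjOn γ (Icc 0 1)) (hBV : BoundedVariationOn γ (Icc 0 1))
    (h0 : γ 0 ∈ K) (h1 : γ 1 ∈ K) (hout : ∀ t ∈ Ioo (0:ℝ) 1, γ t ∉ K) {a b : ℝ} (ha : 0 < a) (hab : a < b) (hb : b < 1) :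
    IsCompact (K ∪ γ '' Icc 0 a ∪ γ '' Icc b 1) ∧ IsPolynomiallyConvex (K ∪ γ '' Icc 0 a ∪ γ '' Icc b 1) := by
  have s1 : Icc 0 a ⊆ Icc (0:ℝ) 1 := Icc_subset_Icc le_rfl (by linarith)
  have s2 : Icc b 1 ⊆ Icc (0:ℝ) 1 := Icc_subset_Icc (by linarith) le_rfl
  have c1 : IsCompact (K ∪ γ '' Icc 0 a) := hK.union (isCompact_Icc.image_of_continuousOn (hc.mono s1))
  refine ⟨c1.union (isCompact_Icc.image_of_continuousOn (hc.mono s2)), ?_⟩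
  have p1 := thmA_right hK hpc ha (hc.mono s1) (hinj.mono s1) (hBV.mono s1) h0 (fun t ht => hout t ⟨ht.1, by linarith [ht.2]⟩)
  apply thmA_left c1 p1 hb (hc.mono s2) (hinj.mono s2) (hBV.mono s2) (Or.inl h1)
  rintro t ht (h | ⟨s, hs, h⟩)
  · exact hout t ⟨by linarith [ht.1], ht.2⟩ h
  · have := hinj (s1 hs) (s2 ⟨ht.1, ht.2.le⟩) h
    linarith [hs.2, ht.1]

end

noncomputable section
open Set MvPolynomial Topology MeasureTheory

lemma subset_hull {N : ℕ} {X : Set (Fin N → ℂ)} (hX : IsCompact X) : X ⊆ polyHull X := by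
  intro z hz
  rw [mem_polyHull_iff hX]
  intro p C hC; exact hC z hz

lemma hull_compact {N : ℕ} {X : Set (Fin N → ℂ)} (hX : IsCompact X) : IsCompact (polyHull X) := by
  have hcl : IsClosed (polyHull X) := by
    have : polyHull X = ⋂ p : MvPolynomial (Fin N) ℂ, {z | ‖eval z p‖ ≤ ⨆ x ∈ X, ‖eval x p‖} := by
      ext z; simp [polyHull]
    rw [this]
    exact isClosed_iInter fun p => isClosed_le (MvPolynomial.continuous_eval p).norm continuous_const
  obtain ⟨M, hM⟩ := hX.exists_bound_of_continuousOn (f := fun x : Fin N → ℂ => x) continuousOn_id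
  refine (isCompact_closedBall (0 : Fin N → ℂ) |M|).of_isClosed_subset hcl ?_
  intro z hz
  rw [mem_closedBall_zero_iff, pi_norm_le_iff_of_nonneg (abs_nonneg _)]
  intro i
  have := (mem_polyHull_iff hX).1 hz (MvPolynomial.X i) |M| (by
    intro x hx
    rw [eval_X]
    exact (norm_le_pi_norm x i).trans ((hM x hx).trans (le_abs_self _)))
  rwa [eval_X] at this

lemma hull_pc {N : ℕ} {X : Set (Fin N → ℂ)} (hX : IsCompact X) : IsPolynomiallyConvex (polyHull X) := by
  apply pc_of (hull_compact hX)
  intro z hz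
  rw [mem_polyHull_iff (hull_compact hX)] at hz
  rw [mem_polyHull_iff hX]
  intro p C hC
  exact hz p C (fun y hy => (mem_polyHull_iff hX).1 hy p C hC)

lemma char_norm {Y : Type} [TopologicalSpace Y] [CompactSpace Y] [Nonempty Y] (B : Subalgebra ℂ C(Y,ℂ)) (hB : IsClosed (B : Set C(Y,ℂ)))
    (χ : B →ₐ[ℂ] ℂ) (a : B) : ‖χ a‖ ≤ ‖(a : C(Y,ℂ))‖ := by
  have : CompleteSpace B := hB.completeSpace_coe
  have h := AlgHom.norm_apply_le_self_mul_norm_one χ a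
  have h1 : ‖(1 : B)‖ = 1 := by
    change ‖(1 : C(Y,ℂ))‖ = 1
    exact norm_one
  rw [h1, mul_one] at h
  exact h

lemma resC_mem {N : ℕ} {Y : Set (Fin N → ℂ)} [CompactSpace Y] [Nonempty Y] (hYc : IsCompact Y) (hY : IsPolynomiallyConvex Y) (p : MvPolynomial (Fin N) ℂ) {w : ℂ}
    (hw : w ∉ range (evC Y p)) : resC (evC Y p) w ∈ (evC Y).range.topologicalClosure := by
  set B := (evC Y).range.topologicalClosure with hB
  have hmem : ∀ a, evC Y a ∈ B := fun a => Subalgebra.le_topologicalClosure _ ⟨a, rfl⟩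
  have hBc : IsClosed (B : Set C(Y,ℂ)) := Subalgebra.isClosed_topologicalClosure _
  have : CompleteSpace B := hBc.completeSpace_coe
  let Ψ : MvPolynomial (Fin N) ℂ →ₐ[ℂ] B := (evC Y).codRestrict B hmem
  have hu : IsUnit (Ψ (p - MvPolynomial.C w)) := by
    by_contra hnu
    obtain ⟨χ, hχ⟩ := WeakDual.CharacterSpace.exists_apply_eq_zero hnu
    let χ' : B →ₐ[ℂ] ℂ := WeakDual.CharacterSpace.toAlgHom χ
    let y : Fin N → ℂ := fun i => χ' (Ψ (MvPolynomial.X i))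
    have hy : ∀ a, χ' (Ψ a) = eval y a := by
      intro a
      have : χ'.comp Ψ = MvPolynomial.aeval y := by
        apply MvPolynomial.algHom_ext
        intro i; simp [y]
      have h2 := congrArg (fun f : MvPolynomial (Fin N) ℂ →ₐ[ℂ] ℂ => f a) this
      simpa [MvPolynomial.aeval_eq_eval] using h2
    have hyY : y ∈ Y := by
      rw [← (show polyHull Y = Y from hY), mem_polyHull_iff hYc]
      intro a C hC
      rw [← hy]
      refine (char_norm B hBc χ' _).trans ?_
      change ‖evC Y a‖ ≤ C
      rw [ContinuousMap.norm_le_of_nonempty]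
      intro x
      rw [evC_apply]; exact hC _ x.2
    apply hw
    refine ⟨⟨y, hyY⟩, ?_⟩
    rw [evC_apply]
    have h3 : χ' (Ψ (p - MvPolynomial.C w)) = 0 := hχ
    rw [hy, map_sub, eval_C, sub_eq_zero] at h3
    exact h3
  obtain ⟨⟨a, ha⟩, h⟩ := hu.exists_right_inv
  have h' := congrArg Subtype.val h
  have h'' : evC Y (p - MvPolynomial.C w) * a = 1 := h'
  have : resC (evC Y p) w = a := by
    ext x
    rw [resC_apply hw]
    have := congrArg (fun g : C(Y,ℂ) => g x) h''
    simp only [ContinuousMap.mul_apply, ContinuousMap.one_apply] at this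
    rw [evC_apply, map_sub, eval_C] at this
    rw [evC_apply]
    exact (eq_inv_of_mul_eq_one_right this).symm
  rw [this]; exact ha

lemma line_polys {N : ℕ} {L : Set (Fin N → ℂ)} (hL : IsComplexAffineLine L) : ∃ l : Fin N → MvPolynomial (Fin N) ℂ, ∀ z, z ∈ L ↔ ∀ j, eval z (l j) = 0 := by
  obtain ⟨z0, v, hv, rfl⟩ := hL
  obtain ⟨i, hi⟩ := Function.ne_iff.1 hv
  have hi : v i ≠ 0 := hi
  refine ⟨fun j => MvPolynomial.C (v i) * (MvPolynomial.X j - MvPolynomial.C (z0 j)) - MvPolynomial.C (v j) * (MvPolynomial.X i - MvPolynomial.C (z0 i)), fun z => ?_⟩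
  constructor
  · rintro ⟨t, rfl⟩ j
    simp; ring
  · intro h
    refine ⟨(z i - z0 i) / v i, ?_⟩
    ext j
    have := h j
    simp at this
    simp
    field_simp
    linear_combination this

lemma root_trick {c A M C : ℝ} (hc : 0 < c) (hC : 0 ≤ C) (h : ∀ m : ℕ, c * A ^ m ≤ M * C ^ m) : A ≤ C := by
  by_contra! hlt
  have hA : 0 < A := hC.trans_lt hlt
  have hM : 0 < M := by have := h 0; simp at this; linarith
  obtain ⟨m, hm⟩ := exists_pow_lt_of_lt_one (div_pos hc hM) ((div_lt_one hA).2 hlt)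
  have := h m
  rw [div_pow, div_lt_div_iff₀ (by positivity) hM] at hm
  linarith

end

noncomputable section
open Set MvPolynomial Topology MeasureTheory

lemma icc_split {N : ℕ} {γ : ℝ → Fin N → ℂ} {K : Set (Fin N → ℂ)} {a b : ℝ} {y : Fin N → ℂ} (hy : y ∈ K ∪ γ '' Icc 0 1) :
    y ∈ K ∪ γ '' Icc 0 a ∪ γ '' Icc b 1 ∨ ∃ t ∈ Ioo a b, γ t = y := by
  rcases hy with hy | ⟨t, ht, rfl⟩
  · exact Or.inl (Or.inl (Or.inl hy))
  · rcases le_or_gt t a with h | h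
    · exact Or.inl (Or.inl (Or.inr ⟨t, ⟨ht.1, h⟩, rfl⟩))
    · rcases le_or_gt b t with h' | h'
      · exact Or.inl (Or.inr ⟨t, ⟨h', ht.2⟩, rfl⟩)
      · exact Or.inr ⟨t, ⟨h, h'⟩, rfl⟩

lemma gap_sub {N : ℕ} {γ : ℝ → Fin N → ℂ} {K : Set (Fin N → ℂ)} {a b : ℝ} (ha : a ≤ 1) (hb : 0 ≤ b) :
    K ∪ γ '' Icc 0 a ∪ γ '' Icc b 1 ⊆ K ∪ γ '' Icc 0 1 := by
  rintro y ((hy | hy) | hy)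
  · exact Or.inl hy
  · exact Or.inr (image_mono (Icc_subset_Icc le_rfl ha) hy)
  · exact Or.inr (image_mono (Icc_subset_Icc hb le_rfl) hy)

lemma clos_hull {N : ℕ} {X Y : Set (Fin N → ℂ)} [CompactSpace Y] (hX : IsCompact X) (hY : polyHull X = Y) (hXY : X ⊆ Y) {x : Fin N → ℂ} (hx : x ∈ Y)
    {h : C(Y, ℂ)} (hh : h ∈ (evC Y).range.topologicalClosure) {C : ℝ} (hC : ∀ y (hy : y ∈ X), ‖h ⟨y, hXY hy⟩‖ ≤ C) : ‖h ⟨x, hx⟩‖ ≤ C := by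
  have hh' : h ∈ closure ((evC Y).range : Set C(Y,ℂ)) := hh
  apply le_of_forall_pos_le_add
  intro ε hε
  obtain ⟨g, ⟨p, hp⟩, hg⟩ := Metric.mem_closure_iff.1 hh' (ε/2) (by positivity)
  have hp : evC Y p = g := hp
  subst hp
  have hd : ∀ y, ‖h y - evC Y p y‖ ≤ ε / 2 := by
    intro y
    rw [← dist_eq_norm]
    exact (ContinuousMap.dist_apply_le_dist y).trans hg.le
  have h1 : ‖eval x p‖ ≤ C + ε / 2 := by
    have hx' : x ∈ polyHull X := by rw [hY]; exact hx
    rw [mem_polyHull_iff hX] at hx'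
    apply hx'
    intro y hy
    have e1 := hd ⟨y, hXY hy⟩
    rw [evC_apply] at e1
    have e2 := norm_sub_norm_le (eval y p) (h ⟨y, hXY hy⟩)
    rw [norm_sub_rev (eval y p)] at e2
    have := hC y hy
    linarith
  have e1 := hd ⟨x, hx⟩
  rw [evC_apply] at e1
  have e2 := norm_sub_norm_le (h ⟨x, hx⟩) (eval x p)
  linarith

lemma geo_trick {A C M : ℝ} (h : ∀ m : ℕ, A ≤ C + M * (1/2)^m) : A ≤ C := by
  have : Filter.Tendsto (fun m : ℕ => C + M * (1/2:ℝ)^m) Filter.atTop (𝓝 (C + M * 0)) :=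
    ((tendsto_pow_atTop_nhds_zero_of_lt_one (by norm_num) (by norm_num)).const_mul M).const_add C
  have h2 := ge_of_tendsto' this h
  simpa using h2

/-- step 1 -/
lemma step_one {N : ℕ} {K : Set (Fin N → ℂ)} {γ : ℝ → Fin N → ℂ} (hK : IsCompact K) (hpc : IsPolynomiallyConvex K)
    (hc : ContinuousOn γ (Icc 0 1)) (hinj : InjOn γ (Icc 0 1)) (hBV : BoundedVariationOn γ (Icc 0 1))
    (h0 : γ 0 ∈ K) (h1 : γ 1 ∈ K) (hout : ∀ t ∈ Ioo (0:ℝ) 1, γ t ∉ K) {s t : ℝ} (hs : 0 ≤ s) (hst : s < t) (ht : t ≤ 1)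
    {l : MvPolynomial (Fin N) ℂ} (hl : ∀ r ∈ Ioo s t, eval (γ r) l = 0) {x : Fin N → ℂ} (hx : x ∈ polyHull (K ∪ γ '' Icc 0 1)) (hlx : eval x l ≠ 0) :
    x ∈ K ∪ γ '' Icc 0 1 := by
  have hXc : IsCompact (K ∪ γ '' Icc 0 1) := compactSpace_attach hK hc
  obtain ⟨gc, gp⟩ := thmA_gap hK hpc hc hinj hBV h0 h1 hout (a := (2*s+t)/3) (b := (s+2*t)/3) (by linarith) (by linarith) (by linarith)
  apply gap_sub (a := (2*s+t)/3) (b := (s+2*t)/3) (by linarith) (by linarith)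
  rw [← (show polyHull _ = _ from gp), mem_polyHull_iff gc]
  intro p C hC
  have hC0 : 0 ≤ C := (norm_nonneg _).trans (hC (γ 0) (Or.inl (Or.inl h0)))
  obtain ⟨M, hM, hM'⟩ := poly_bdd hXc l
  apply root_trick (c := ‖eval x l‖) (M := M) (norm_pos_iff.2 hlx) hC0
  intro m
  have := (mem_polyHull_iff hXc).1 hx (l * p ^ m) (M * C ^ m) (by
    intro y hy
    rw [map_mul, map_pow, norm_mul, norm_pow]
    rcases icc_split (a := (2*s+t)/3) (b := (s+2*t)/3) hy with h | ⟨r, hr, rfl⟩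
    · gcongr
      · exact hM' y hy
      · exact hC y h
    · rw [hl r ⟨by linarith [hr.1], by linarith [hr.2]⟩]
      simp; positivity)
  rwa [map_mul, map_pow, norm_mul, norm_pow] at this

theorem thmB {N : ℕ} {K : Set (Fin N → ℂ)} {γ : ℝ → Fin N → ℂ} (hK : IsCompact K) (hpc : IsPolynomiallyConvex K)
    (hc : ContinuousOn γ (Icc 0 1)) (hinj : InjOn γ (Icc 0 1)) (hBV : BoundedVariationOn γ (Icc 0 1))
    (h0 : γ 0 ∈ K) (h1 : γ 1 ∈ K) (hout : ∀ t ∈ Ioo (0:ℝ) 1, γ t ∉ K) {s t : ℝ} (hs : 0 ≤ s) (hst : s < t) (ht : t ≤ 1)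
    {L : Set (Fin N → ℂ)} (hL : IsComplexAffineLine L) (hγL : γ '' Ioo s t ⊆ L) (hnL : ¬ γ '' Icc 0 1 ⊆ L) : IsPolynomiallyConvex (K ∪ γ '' Icc 0 1) := by
  have hXc : IsCompact (K ∪ γ '' Icc 0 1) := compactSpace_attach hK hc
  obtain ⟨l, hl⟩ := line_polys hL
  have hhull : ∀ y ∈ polyHull (K ∪ γ '' Icc 0 1), y ∈ K ∪ γ '' Icc 0 1 ∨ y ∈ L := by
    intro y hy
    by_cases h : y ∈ L
    · exact Or.inr h
    · left
      rw [hl] at h; push Not at h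
      obtain ⟨j, hj⟩ := h
      exact step_one hK hpc hc hinj hBV h0 h1 hout hs hst ht (fun r hr => (hl _).1 (hγL ⟨r, hr, rfl⟩) j) hy hj
  apply pc_of hXc
  intro x hx
  by_contra hxX
  have hxL : x ∈ L := (hhull x hx).resolve_left hxX
  have hLc : IsClosed L := by
    have : L = ⋂ j, {z | eval z (l j) = 0} := by ext z; simp [hl]
    rw [this]
    exact isClosed_iInter fun j => isClosed_eq (MvPolynomial.continuous_eval _) continuous_const
  obtain ⟨tc, htc, hcL⟩ : ∃ tc ∈ Ioo (0:ℝ) 1, γ tc ∉ L := by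
    by_contra! hcon
    apply hnL
    have h2 : MapsTo γ (closure (Ioo (0:ℝ) 1)) (closure L) := MapsTo.closure_of_continuousOn hcon (by rwa [closure_Ioo (by norm_num)])
    rw [closure_Ioo (by norm_num), hLc.closure_eq] at h2
    exact h2.image_subset
  rw [hl] at hcL; push Not at hcL
  obtain ⟨j, hj⟩ := hcL
  obtain ⟨M, hM, hM'⟩ := poly_bdd hK (l j)
  have hljc : 0 < ‖eval (γ tc) (l j)‖ := norm_pos_iff.2 hj
  obtain ⟨p0, hp0, hp0K⟩ := pc_sep hK hpc (hout tc htc) (ε := ‖eval (γ tc) (l j)‖ / (4 * M)) (by positivity)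
  let p : MvPolynomial (Fin N) ℂ := MvPolynomial.C ((eval (γ tc) (l j))⁻¹) * l j * p0
  have hpe : ∀ z, eval z p = (eval (γ tc) (l j))⁻¹ * eval z (l j) * eval z p0 := fun z => by simp [p]
  have hpc1 : eval (γ tc) p = 1 := by rw [hpe, hp0, inv_mul_cancel₀ hj, mul_one]
  have hpL : ∀ z ∈ L, eval z p = 0 := fun z hz => by rw [hpe, (hl z).1 hz j]; simp
  have hpK : ∀ z ∈ K, ‖eval z p‖ ≤ 1/4 := fun z hz => by
    rw [hpe, norm_mul, norm_mul, norm_inv]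
    calc _ ≤ ‖eval (γ tc) (l j)‖⁻¹ * M * (‖eval (γ tc) (l j)‖ / (4 * M)) := by
          gcongr
          · exact hM' z hz
          · exact hp0K z hz
      _ = 1/4 := by field_simp
  have hYc := hull_compact hXc
  have hYpc := hull_pc hXc
  have hXY := subset_hull hXc
  obtain ⟨Y, hY⟩ : ∃ Y, polyHull (K ∪ γ '' Icc 0 1) = Y := ⟨_, rfl⟩
  rw [hY] at hx hYc hYpc hXY hhull
  have : CompactSpace Y := isCompact_iff_compactSpace.1 hYc
  have : Nonempty Y := ⟨⟨x, hx⟩⟩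
  obtain ⟨g, hg1, hg2, hg3, hg4, hg5⟩ := reparam (zero_lt_one (α := ℝ)) hc hinj hBV
  have hfar : ∀ z, z ∈ K ∪ L → 1/2 ≤ ‖eval z p - 1‖ := by
    intro z hz
    have hz' : ‖eval z p‖ ≤ 1/4 := by
      rcases hz with hz | hz
      · exact hpK z hz
      · rw [hpL z hz]; norm_num
    have := norm_sub_norm_le (1:ℂ) (eval z p)
    rw [norm_sub_rev, norm_one] at this
    linarith
  have hfar' : ∀ z, z ∈ K ∪ L → eval z p ∉ Metric.closedBall (1:ℂ) (1/2) := by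
    intro z hz h
    have hz' : ‖eval z p‖ ≤ 1/4 := by
      rcases hz with hz | hz
      · exact hpK z hz
      · rw [hpL z hz]; norm_num
    have := norm_sub_norm_le (1:ℂ) (eval z p)
    rw [norm_sub_rev, norm_one] at this
    rw [mem_closedBall_iff_norm] at h
    linarith
  have hvol : volume (Metric.closedBall (1:ℂ) (1/2) ∩ range (evC Y p)) = 0 := by
    obtain ⟨Lc, hLc⟩ := (BL.poly hg1 p).lip
    refine measure_mono_null ?_ (vol_lip_image (hLc.lipschitzOnWith (s := Icc 0 1)))
    rintro _ ⟨hw, ⟨y, hy⟩, rfl⟩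
    rw [evC_apply] at hw ⊢
    rcases hhull y hy with (hyK | hyγ) | hyL
    · exact absurd hw (hfar' y (Or.inl hyK))
    · rw [← hg5] at hyγ
      obtain ⟨r, hr, rfl⟩ := hyγ
      exact ⟨r, hr, rfl⟩
    · exact absurd hw (hfar' y (Or.inr hyL))
  have hmem : ∀ a, evC Y a ∈ (evC Y).range.topologicalClosure := fun a => Subalgebra.le_topologicalClosure _ ⟨a, rfl⟩
  obtain ⟨b, hbB, hb⟩ := bump (evC Y).range.topologicalClosure (Subalgebra.isClosed_topologicalClosure _) (hmem p) (ζ := 1) (r := 1/2) (by norm_num) hvol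
    (fun w _ hw => resC_mem hYc hYpc p hw)
  -- the cutoff function
  obtain ⟨q, hqB, hq⟩ : ∃ q ∈ (evC Y).range.topologicalClosure, ∀ y : Y, q y = ((4 * (min (1/2) ‖eval y.1 p - 1‖)^2 : ℝ) : ℂ) := by
    refine ⟨1 - (4:ℂ) • b, Subalgebra.sub_mem _ (Subalgebra.one_mem _) (Subalgebra.smul_mem _ hbB _), fun y => ?_⟩
    rw [ContinuousMap.sub_apply, ContinuousMap.smul_apply, hb, evC_apply]
    push_cast
    rw [smul_eq_mul]
    change (1:ℂ) - _ = _
    ring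
  have hq1 : ∀ y, ‖q y‖ ≤ 1 := by
    intro y
    rw [hq, Complex.norm_real, Real.norm_of_nonneg (by positivity)]
    have h1 : min (1/2) ‖eval y.1 p - 1‖ ≤ 1/2 := min_le_left _ _
    have h2 : 0 ≤ min (1/2) ‖eval y.1 p - 1‖ := le_min (by norm_num) (norm_nonneg _)
    nlinarith
  have hqx : q ⟨x, hx⟩ = 1 := by
    rw [hq, min_eq_left (hfar x (Or.inr hxL))]; norm_num
  -- near tc
  obtain ⟨δ, hδ, hδ1, hδ2, hnear⟩ : ∃ δ > 0, 0 < tc - δ ∧ tc + δ < 1 ∧ ∀ r, |r - tc| < δ → ‖eval (γ r) p - 1‖ ≤ 1/4 := by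
    have hcat : ContinuousAt γ tc := hc.continuousAt (Icc_mem_nhds htc.1 htc.2)
    have hcp : ContinuousAt (fun r => eval (γ r) p) tc := (MvPolynomial.continuous_eval p).continuousAt.comp hcat
    obtain ⟨δ, hδ, h⟩ := Metric.continuousAt_iff.1 hcp (1/4) (by norm_num)
    have hm : 0 < min tc (1 - tc) := lt_min htc.1 (by linarith [htc.2])
    have m1 := min_le_left tc (1 - tc)
    have m2 := min_le_right tc (1 - tc)
    have m3 := min_le_left δ (min tc (1-tc) / 2)
    have m4 := min_le_right δ (min tc (1-tc) / 2)
    refine ⟨min δ (min tc (1-tc) / 2), lt_min hδ (by linarith), by linarith, by linarith, fun r hr => ?_⟩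
    have := h (x := r) (by rw [Real.dist_eq]; linarith)
    rw [hpc1, dist_eq_norm] at this
    exact this.le
  obtain ⟨gc, gp⟩ := thmA_gap hK hpc hc hinj hBV h0 h1 hout (a := tc - δ) (b := tc + δ) hδ1 (by linarith) hδ2
  apply hxX
  apply gap_sub (a := tc - δ) (b := tc + δ) (by linarith) (by linarith)
  rw [← (show polyHull _ = _ from gp), mem_polyHull_iff gc]
  intro f C hC
  have hC0 : 0 ≤ C := (norm_nonneg _).trans (hC (γ 0) (Or.inl (Or.inl h0)))
  obtain ⟨M2, hM2, hM2'⟩ := poly_bdd hXc f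
  apply geo_trick (M := M2)
  intro m
  have key := clos_hull hXc hY hXY hx (h := evC Y f * q ^ m) (Subalgebra.mul_mem _ (hmem f) (Subalgebra.pow_mem _ hqB m)) (C := C + M2 * (1/2)^m) (by
    intro y hy
    rw [ContinuousMap.mul_apply, ContinuousMap.pow_apply, norm_mul, norm_pow, evC_apply]
    rcases icc_split (a := tc - δ) (b := tc + δ) hy with h | ⟨r, hr, rfl⟩
    · have e1 : ‖q ⟨y, hXY hy⟩‖ ^ m ≤ 1 := pow_le_one₀ (norm_nonneg _) (hq1 _)
      have e2 := hC y h
      have e3 : ‖eval y f‖ * ‖q ⟨y, hXY hy⟩‖ ^ m ≤ C * 1 := by gcongr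
      have e4 : 0 ≤ M2 * (1/2:ℝ)^m := by positivity
      simp only at e3 ⊢
      linarith
    · have e1 : ‖q ⟨γ r, hXY hy⟩‖ ≤ 1/2 := by
        rw [hq, Complex.norm_real, Real.norm_of_nonneg (by positivity)]
        have h1 : min (1/2) ‖eval (γ r) p - 1‖ ≤ 1/4 := (min_le_right _ _).trans (hnear r (abs_lt.2 ⟨by linarith [hr.1], by linarith [hr.2]⟩))
        have h2 : 0 ≤ min (1/2) ‖eval (γ r) p - 1‖ := le_min (by norm_num) (norm_nonneg _)
        simp only
        nlinarith
      have e2 := hM2' _ hy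
      have e3 : ‖eval (γ r) f‖ * ‖q ⟨γ r, hXY hy⟩‖ ^ m ≤ M2 * (1/2)^m := by gcongr
      simp only at e3 ⊢
      linarith)
  rw [ContinuousMap.mul_apply, ContinuousMap.pow_apply, hqx, one_pow, mul_one, evC_apply] at key
  exact key

end

/-- Attaching finitely many disjoint rectifiable arcs, each partly lying in a complex
affine line not containing all of it and each meeting a compact polynomially convex set
`K` exactly in its endpoints, preserves polynomial convexity. -/
theorem stmt_14 (N : ℕ) (K : Set (Fin N → ℂ)) (hKcomp : IsCompact K)
    (hKpc : IsPolynomiallyConvex K) (u : ℕ) (γ : Fin u → ℝ → (Fin N → ℂ))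
    (hcont : ∀ j, ContinuousOn (γ j) (Icc 0 1)) (hinj : ∀ j, InjOn (γ j) (Icc 0 1))
    (hBV : ∀ j, BoundedVariationOn (γ j) (Icc 0 1))
    (lam : Fin u → Set (Fin N → ℂ)) (hlam : ∀ j, γ j '' Icc 0 1 = lam j)
    (hdisj : Pairwise (Function.onFun Disjoint lam))
    (hend0 : ∀ j, γ j 0 ∈ K) (hend1 : ∀ j, γ j 1 ∈ K)
    (hmeet : ∀ j, lam j ∩ K = {γ j 0, γ j 1})
    (hline : ∀ j, ∃ (L : Set (Fin N → ℂ)) (s t : ℝ), IsComplexAffineLine L ∧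
      0 ≤ s ∧ s < t ∧ t ≤ 1 ∧ γ j '' Ioo s t ⊆ L ∧ ¬ lam j ⊆ L) :
    IsPolynomiallyConvex (K ∪ ⋃ j, lam j) := by
  have key : ∀ S : Finset (Fin u), IsCompact (K ∪ ⋃ j ∈ S, lam j) ∧ IsPolynomiallyConvex (K ∪ ⋃ j ∈ S, lam j) := by
    intro S
    induction S using Finset.induction_on with
    | empty => simpa using ⟨hKcomp, hKpc⟩
    | insert j S hj ih =>
      have e : K ∪ ⋃ i ∈ insert j S, lam i = (K ∪ ⋃ i ∈ S, lam i) ∪ γ j '' Icc 0 1 := by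
        rw [Finset.set_biUnion_insert, hlam, union_assoc, union_comm (lam j)]
      rw [e]
      refine ⟨compactSpace_attach ih.1 (hcont j), ?_⟩
      obtain ⟨L, s, t, hL, hs, hst, ht, hsub, hn⟩ := hline j
      refine thmB ih.1 ih.2 (hcont j) (hinj j) (hBV j) (Or.inl (hend0 j)) (Or.inl (hend1 j)) ?_ hs hst ht hL hsub (by rwa [hlam])
      intro r hr
      have hrI : r ∈ Icc (0:ℝ) 1 := ⟨hr.1.le, hr.2.le⟩
      have hrl : γ j r ∈ lam j := by rw [← hlam]; exact ⟨r, hrI, rfl⟩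
      rintro (h | h)
      · have h2 : γ j r ∈ lam j ∩ K := ⟨hrl, h⟩
        rw [hmeet] at h2
        rcases h2 with h2 | h2
        · exact hr.1.ne' (hinj j hrI (by simp) h2)
        · exact hr.2.ne (hinj j hrI (by simp) h2)
      · simp only [mem_iUnion] at h
        obtain ⟨i, hi, h⟩ := h
        have hij : j ≠ i := by rintro rfl; exact hj hi
        exact Set.disjoint_left.1 (hdisj hij) hrl h
  have := (key Finset.univ).2
  simpa using this

end
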